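/- Let 𝒞 be a hereditary class of graphs. The following are equivalent: (i) for every positive integer p, 𝒞 is strongly χ_p-bounded; (ii) for each positive integer t, the class 𝒞_t = {G ∈ 𝒞 : ω(G) ≤ t} has bounded expansion; (iii) 𝒞 has ω-bounded expansion; (iv) 𝒞 is χ-bounded, there exists an integer s with K_{s,s} ∉ 𝒞, and for every positive integer r, d̄(ITM_r^e(𝒞)) < ∞; (v) every connected acyclically oriented graph has a restricted dual for the class of all orientations of graphs in 𝒞. -/

import Mathlib

open SimpleGraph

/-! ## Basic containment relations between graphs -/

/-- `H` is isomorphic to a (not necessarily induced) subgraph of `G`. -/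
def IsSubgraphOf {V W : Type*} (H : SimpleGraph V) (G : SimpleGraph W) : Prop :=
  ∃ f : H →g G, Function.Injective f

/-- `H` is isomorphic to an induced subgraph of `G`. -/
def IsInducedSubgraphOf {V W : Type*} (H : SimpleGraph V) (G : SimpleGraph W) : Prop :=
  Nonempty (H ↪g G)

/-- The clique number `ω(G)`: the largest `m` such that `K_m` is a subgraph of `G`. -/
noncomputable def omegaNum {V : Type*} (G : SimpleGraph V) : ℕ :=
  sSup {m | IsSubgraphOf (⊤ : SimpleGraph (Fin m)) G}

/-- The chromatic number `χ(G)` (as a natural number). -/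
noncomputable def chi {V : Type*} (G : SimpleGraph V) : ℕ :=
  sInf {N | G.Colorable N}

/-! ## Tree-depth and the invariants `χ_p` -/

/-- A forest order: a partial order in which the down-set of every element is a chain.
Such orders are exactly the ancestor orders of rooted forests. -/
def IsForestOrder {V : Type*} (r : V → V → Prop) : Prop :=
  (∀ v, r v v) ∧ (∀ u v, r u v → r v u → u = v) ∧
  (∀ u v w, r u v → r v w → r u w) ∧
  (∀ u v w, r u w → r v w → r u v ∨ r v u)

/-- `G` has tree-depth at most `h`: `G` is a subgraph of the closure of a rooted forest
of height at most `h` (height = maximum number of vertices on a root-to-leaf path). -/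
def TreeDepthLE {V : Type*} (G : SimpleGraph V) (h : ℕ) : Prop :=
  ∃ r : V → V → Prop, IsForestOrder r ∧
    (∀ u v, G.Adj u v → r u v ∨ r v u) ∧
    (∀ v, {u | r u v}.ncard ≤ h)

/-- The tree-depth `td(G)`. -/
noncomputable def treeDepth {V : Type*} (G : SimpleGraph V) : ℕ :=
  sInf {h | TreeDepthLE G h}

/-- `χ_p(G)`: the least number of colors of a vertex coloring such that every set `I` of at
most `p` colors induces a subgraph of tree-depth at most `|I|`. -/
noncomputable def chiP {V : Type*} (G : SimpleGraph V) (p : ℕ) : ℕ :=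
  sInf {N | ∃ c : V → Fin N, ∀ I : Finset (Fin N), I.card ≤ p →
    TreeDepthLE (G.induce {v | c v ∈ I}) I.card}

/-! ## Star colorings -/

/-- A star coloring: a proper coloring with no path on `4` vertices using only two colors. -/
def IsStarColoring {V α : Type*} (G : SimpleGraph V) (c : V → α) : Prop :=
  (∀ u v, G.Adj u v → c u ≠ c v) ∧
  ∀ x y z w : V, G.Adj x y → G.Adj y z → G.Adj z w →
    x ≠ z → y ≠ w → x ≠ w → ¬(c x = c z ∧ c y = c w)

/-- The star chromatic number `χ_s(G)`. -/
noncomputable def starChi {V : Type*} (G : SimpleGraph V) : ℕ :=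
  sInf {N | ∃ c : V → Fin N, IsStarColoring G c}

/-! ## Subdivisions -/

/-- The edges of a graph on `Fin n`, presented as increasingly ordered pairs. -/
def Edges {n : ℕ} (H : SimpleGraph (Fin n)) : Type :=
  {p : Fin n × Fin n // p.1 < p.2 ∧ H.Adj p.1 p.2}

/-- Base relation of the subdivision of `H`, where the edge `e` receives `t e` internal
vertices. -/
def subdivRel {n : ℕ} (H : SimpleGraph (Fin n)) (t : Edges H → ℕ) :
    (Fin n ⊕ Σ e : Edges H, Fin (t e)) → (Fin n ⊕ Σ e : Edges H, Fin (t e)) → Prop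
  | Sum.inl u, Sum.inl v => ∃ h : u < v ∧ H.Adj u v, t ⟨(u, v), h⟩ = 0
  | Sum.inl u, Sum.inr ⟨e, i⟩ =>
      (u = e.1.1 ∧ (i : ℕ) = 0) ∨ (u = e.1.2 ∧ (i : ℕ) + 1 = t e)
  | Sum.inr ⟨e, i⟩, Sum.inr ⟨e', j⟩ => e = e' ∧ (i : ℕ) + 1 = (j : ℕ)
  | _, _ => False

/-- The subdivision of `H` in which each edge `e` is replaced by a path with exactly `t e`
internal vertices. In particular `Subdiv H (fun _ => r)` is the `r`-subdivision `H^{(r)}`,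
and the `(≤ r)`-subdivisions of `H` are the graphs `Subdiv H t` with `t e ≤ r` for all `e`. -/
def Subdiv {n : ℕ} (H : SimpleGraph (Fin n)) (t : Edges H → ℕ) :
    SimpleGraph (Fin n ⊕ Σ e : Edges H, Fin (t e)) :=
  SimpleGraph.fromRel (subdivRel H t)

/-- `H ∈ TM_r(G)`: some `(≤ r)`-subdivision of `H` is a subgraph of `G`. -/
def MemTM {W : Type*} (r : ℕ) (G : SimpleGraph W) {n : ℕ} (H : SimpleGraph (Fin n)) : Prop :=
  ∃ t : Edges H → ℕ, (∀ e, t e ≤ r) ∧ IsSubgraphOf (Subdiv H t) G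

/-- `H ∈ ITM_r^e(G)`: the exact `r`-subdivision of `H` is an induced subgraph of `G`. -/
def MemITM {W : Type*} (r : ℕ) (G : SimpleGraph W) {n : ℕ} (H : SimpleGraph (Fin n)) : Prop :=
  IsInducedSubgraphOf (Subdiv H (fun _ => r)) G

/-- `ω(TM_r(G))`: the supremum of the clique numbers of the graphs in `TM_r(G)`. -/
noncomputable def omegaTM {W : Type*} (r : ℕ) (G : SimpleGraph W) : ℕ :=
  sSup {m | ∃ (k : ℕ) (H : SimpleGraph (Fin k)), MemTM r G H ∧ omegaNum H = m}

/-- The biclique number `bω(G)`: the largest `s` with `K_{s,s}` a subgraph of `G`. -/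
noncomputable def bomega {V : Type*} (G : SimpleGraph V) : ℕ :=
  sSup {s | IsSubgraphOf (completeBipartiteGraph (Fin s) (Fin s)) G}

/-- The average degree `d̄(G) = 2|E(G)|/|V(G)|`. -/
noncomputable def avgDeg {n : ℕ} (G : SimpleGraph (Fin n)) : ℝ :=
  2 * (G.edgeSet.ncard : ℝ) / n

/-! ## Classes of graphs -/

/-- A class of (finite, simple) graphs: for each `n`, a set of graphs on `Fin n`.
Classes are implicitly closed under isomorphism via the relations used below. -/
def GraphClass := ∀ n : ℕ, Set (SimpleGraph (Fin n))

/-- A hereditary class: closed under induced subgraphs (hence under isomorphism). -/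
def Hereditary (C : GraphClass) : Prop :=
  ∀ ⦃n m : ℕ⦄ (G : SimpleGraph (Fin n)) (H : SimpleGraph (Fin m)),
    G ∈ C n → IsInducedSubgraphOf H G → H ∈ C m

/-- A monotone class: closed under subgraphs (hence under isomorphism). -/
def MonotoneClass (C : GraphClass) : Prop :=
  ∀ ⦃n m : ℕ⦄ (G : SimpleGraph (Fin n)) (H : SimpleGraph (Fin m)),
    G ∈ C n → IsSubgraphOf H G → H ∈ C m

/-- `H ∈ TM_r(𝒞)`. -/
def MemTMClass (r : ℕ) (C : GraphClass) {m : ℕ} (H : SimpleGraph (Fin m)) : Prop :=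
  ∃ (n : ℕ) (G : SimpleGraph (Fin n)), G ∈ C n ∧ MemTM r G H

/-- `H ∈ ITM_r^e(𝒞)`. -/
def MemITMClass (r : ℕ) (C : GraphClass) {m : ℕ} (H : SimpleGraph (Fin m)) : Prop :=
  ∃ (n : ℕ) (G : SimpleGraph (Fin n)), G ∈ C n ∧ MemITM r G H

/-- `𝒞` is `χ`-bounded: `χ(H) ≤ f(ω(H))` for every induced subgraph `H` of a graph of `𝒞`. -/
def ChiBounded (C : GraphClass) : Prop :=
  ∃ f : ℕ → ℕ, ∀ ⦃n : ℕ⦄ (G : SimpleGraph (Fin n)), G ∈ C n →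
    ∀ ⦃m : ℕ⦄ (H : SimpleGraph (Fin m)), IsInducedSubgraphOf H G →
      chi H ≤ f (omegaNum H)

/-- `𝒞` has bounded expansion: for every `r`, `d̄(TM_r(𝒞)) < ∞`. -/
def BoundedExpansion (C : GraphClass) : Prop :=
  ∀ r : ℕ, ∃ d : ℝ, ∀ ⦃m : ℕ⦄ (H : SimpleGraph (Fin m)), MemTMClass r C H → avgDeg H ≤ d

/-- `𝒞` has `ω`-bounded expansion. -/
def OmegaBoundedExpansion (C : GraphClass) : Prop :=
  ∃ f : ℕ → ℕ → ℝ, ∀ ⦃n : ℕ⦄ (G : SimpleGraph (Fin n)), G ∈ C n →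
    ∀ (r : ℕ) ⦃m : ℕ⦄ (H : SimpleGraph (Fin m)), MemTM r G H →
      avgDeg H ≤ f (omegaNum G) r

/-- `𝒞` is nowhere dense: for every `r`, `ω(TM_r(𝒞)) < ∞`. -/
def NowhereDense (C : GraphClass) : Prop :=
  ∀ r : ℕ, ∃ c : ℕ, ∀ ⦃m : ℕ⦄ (H : SimpleGraph (Fin m)), MemTMClass r C H → omegaNum H ≤ c

/-- `𝒞` is strongly `χ_p`-bounded: `χ_p(G) ≤ f_p(ω(G))` on `𝒞`. -/
def StronglyChiPBounded (C : GraphClass) (p : ℕ) : Prop :=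
  ∃ f : ℕ → ℕ, ∀ ⦃n : ℕ⦄ (G : SimpleGraph (Fin n)), G ∈ C n → chiP G p ≤ f (omegaNum G)

/-- `𝒞` is weakly `χ_p`-bounded: `χ_p(G) ≤ g_p(ω(TM_{p-1}(G)))` on `𝒞`. -/
def WeaklyChiPBounded (C : GraphClass) (p : ℕ) : Prop :=
  ∃ g : ℕ → ℕ, ∀ ⦃n : ℕ⦄ (G : SimpleGraph (Fin n)), G ∈ C n → chiP G p ≤ g (omegaTM (p - 1) G)

/-! ## Directed graphs, orientations and restricted dualities -/

/-- Existence of a homomorphism between directed graphs presented as binary relations. -/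
def DigraphHomEx {n m : ℕ} (A : Fin n → Fin n → Prop) (B : Fin m → Fin m → Prop) : Prop :=
  ∃ f : Fin n → Fin m, ∀ u v, A u v → B (f u) (f v)

/-- `A` is an orientation of the graph `G`. -/
def IsOrientationOf {n : ℕ} (A : Fin n → Fin n → Prop) (G : SimpleGraph (Fin n)) : Prop :=
  (∀ u v, ¬(A u v ∧ A v u)) ∧ (∀ u v, G.Adj u v ↔ (A u v ∨ A v u))

/-- A directed graph is acyclic if it has no directed cycle. -/
def IsAcyclicDigraph {n : ℕ} (A : Fin n → Fin n → Prop) : Prop :=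
  ∀ v, ¬ Relation.TransGen A v v

/-- The directed graph `F` has a restricted dual for the class of all orientations of the
graphs of `𝒞`. -/
def HasRestrictedDualForOrientations (C : GraphClass) {nF : ℕ}
    (F : Fin nF → Fin nF → Prop) : Prop :=
  ∃ (m : ℕ) (D : Fin m → Fin m → Prop),
    ¬ DigraphHomEx F D ∧
    ∀ ⦃n : ℕ⦄ (A : Fin n → Fin n → Prop) (G : SimpleGraph (Fin n)),
      G ∈ C n → IsOrientationOf A G →
      (¬ DigraphHomEx F A ↔ DigraphHomEx A D)

/-! ## Holes -/

/-- The number `h_g(G)` of holes of length `g` in `G`, i.e. of vertex subsets inducing a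
cycle on `g` vertices. -/
noncomputable def holeCount {n : ℕ} (g : ℕ) (G : SimpleGraph (Fin n)) : ℕ :=
  {S : Set (Fin n) | Nonempty (G.induce S ≃g SimpleGraph.cycleGraph g)}.ncard

/-- `G` is even hole-free: it has no induced cycle of even length at least `4`. -/
def EvenHoleFree {n : ℕ} (G : SimpleGraph (Fin n)) : Prop :=
  ∀ g : ℕ, 4 ≤ g → Even g → holeCount g G = 0

/-! ## Walks presented as sequences -/

/-- `a` and `b` are joined by a walk of `G` all of whose internal vertices lie in `P`. -/
def Link {V : Type*} (G : SimpleGraph V) (P : Set V) (a b : V) : Prop :=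
  ∃ (l : ℕ) (g : ℕ → V), g 0 = a ∧ g l = b ∧ (∀ s < l, G.Adj (g s) (g (s + 1))) ∧
    ∀ s, 0 < s → s < l → g s ∈ P

/-- The first `l + 1` terms of `g` form an induced path of `G`. -/
def IsInducedSeq {V : Type*} (G : SimpleGraph V) (g : ℕ → V) (l : ℕ) : Prop :=
  (∀ s < l, G.Adj (g s) (g (s + 1))) ∧
    ∀ s t, s < t → t ≤ l → g s ≠ g t ∧ (s + 1 < t → ¬ G.Adj (g s) (g t))

section Link

variable {V : Type*} {G : SimpleGraph V} {P Q : Set V} {a b c : V}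

theorem Link.mono (h : Link G P a b) (hPQ : P ⊆ Q) : Link G Q a b := by
  obtain ⟨l, g, h0, hl, hadj, hP⟩ := h
  exact ⟨l, g, h0, hl, hadj, fun s h1 h2 => hPQ (hP s h1 h2)⟩

theorem Link.of_adj (h : G.Adj a b) : Link G P a b :=
  ⟨1, fun s => if s = 0 then a else b, by simp, by simp,
    fun s hs => by obtain rfl : s = 0 := by omega
                   simpa using h,
    fun s h1 h2 => by omega⟩

theorem Link.symm (h : Link G P a b) : Link G P b a := by
  obtain ⟨l, g, h0, hl, hadj, hP⟩ := h
  refine ⟨l, fun s => g (l - s), by simpa using hl, by simpa using h0, fun s hs => ?_,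
    fun s h1 h2 => hP _ (by omega) (by omega)⟩
  have := hadj (l - (s + 1)) (by omega)
  rw [show l - (s + 1) + 1 = l - s by omega] at this
  exact this.symm

theorem Link.trans (h : Link G P a b) (h' : Link G P b c) (hb : b ∈ P) : Link G P a c := by
  obtain ⟨l, g, h0, hl, hadj, hP⟩ := h
  obtain ⟨m, f, f0, fm, fadj, fP⟩ := h'
  refine ⟨l + m, fun s => if s ≤ l then g s else f (s - l), by simpa using h0, ?_,
    fun s hs => ?_, fun s h1 h2 => ?_⟩
  · rcases Nat.eq_zero_or_pos m with rfl | hm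
    · simp [hl, ← fm, f0]
    · dsimp only
      rw [if_neg (by omega)]
      simpa using fm
  · dsimp only
    rcases lt_trichotomy s l with h | rfl | h
    · rw [if_pos (by omega), if_pos (by omega)]
      exact hadj s h
    · rw [if_pos le_rfl, if_neg (by omega), hl, ← f0, show s + 1 - s = 0 + 1 by omega]
      exact fadj 0 (by omega)
    · rw [if_neg (by omega), if_neg (by omega), show s + 1 - l = s - l + 1 by omega]
      exact fadj _ (by omega)
  · dsimp only
    split_ifs with h
    · rcases lt_or_eq_of_le h with h | rfl
      · exact hP s h1 h
      · rwa [hl]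
    · exact fP _ (by omega) (by omega)

theorem Link.exists_isInducedSeq (h : Link G P a b) :
    ∃ (l : ℕ) (g : ℕ → V), g 0 = a ∧ g l = b ∧ (∀ s, 0 < s → s < l → g s ∈ P) ∧
      IsInducedSeq G g l := by
  classical
  have hex : ∃ l, ∃ g : ℕ → V, g 0 = a ∧ g l = b ∧ (∀ s < l, G.Adj (g s) (g (s + 1))) ∧
    ∀ s, 0 < s → s < l → g s ∈ P := h
  obtain ⟨g, h0, hl, hadj, hP⟩ := Nat.find_spec hex
  have hmin := fun m (hm : m < Nat.find hex) => Nat.find_min hex hm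
  generalize Nat.find hex = l at *
  refine ⟨l, g, h0, hl, hP, hadj, fun s t hst htl => ⟨fun heq => ?_, fun hst' hAdj => ?_⟩⟩
  · refine hmin (l - (t - s)) (by omega)
      ⟨fun x => if x ≤ s then g x else g (x + (t - s)), by simpa using h0, ?_, fun x hx => ?_,
        fun x h1 h2 => ?_⟩
    · dsimp only
      split_ifs with h
      · rw [show l - (t - s) = s by omega, heq, show t = l by omega, hl]
      · rw [show l - (t - s) + (t - s) = l by omega, hl]
    · dsimp only
      rcases lt_trichotomy x s with h | rfl | h
      · rw [if_pos (by omega), if_pos (by omega)]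
        exact hadj x (by omega)
      · rw [if_pos le_rfl, if_neg (by omega), heq, show x + 1 + (t - x) = t + 1 by omega]
        exact hadj t (by omega)
      · rw [if_neg (by omega), if_neg (by omega), show x + 1 + (t - s) = x + (t - s) + 1 by omega]
        exact hadj _ (by omega)
    · dsimp only
      split_ifs
      · exact hP x h1 (by omega)
      · exact hP _ (by omega) (by omega)
  · refine hmin (l - (t - s - 1)) (by omega)
      ⟨fun x => if x ≤ s then g x else g (x + (t - s - 1)), by simpa using h0, ?_, fun x hx => ?_,
        fun x h1 h2 => ?_⟩
    · dsimp only
      rw [if_neg (by omega), show l - (t - s - 1) + (t - s - 1) = l by omega, hl]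
    · dsimp only
      rcases lt_trichotomy x s with h | rfl | h
      · rw [if_pos (by omega), if_pos (by omega)]
        exact hadj x (by omega)
      · rw [if_pos le_rfl, if_neg (by omega), show x + 1 + (t - x - 1) = t by omega]
        exact hAdj
      · rw [if_neg (by omega), if_neg (by omega),
          show x + 1 + (t - s - 1) = x + (t - s - 1) + 1 by omega]
        exact hadj _ (by omega)
    · dsimp only
      split_ifs
      · exact hP x h1 (by omega)
      · exact hP _ (by omega) (by omega)

end Link

/-! ## Degenerate relations -/

section Degenerate

variable {V : Type*} [DecidableEq V] (conf : V → V → Prop)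

open Classical in
theorem exists_outNeighbor_of_degenerate (hsymm : ∀ u v, conf u v → conf v u) (k : ℕ)
    (S : Finset V)
    (h : ∀ T ⊆ S, T.Nonempty → ∃ v ∈ T, (T.filter fun u => conf v u).card ≤ k) :
    ∃ O : V → Finset V, (∀ v, (O v).card ≤ k) ∧
      ∀ u ∈ S, ∀ v ∈ S, u ≠ v → conf u v → u ∈ O v ∨ v ∈ O u := by
  induction hn : S.card generalizing S with
  | zero =>
    rw [Finset.card_eq_zero] at hn
    exact ⟨fun _ => ∅, by simp, by simp [hn]⟩
  | succ n ih =>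
    obtain ⟨v, hv, hvk⟩ := h S subset_rfl (Finset.card_pos.1 (by omega))
    obtain ⟨O, hO, hOS⟩ := ih (S.erase v)
      (fun T hT hne => h T (hT.trans (Finset.erase_subset _ _)) hne)
      (by rw [Finset.card_erase_of_mem hv]; omega)
    refine ⟨Function.update O v (S.filter fun u => conf v u), fun w => ?_, fun u hu w hw huw hc => ?_⟩
    · by_cases hwv : w = v
      · subst hwv; simpa using hvk
      · simpa [hwv] using hO w
    · by_cases huv : u = v
      · subst huv
        right
        simp [hw, hc]
      · by_cases hwv : w = v
        · subst hwv
          left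
          simp [hu, hsymm _ _ hc]
        · simpa [huv, hwv] using hOS u (by simp [huv, hu]) w (by simp [hwv, hw]) huw hc

open Classical in
theorem exists_coloring_of_degenerate (hsymm : ∀ u v, conf u v → conf v u) (k : ℕ)
    (S : Finset V)
    (h : ∀ T ⊆ S, T.Nonempty → ∃ v ∈ T, (T.filter fun u => conf v u).card ≤ k) :
    ∃ c : V → Fin (k + 1), ∀ u ∈ S, ∀ v ∈ S, u ≠ v → conf u v → c u ≠ c v := by
  induction hn : S.card generalizing S with
  | zero =>
    rw [Finset.card_eq_zero] at hn
    exact ⟨fun _ => 0, by simp [hn]⟩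
  | succ n ih =>
    obtain ⟨v, hv, hvk⟩ := h S subset_rfl (Finset.card_pos.1 (by omega))
    obtain ⟨c, hc⟩ := ih (S.erase v)
      (fun T hT hne => h T (hT.trans (Finset.erase_subset _ _)) hne)
      (by rw [Finset.card_erase_of_mem hv]; omega)
    have : ∃ x : Fin (k + 1), x ∉ (S.filter fun u => conf v u).image c := by
      by_contra! hall
      have h1 := Finset.card_le_card (show Finset.univ ⊆ (S.filter fun u => conf v u).image c from
        fun x _ => hall x)
      have h2 := Finset.card_image_le (s := S.filter fun u => conf v u) (f := c)
      simp at h1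
      omega
    obtain ⟨x, hx⟩ := this
    simp only [Finset.mem_image, Finset.mem_filter, not_exists, not_and, and_imp] at hx
    refine ⟨Function.update c v x, fun u hu w hw huw hcf => ?_⟩
    by_cases huv : u = v
    · subst huv
      have := hx w hw hcf
      simp [huw.symm]
      exact fun h => this h.symm
    · by_cases hwv : w = v
      · subst hwv
        simpa [huv] using hx u hu (hsymm _ _ hcf)
      · simpa [huv, hwv] using hc u (by simp [huv, hu]) w (by simp [hwv, hw]) huw hcf

open Classical in
theorem exists_independent_of_degenerate (hsymm : ∀ u v, conf u v → conf v u) (k : ℕ)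
    (S : Finset V)
    (h : ∀ T ⊆ S, T.Nonempty → ∃ v ∈ T, (T.filter fun u => conf v u).card ≤ k) :
    ∃ I ⊆ S, S.card ≤ (k + 1) * I.card ∧ ∀ u ∈ I, ∀ v ∈ I, u ≠ v → ¬ conf u v := by
  obtain ⟨c, hc⟩ := exists_coloring_of_degenerate conf hsymm k S h
  obtain ⟨x, -, hx⟩ := Finset.exists_le_card_fiber_of_nsmul_le_card_of_maps_to
    (s := S) (t := Finset.univ) (f := c) (b := (S.card : ℚ) / (k + 1)) (by simp) ⟨0, by simp⟩
    (by simp; field_simp; rfl)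
  refine ⟨S.filter fun u => c u = x, Finset.filter_subset _ _, ?_, ?_⟩
  · rw [div_le_iff₀ (by positivity)] at hx
    have : (S.card : ℚ) ≤ (((k + 1) * (S.filter fun u => c u = x).card : ℕ) : ℚ) := by
      push_cast; linarith
    exact_mod_cast this
  · intro u hu v hv huv hcf
    simp only [Finset.mem_filter] at hu hv
    exact hc u hu.1 v hv.1 huv hcf (hu.2.trans hv.2.symm)

open Classical in
theorem exists_le_of_card_pairs_le {S : Finset V} (hS : S.Nonempty) {k : ℕ}
    (h : ((S ×ˢ S).filter fun p => conf p.1 p.2).card ≤ k * S.card) :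
    ∃ v ∈ S, (S.filter fun u => conf v u).card ≤ k := by
  by_contra! hlt
  have : ((S ×ˢ S).filter fun p => conf p.1 p.2).card =
      ∑ v ∈ S, (S.filter fun u => conf v u).card := by
    rw [Finset.card_filter, Finset.sum_product]
    exact Finset.sum_congr rfl fun v _ => (Finset.card_filter _ _).symm
  have h2 : ∑ v ∈ S, k < ∑ v ∈ S, (S.filter fun u => conf v u).card :=
    Finset.sum_lt_sum_of_nonempty hS hlt
  simp at h2
  rw [this] at h
  linarith

end Degenerate

/-! ## Random restriction -/

theorem card_colorings_le {V : Type*} [Fintype V] [DecidableEq V] {a b : V} (hab : a ≠ b)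
    {Z : Finset V} (ha : a ∉ Z) (hb : b ∉ Z) {q : ℕ} (hq : 2 ≤ q) [NeZero q]
    (hZ : 2 * Z.card ≤ q) :
    q ^ Fintype.card V ≤ 2 * q ^ 2 * (Finset.univ.filter fun φ : V → Fin q =>
      φ a = 0 ∧ φ b = 0 ∧ ∀ z ∈ Z, φ z ≠ 0).card := by
  have hset : (Finset.univ.filter fun φ : V → Fin q => φ a = 0 ∧ φ b = 0 ∧ ∀ z ∈ Z, φ z ≠ 0) =
      Fintype.piFinset fun v => if v = a ∨ v = b then {0} else
        if v ∈ Z then Finset.univ.erase (0 : Fin q) else Finset.univ := by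
    ext φ
    simp only [Finset.mem_filter, Finset.mem_univ, true_and, Fintype.mem_piFinset]
    constructor
    · rintro ⟨h1, h2, h3⟩ v
      split_ifs with h h'
      · rcases h with rfl | rfl <;> simpa
      · simpa using h3 v h'
      · simp
    · intro h
      refine ⟨by simpa using h a, by simpa using h b, fun z hz => ?_⟩
      have := h z
      rw [if_neg (by rintro (rfl | rfl) <;> contradiction), if_pos hz] at this
      simpa using this
  rw [hset, Fintype.card_piFinset]
  have hprod : q ^ 2 * ∏ v : V, (if v = a ∨ v = b then ({0} : Finset (Fin q)) else
        if v ∈ Z then Finset.univ.erase (0 : Fin q) else Finset.univ).card =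
      (q - 1) ^ Z.card * q ^ (Fintype.card V - Z.card) := by
    have h1 : q ^ 2 = ∏ v : V, if v = a ∨ v = b then q else 1 := by
      rw [Finset.prod_ite]
      simp only [Finset.prod_const, Finset.prod_const_one, mul_one]
      rw [Finset.filter_or, Finset.card_union_of_disjoint]
      · simp [Finset.filter_eq']
      · simp [Finset.filter_eq', hab]
    have h2 : (q - 1) ^ Z.card * q ^ (Fintype.card V - Z.card) =
        ∏ v : V, if v ∈ Z then q - 1 else q := by
      rw [Finset.prod_ite]
      simp only [Finset.prod_const]
      congr 2
      · simp
      · rw [Finset.filter_not, Finset.card_sdiff_of_subset (Finset.filter_subset _ _)]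
        simp [Finset.card_univ]
    rw [h1, h2, ← Finset.prod_mul_distrib]
    refine Finset.prod_congr rfl fun v _ => ?_
    by_cases h : v = a ∨ v = b
    · have : v ∉ Z := by rcases h with rfl | rfl <;> assumption
      simp [h, this]
    · by_cases h' : v ∈ Z <;> simp [h, h']
  rw [mul_assoc, hprod]
  have hle : Z.card ≤ Fintype.card V := Finset.card_le_univ Z
  have hbern : q ^ Z.card ≤ 2 * (q - 1) ^ Z.card := by
    have hq0 : (0 : ℚ) < q := by exact_mod_cast (by omega : 0 < q)
    have h1 := one_add_mul_le_pow (a := -(1 / q : ℚ)) (by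
      have : (1 / q : ℚ) ≤ 1 := by rw [div_le_one hq0]; exact_mod_cast (by omega : 1 ≤ q)
      linarith) Z.card
    have h2 : (1 / 2 : ℚ) ≤ 1 + Z.card * -(1 / q : ℚ) := by
      have : (Z.card : ℚ) * (1 / q) ≤ 1 / 2 := by
        rw [mul_one_div, div_le_iff₀ hq0]
        have : (2 * Z.card : ℚ) ≤ q := by exact_mod_cast hZ
        linarith
      linarith
    have h3 : (1 + -(1 / q : ℚ)) = ((q - 1 : ℕ) : ℚ) / q := by
      rw [Nat.cast_sub (by omega)]; field_simp; push_cast; ring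
    rw [h3, div_pow] at h1
    have h4 : (1 / 2 : ℚ) * q ^ Z.card ≤ ((q - 1 : ℕ) : ℚ) ^ Z.card := by
      have := h2.trans h1
      rwa [le_div_iff₀ (by positivity)] at this
    have : ((q ^ Z.card : ℕ) : ℚ) ≤ ((2 * (q - 1) ^ Z.card : ℕ) : ℚ) := by
      push_cast at h4 ⊢; linarith
    exact_mod_cast this
  calc q ^ Fintype.card V = q ^ Z.card * q ^ (Fintype.card V - Z.card) := by
        rw [← pow_add]; congr 1; omega
    _ ≤ 2 * (q - 1) ^ Z.card * q ^ (Fintype.card V - Z.card) := by gcongr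
    _ = _ := by ring

/-- A random restriction of the vertex set keeps a large family of pairs that avoid their
forbidden sets. -/
theorem exists_restriction {V ι : Type*} [Fintype V] [DecidableEq V] (X : Finset V) (E : Finset ι)
    (a b : ι → V) (Z : ι → Finset V) (q L : ℕ) (hq : 2 ≤ q)
    (haX : ∀ i ∈ E, a i ∈ X) (hbX : ∀ i ∈ E, b i ∈ X)
    (hab : ∀ i ∈ E, a i ≠ b i) (haZ : ∀ i ∈ E, a i ∉ Z i) (hbZ : ∀ i ∈ E, b i ∉ Z i)
    (hZ : ∀ i ∈ E, 2 * (Z i).card ≤ q) (h : 2 * q * L * X.card < E.card) :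
    ∃ X' ⊆ X, L * X'.card <
      (E.filter fun i => a i ∈ X' ∧ b i ∈ X' ∧ Disjoint (Z i) X').card := by
  have : NeZero q := ⟨by omega⟩
  by_contra! hcon
  let Xs : (V → Fin q) → Finset V := fun φ => X.filter fun v => φ v = 0
  have hsum : ∑ φ : V → Fin q,
      (E.filter fun i => a i ∈ Xs φ ∧ b i ∈ Xs φ ∧ Disjoint (Z i) (Xs φ)).card ≤
      ∑ φ : V → Fin q, L * (Xs φ).card :=
    Finset.sum_le_sum fun φ _ => hcon _ (Finset.filter_subset _ _)
  have hX : q * ∑ φ : V → Fin q, (Xs φ).card = X.card * q ^ Fintype.card V := by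
    have h1 : ∑ φ : V → Fin q, (Xs φ).card =
        ∑ v ∈ X, (Finset.univ.filter fun φ : V → Fin q => φ v = 0).card := by
      simp only [Xs, Finset.card_filter]
      rw [Finset.sum_comm]
    rw [h1, Finset.mul_sum, Finset.sum_congr rfl (g := fun _ => q ^ Fintype.card V)]
    · simp
    · intro v _
      have : (Finset.univ.filter fun φ : V → Fin q => φ v = 0) =
          Fintype.piFinset fun u => if u = v then {0} else Finset.univ := by
        ext φ
        simp only [Finset.mem_filter, Finset.mem_univ, true_and, Fintype.mem_piFinset]
        constructor
        · rintro h u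
          split_ifs with hu
          · simpa [hu] using h
          · simp
        · intro h
          simpa using h v
      rw [this, Fintype.card_piFinset]
      have h2 : (∏ u : V, if u = v then q else 1) = q := by simp
      refine (congrArg (· * _) h2.symm).trans ?_
      rw [← Finset.prod_mul_distrib, Finset.prod_congr rfl (g := fun _ => q)]
      · simp [Finset.card_univ]
      · intro u _
        by_cases hu : u = v <;> simp [hu]
  have hE : E.card * q ^ Fintype.card V ≤ 2 * q ^ 2 * ∑ φ : V → Fin q,
      (E.filter fun i => a i ∈ Xs φ ∧ b i ∈ Xs φ ∧ Disjoint (Z i) (Xs φ)).card := by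
    simp only [Finset.card_filter]
    rw [Finset.sum_comm, Finset.mul_sum, ← smul_eq_mul, ← Finset.sum_const]
    refine Finset.sum_le_sum fun i hi => ?_
    rw [← Finset.card_filter]
    refine (card_colorings_le (hab i hi) (haZ i hi) (hbZ i hi) hq (hZ i hi)).trans ?_
    refine Nat.mul_le_mul_left _ (Finset.card_le_card fun φ hφ => ?_)
    simp only [Finset.mem_filter, Finset.mem_univ, true_and] at hφ ⊢
    refine ⟨by simp [Xs, haX i hi, hφ.1], by simp [Xs, hbX i hi, hφ.2.1], ?_⟩
    rw [Finset.disjoint_left]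
    intro z hz hz'
    exact hφ.2.2 z hz (Finset.mem_filter.1 hz').2
  have hpos : 0 < q ^ Fintype.card V := pow_pos (by omega) _
  rw [← Finset.mul_sum] at hsum
  have : E.card * q ^ Fintype.card V ≤ 2 * q * L * X.card * q ^ Fintype.card V := by
    calc E.card * q ^ Fintype.card V ≤ _ := hE
      _ ≤ 2 * q ^ 2 * (L * ∑ φ : V → Fin q, (Xs φ).card) := Nat.mul_le_mul_left _ hsum
      _ = 2 * q * L * (q * ∑ φ : V → Fin q, (Xs φ).card) := by ring
      _ = _ := by rw [hX]; ring
  have := Nat.le_of_mul_le_mul_right this hpos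
  omega

/-! ## Path systems and topological minors -/

/-- A family of paths, the `i`-th one with `t i` internal vertices, with ends in `B`, whose
interiors are disjoint from `B` and from each other; no two paths have the same ends. -/
structure IsPathSys {V ι : Type*} (G : SimpleGraph V) (B : Finset V) (q : ι → ℕ → V)
    (t : ι → ℕ) : Prop where
  fst_mem : ∀ i, q i 0 ∈ B
  lst_mem : ∀ i, q i (t i + 1) ∈ B
  ends_ne : ∀ i, q i 0 ≠ q i (t i + 1)
  adj : ∀ i s, s ≤ t i → G.Adj (q i s) (q i (s + 1))
  inj : ∀ i s s', 0 < s → s ≤ t i → 0 < s' → s' ≤ t i → q i s = q i s' → s = s'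
  notMem : ∀ i s, 0 < s → s ≤ t i → q i s ∉ B
  disj : ∀ i j s s', i ≠ j → 0 < s → s ≤ t i → 0 < s' → s' ≤ t j → q i s ≠ q j s'
  simple : ∀ i j, s(q i 0, q i (t i + 1)) = s(q j 0, q j (t j + 1)) → i = j

/-- A path system whose union is an induced subgraph in which all ends are pairwise
non-adjacent. -/
structure IsInducedPathSys {V ι : Type*} (G : SimpleGraph V) (B : Finset V) (q : ι → ℕ → V)
    (t : ι → ℕ) : Prop extends IsPathSys G B q t where
  indep : ∀ u ∈ B, ∀ v ∈ B, ¬ G.Adj u v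
  adj_branch : ∀ i s, 0 < s → s ≤ t i → ∀ v ∈ B, G.Adj (q i s) v →
    (v = q i 0 ∧ s = 1) ∨ (v = q i (t i + 1) ∧ s = t i)
  adj_internal : ∀ i j s s', 0 < s → s ≤ t i → 0 < s' → s' ≤ t j → G.Adj (q i s) (q j s') →
    i = j ∧ (s + 1 = s' ∨ s' + 1 = s)

section PathSys

variable {V ι : Type*} {G : SimpleGraph V} {B : Finset V} {q : ι → ℕ → V} {t : ι → ℕ}

open Classical in
/-- Reverse the paths whose index satisfies `p`. -/
noncomputable def reorient (q : ι → ℕ → V) (t : ι → ℕ) (p : ι → Prop) : ι → ℕ → V :=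
  fun i s => if p i then q i (t i + 1 - s) else q i s

theorem reorient_ends (q : ι → ℕ → V) (t : ι → ℕ) (p : ι → Prop) (i : ι) :
    s(reorient q t p i 0, reorient q t p i (t i + 1)) = s(q i 0, q i (t i + 1)) := by
  by_cases h : p i <;> simp [reorient, h, Sym2.eq_swap]

theorem IsPathSys.reorient (h : IsPathSys G B q t) (p : ι → Prop) :
    IsPathSys G B (reorient q t p) t where
  fst_mem i := by
    unfold _root_.reorient; split_ifs <;> simp [h.fst_mem, h.lst_mem]
  lst_mem i := by
    unfold _root_.reorient; split_ifs <;> simp [h.fst_mem, h.lst_mem]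
  ends_ne i := by
    unfold _root_.reorient; split_ifs <;> simp [h.ends_ne i, (h.ends_ne i).symm]
  adj i s hs := by
    unfold _root_.reorient
    split_ifs
    · have := h.adj i (t i - s) (by omega)
      rw [show t i - s + 1 = t i + 1 - s by omega] at this
      rw [show t i + 1 - (s + 1) = t i - s by omega]
      exact this.symm
    · exact h.adj i s hs
  inj i s s' h1 h2 h3 h4 he := by
    unfold _root_.reorient at he
    split_ifs at he
    · have := h.inj i _ _ (by omega) (by omega) (by omega) (by omega) he
      omega
    · exact h.inj i _ _ h1 h2 h3 h4 he
  notMem i s h1 h2 := by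
    unfold _root_.reorient
    split_ifs
    · exact h.notMem i _ (by omega) (by omega)
    · exact h.notMem i _ (by omega) (by omega)
  disj i j s s' hij h1 h2 h3 h4 := by
    unfold _root_.reorient
    split_ifs <;> exact h.disj i j _ _ hij (by omega) (by omega) (by omega) (by omega)
  simple i j he := by
    rw [reorient_ends, reorient_ends] at he
    exact h.simple i j he

theorem IsInducedPathSys.reorient (h : IsInducedPathSys G B q t) (p : ι → Prop) :
    IsInducedPathSys G B (reorient q t p) t where
  toIsPathSys := h.toIsPathSys.reorient p
  indep := h.indep
  adj_branch i s h1 h2 v hv hadj := by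
    unfold _root_.reorient at hadj ⊢
    split_ifs at hadj ⊢
    · rcases h.adj_branch i _ (by omega) (by omega) v hv hadj with ⟨rfl, hs⟩ | ⟨rfl, hs⟩
      · right; simp; omega
      · left; simp; omega
    · exact h.adj_branch i s h1 h2 v hv hadj
  adj_internal i j s s' h1 h2 h3 h4 hadj := by
    have : i = j := by
      unfold _root_.reorient at hadj
      split_ifs at hadj <;>
        exact (h.adj_internal i j _ _ (by omega) (by omega) (by omega) (by omega) hadj).1
    subst this
    unfold _root_.reorient at hadj
    refine ⟨rfl, ?_⟩
    split_ifs at hadj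
    · have := (h.adj_internal i i _ _ (by omega) (by omega) (by omega) (by omega) hadj).2
      omega
    · exact (h.adj_internal i i _ _ h1 h2 h3 h4 hadj).2

/-- The graph of a path system, its vertices being indexed by `e`. -/
def pathSysGraph (h : IsPathSys G B q t) {n : ℕ} (e : B ≃ Fin n) : SimpleGraph (Fin n) where
  Adj u v := ∃ i, s(q i 0, q i (t i + 1)) = s((e.symm u : V), (e.symm v : V))
  symm := ⟨by
    rintro u v ⟨i, hi⟩
    exact ⟨i, by rw [hi, Sym2.eq_swap]⟩⟩
  loopless := ⟨by
    rintro u ⟨i, hi⟩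
    have := h.ends_ne i
    simp only [Sym2.eq_iff] at hi
    rcases hi with ⟨h1, h2⟩ | ⟨h1, h2⟩ <;> exact this (h1.trans h2.symm)⟩

theorem ncard_edgeSet_pathSysGraph [Fintype ι] (h : IsPathSys G B q t) {n : ℕ} (e : B ≃ Fin n) :
    (pathSysGraph h e).edgeSet.ncard = Fintype.card ι := by
  let f : ι → Sym2 (Fin n) := fun i => s(e ⟨_, h.fst_mem i⟩, e ⟨_, h.lst_mem i⟩)
  have hf : ∀ i, Sym2.map (fun u => (e.symm u : V)) (f i) = s(q i 0, q i (t i + 1)) := by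
    intro i; simp [f]
  have hinj : Function.Injective f := fun i j hij => h.simple i j (by rw [← hf, ← hf, hij])
  have hrange : (pathSysGraph h e).edgeSet = f '' Set.univ := by
    ext x
    induction x with | _ u v => ?_
    rw [SimpleGraph.mem_edgeSet]
    simp only [Set.image_univ, Set.mem_range]
    constructor
    · rintro ⟨i, hi⟩
      refine ⟨i, ?_⟩
      have hinj2 : Function.Injective (Sym2.map fun u => (e.symm u : V)) :=
        Sym2.map.injective (Subtype.val_injective.comp e.symm.injective)
      apply hinj2
      rw [hf, hi]; simp
    · rintro ⟨i, hi⟩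
      exact ⟨i, by rw [← hf, hi]; simp⟩
  rw [hrange, Set.ncard_image_of_injective _ hinj, Set.ncard_univ, Nat.card_eq_fintype_card]

theorem exists_edgeIndex (h : IsPathSys G B q t) {n : ℕ} (e : B ≃ Fin n)
    (ho : ∀ i, e ⟨_, h.fst_mem i⟩ < e ⟨_, h.lst_mem i⟩) :
    ∃ idx : Edges (pathSysGraph h e) → ι, Function.Injective idx ∧
      ∀ f, q (idx f) 0 = e.symm f.1.1 ∧ q (idx f) (t (idx f) + 1) = e.symm f.1.2 := by
  have key : ∀ f : Edges (pathSysGraph h e), ∃ i, q i 0 = e.symm f.1.1 ∧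
      q i (t i + 1) = e.symm f.1.2 := by
    rintro ⟨⟨u, v⟩, huv, i, hi⟩
    refine ⟨i, ?_⟩
    rw [Sym2.eq_iff] at hi
    rcases hi with hi | ⟨h1, h2⟩
    · exact hi
    · have := ho i
      simp only [h1, h2, Subtype.coe_eta, Equiv.apply_symm_apply] at this
      exact absurd huv (not_lt.2 this.le)
  choose idx hidx using key
  refine ⟨idx, fun f g hfg => ?_, hidx⟩
  have h1 := hidx f
  have h2 := hidx g
  rw [hfg] at h1
  have e1 := Subtype.val_injective (h1.1.symm.trans h2.1)
  have e2 := Subtype.val_injective (h1.2.symm.trans h2.2)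
  exact Subtype.ext (Prod.ext (e.symm.injective e1) (e.symm.injective e2))

/-- The placement of the subdivision of the graph of a path system. -/
def subdivPlacement {n : ℕ} {H : SimpleGraph (Fin n)} (e : B ≃ Fin n) (q : ι → ℕ → V)
    (idx : Edges H → ι) (t' : Edges H → ℕ) : (Fin n ⊕ Σ e : Edges H, Fin (t' e)) → V
  | Sum.inl u => e.symm u
  | Sum.inr ⟨f, i⟩ => q (idx f) (i + 1)

theorem subdivPlacement_injective (h : IsPathSys G B q t) {n : ℕ} {H : SimpleGraph (Fin n)}
    (e : B ≃ Fin n) (idx : Edges H → ι) (hidx : Function.Injective idx) {t' : Edges H → ℕ}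
    (ht : ∀ f, t' f = t (idx f)) : Function.Injective (subdivPlacement e q idx t') := by
  rintro (u | ⟨f, i⟩) (v | ⟨g, j⟩) huv
  · simp only [subdivPlacement] at huv
    exact congrArg _ (e.symm.injective (Subtype.val_injective huv))
  · have := h.notMem (idx g) (j + 1) (by omega) (by have := ht g; omega)
    simp only [subdivPlacement] at huv
    exact absurd (huv ▸ (e.symm u).2) this
  · have := h.notMem (idx f) (i + 1) (by omega) (by have := ht f; omega)
    simp only [subdivPlacement] at huv
    exact absurd (huv ▸ (e.symm v).2) this
  · simp only [subdivPlacement] at huv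
    by_cases hfg : f = g
    · subst hfg
      have := h.inj (idx f) (i + 1) (j + 1) (by omega) (by have := ht f; omega) (by omega)
        (by have := ht f; omega) huv
      obtain rfl : i = j := Fin.ext (by omega)
      rfl
    · exact absurd huv (h.disj _ _ _ _ (fun hh => hfg (hidx hh)) (by omega)
        (by have := ht f; omega) (by omega) (by have := ht g; omega))

theorem subdivPlacement_adj (h : IsPathSys G B q t) {n : ℕ} {H : SimpleGraph (Fin n)}
    (e : B ≃ Fin n) (idx : Edges H → ι)
    (hends : ∀ f, q (idx f) 0 = e.symm f.1.1 ∧ q (idx f) (t (idx f) + 1) = e.symm f.1.2)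
    {t' : Edges H → ℕ} (ht : ∀ f, t' f = t (idx f)) {x y} (hxy : (Subdiv H t').Adj x y) :
    G.Adj (subdivPlacement e q idx t' x) (subdivPlacement e q idx t' y) := by
  have key : ∀ x y, subdivRel H t' x y →
      G.Adj (subdivPlacement e q idx t' x) (subdivPlacement e q idx t' y) := by
    rintro (u | ⟨f, i⟩) (v | ⟨g, j⟩) hr
    · obtain ⟨huv, h0⟩ := hr
      obtain ⟨f, rfl, rfl, h0'⟩ : ∃ f : Edges H, u = f.1.1 ∧ v = f.1.2 ∧ t' f = 0 :=
        ⟨⟨(u, v), huv⟩, rfl, rfl, h0⟩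
      have h1 := h.adj (idx f) 0 (by omega)
      obtain ⟨h2, h3⟩ := hends f
      rw [← ht, h0'] at h3
      rw [h2, h3] at h1
      exact h1
    · rcases hr with ⟨rfl, h0⟩ | ⟨rfl, h0⟩
      · simp only [subdivPlacement, ← (hends g).1, h0]
        exact h.adj _ 0 (by omega)
      · have h1 := h.adj (idx g) (j + 1) (by have := ht g; omega)
        simp only [subdivPlacement, ← (hends g).2, ← ht, ← h0]
        exact h1.symm
    · exact hr.elim
    · obtain ⟨rfl, hij⟩ := hr
      simp only [subdivPlacement, ← hij]
      exact h.adj _ _ (by have := ht f; omega)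
  rw [Subdiv, SimpleGraph.fromRel_adj] at hxy
  rcases hxy.2 with hr | hr
  · exact key _ _ hr
  · exact (key _ _ hr).symm

theorem adj_of_subdivPlacement (h : IsInducedPathSys G B q t) {n : ℕ} {H : SimpleGraph (Fin n)}
    (e : B ≃ Fin n) (idx : Edges H → ι) (hidx : Function.Injective idx)
    (hends : ∀ f, q (idx f) 0 = e.symm f.1.1 ∧ q (idx f) (t (idx f) + 1) = e.symm f.1.2)
    {t' : Edges H → ℕ} (ht : ∀ f, t' f = t (idx f)) {x y}
    (hxy : G.Adj (subdivPlacement e q idx t' x) (subdivPlacement e q idx t' y)) :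
    (Subdiv H t').Adj x y := by
  have hbr : ∀ u f i, G.Adj (subdivPlacement e q idx t' (Sum.inr ⟨f, i⟩))
      (subdivPlacement e q idx t' (Sum.inl u)) →
      subdivRel H t' (Sum.inl u) (Sum.inr ⟨f, i⟩) := by
    intro u f i had
    simp only [subdivPlacement] at had
    have := h.adj_branch _ _ (by omega) (by have := ht f; omega) _ (e.symm u).2 had
    rw [(hends f).1, (hends f).2] at this
    rcases this with ⟨h1, h2⟩ | ⟨h1, h2⟩
    · exact Or.inl ⟨e.symm.injective (Subtype.val_injective h1), by omega⟩
    · exact Or.inr ⟨e.symm.injective (Subtype.val_injective h1), by have := ht f; omega⟩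
  rw [Subdiv, SimpleGraph.fromRel_adj]
  refine ⟨fun heq => G.loopless.irrefl _ (heq ▸ hxy), ?_⟩
  rcases x with u | ⟨f, i⟩ <;> rcases y with v | ⟨g, j⟩
  · exact absurd hxy (h.indep _ (e.symm u).2 _ (e.symm v).2)
  · exact Or.inl (hbr _ _ _ hxy.symm)
  · exact Or.inr (hbr _ _ _ hxy)
  · simp only [subdivPlacement] at hxy
    obtain ⟨h1, h2⟩ := h.adj_internal _ _ _ _ (by omega) (by have := ht f; omega) (by omega)
      (by have := ht g; omega) hxy
    obtain rfl := hidx h1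
    rcases h2 with h2 | h2
    · exact Or.inl ⟨rfl, by omega⟩
    · exact Or.inr ⟨rfl, by omega⟩

theorem IsPathSys.exists_oriented (h : IsPathSys G B q t) {n : ℕ} (e : B ≃ Fin n) :
    ∃ p : ι → Prop, ∀ i, e ⟨_, (h.reorient p).fst_mem i⟩ < e ⟨_, (h.reorient p).lst_mem i⟩ := by
  refine ⟨fun i => e ⟨_, h.lst_mem i⟩ < e ⟨_, h.fst_mem i⟩, fun i => ?_⟩
  by_cases hp : e ⟨_, h.lst_mem i⟩ < e ⟨_, h.fst_mem i⟩
  · simp [_root_.reorient, hp]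
  · have hne : e ⟨_, h.lst_mem i⟩ ≠ e ⟨_, h.fst_mem i⟩ := fun heq =>
      h.ends_ne i (Subtype.ext_iff.1 (e.injective heq)).symm
    have := lt_of_le_of_ne (not_lt.1 hp) hne.symm
    simp only [_root_.reorient, hp, if_false]
    exact this

theorem IsPathSys.exists_memTM [Fintype ι] (h : IsPathSys G B q t) {r : ℕ} (ht : ∀ i, t i ≤ r) :
    ∃ H : SimpleGraph (Fin B.card), MemTM r G H ∧ H.edgeSet.ncard = Fintype.card ι := by
  obtain ⟨p, hp⟩ := h.exists_oriented B.equivFin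
  have h' := h.reorient p
  obtain ⟨idx, hidx, hends⟩ := exists_edgeIndex h' B.equivFin hp
  refine ⟨pathSysGraph h' B.equivFin, ⟨fun f => t (idx f), fun f => ht _,
    ⟨subdivPlacement B.equivFin (_root_.reorient q t p) idx _, fun hxy => ?_⟩, ?_⟩, ncard_edgeSet_pathSysGraph h' _⟩
  · exact subdivPlacement_adj h' _ idx hends (fun _ => rfl) hxy
  · exact subdivPlacement_injective h' _ idx hidx (fun _ => rfl)

theorem IsInducedPathSys.exists_memITM [Fintype ι] (h : IsInducedPathSys G B q t) {r : ℕ}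
    (ht : ∀ i, t i = r) :
    ∃ H : SimpleGraph (Fin B.card), MemITM r G H ∧ H.edgeSet.ncard = Fintype.card ι := by
  obtain ⟨p, hp⟩ := h.toIsPathSys.exists_oriented B.equivFin
  have h' := h.reorient p
  obtain ⟨idx, hidx, hends⟩ := exists_edgeIndex h'.toIsPathSys B.equivFin hp
  refine ⟨pathSysGraph h'.toIsPathSys B.equivFin, ⟨⟨subdivPlacement B.equivFin (_root_.reorient q t p) idx _,
    subdivPlacement_injective h'.toIsPathSys _ idx hidx fun _ => (ht _).symm⟩,
    fun {x y} => ⟨fun hxy => ?_, fun hxy => ?_⟩⟩, ncard_edgeSet_pathSysGraph h'.toIsPathSys _⟩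
  · exact adj_of_subdivPlacement h' _ idx hidx hends (fun _ => (ht _).symm) hxy
  · exact subdivPlacement_adj h'.toIsPathSys _ idx hends (fun _ => (ht _).symm) hxy

end PathSys

/-! ## Link systems -/

/-- A family `F` of triples `(a, b, P)` in which `a, b ∈ B` are linked through the set `P` of at
most `r` vertices; the sets `P` are disjoint from `B` and from each other. -/
structure IsLinkSys {V : Type*} (G : SimpleGraph V) (r : ℕ) (B : Finset V)
    (F : Finset (V × V × Finset V)) : Prop where
  fst_mem : ∀ t ∈ F, t.1 ∈ B
  snd_mem : ∀ t ∈ F, t.2.1 ∈ B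
  ne : ∀ t ∈ F, t.1 ≠ t.2.1
  card_le : ∀ t ∈ F, t.2.2.card ≤ r
  disjoint_branch : ∀ t ∈ F, Disjoint t.2.2 B
  link : ∀ t ∈ F, Link G t.2.2 t.1 t.2.1
  disjoint : ∀ t ∈ F, ∀ t' ∈ F, t ≠ t' → Disjoint t.2.2 t'.2.2
  simple : ∀ t ∈ F, ∀ t' ∈ F, s(t.1, t.2.1) = s(t'.1, t'.2.1) → t = t'

section LinkSys

variable {V : Type*} {G : SimpleGraph V} {r : ℕ} {B : Finset V} {F : Finset (V × V × Finset V)}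

theorem IsLinkSys.subset (h : IsLinkSys G r B F) {F' : Finset (V × V × Finset V)} (hF : F' ⊆ F) :
    IsLinkSys G r B F' where
  fst_mem t ht := h.fst_mem t (hF ht)
  snd_mem t ht := h.snd_mem t (hF ht)
  ne t ht := h.ne t (hF ht)
  card_le t ht := h.card_le t (hF ht)
  disjoint_branch t ht := h.disjoint_branch t (hF ht)
  link t ht := h.link t (hF ht)
  disjoint t ht t' ht' := h.disjoint t (hF ht) t' (hF ht')
  simple t ht t' ht' := h.simple t (hF ht) t' (hF ht')

theorem Link.exists_isInducedSeq_card {P : Finset V} {a b : V} (h : Link G P a b) (hab : a ≠ b) :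
    ∃ (k : ℕ) (g : ℕ → V), g 0 = a ∧ g (k + 1) = b ∧ (∀ s, 0 < s → s ≤ k → g s ∈ P) ∧
      IsInducedSeq G g (k + 1) ∧ k ≤ P.card := by
  obtain ⟨l, g, h0, hl, hP, hind⟩ := h.exists_isInducedSeq
  obtain ⟨k, rfl⟩ : ∃ k, l = k + 1 := by
    rcases l with _ | k
    · exact absurd (h0.symm.trans hl) hab
    · exact ⟨k, rfl⟩
  refine ⟨k, g, h0, hl, fun s h1 h2 => by exact_mod_cast hP s h1 (by omega), hind, ?_⟩
  have := Finset.card_le_card_of_injOn (s := Finset.Icc 1 k) (t := P) g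
    (fun s hs => by
      have hs := Finset.mem_Icc.1 hs
      exact hP s (by omega) (by omega))
    (fun s hs s' hs' he => by
      have hs := Finset.mem_Icc.1 hs
      have hs' := Finset.mem_Icc.1 hs'
      by_contra hne
      rcases Nat.lt_or_gt_of_ne hne with hlt | hlt
      · exact (hind.2 s s' hlt (by omega)).1 he
      · exact (hind.2 s' s hlt (by omega)).1 he.symm)
  simpa using this

theorem IsLinkSys.exists_pathSys (h : IsLinkSys G r B F) :
    ∃ (q : F → ℕ → V) (t : F → ℕ), IsPathSys G B q t ∧ (∀ i, t i ≤ r) ∧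
      (∀ i, q i 0 = i.1.1 ∧ q i (t i + 1) = i.1.2.1) ∧
      (∀ i s, 0 < s → s ≤ t i → q i s ∈ i.1.2.2) ∧ ∀ i, IsInducedSeq G (q i) (t i + 1) := by
  choose t q h0 h1 hP hind hk using fun i : F =>
    (h.link i.1 i.2).exists_isInducedSeq_card (h.ne i.1 i.2)
  refine ⟨q, t, ⟨fun i => ?_, fun i => ?_, fun i => ?_, fun i s hs => ?_,
    fun i s s' hs1 hs2 hs3 hs4 he => ?_, fun i s hs1 hs2 => ?_,
    fun i j s s' hij hs1 hs2 hs3 hs4 he => ?_, fun i j he => ?_⟩,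
    fun i => (hk i).trans (h.card_le i.1 i.2), fun i => ⟨h0 i, h1 i⟩, hP, hind⟩
  · rw [h0]; exact h.fst_mem _ i.2
  · rw [h1]; exact h.snd_mem _ i.2
  · rw [h0, h1]; exact h.ne _ i.2
  · exact (hind i).1 s (by omega)
  · by_contra hne
    rcases Nat.lt_or_gt_of_ne hne with hlt | hlt
    · exact ((hind i).2 s s' hlt (by omega)).1 he
    · exact ((hind i).2 s' s hlt (by omega)).1 he.symm
  · exact Finset.disjoint_left.1 (h.disjoint_branch _ i.2) (hP i s hs1 hs2)
  · exact Finset.disjoint_left.1 (h.disjoint _ i.2 _ j.2 fun hh => hij (Subtype.ext hh))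
      (hP i s hs1 hs2) (he ▸ hP j s' hs3 hs4)
  · rw [h0, h0, h1, h1] at he
    exact Subtype.ext (h.simple _ i.2 _ j.2 he)

theorem IsLinkSys.card_le_of_avgDeg_le (h : IsLinkSys G r B F) {d : ℝ}
    (hd : ∀ ⦃m : ℕ⦄ (H : SimpleGraph (Fin m)), MemTM r G H → avgDeg H ≤ d) :
    2 * (F.card : ℝ) ≤ d * B.card := by
  obtain ⟨q, t, hq, ht, -⟩ := h.exists_pathSys
  obtain ⟨H, hH, hcard⟩ := hq.exists_memTM ht
  have := hd H hH
  rw [avgDeg, hcard, Fintype.card_coe] at this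
  rcases F.eq_empty_or_nonempty with rfl | ⟨x, hx⟩
  · rcases B.eq_empty_or_nonempty with rfl | hB
    · simp
    · have : 0 ≤ d := by simpa using this
      simp; positivity
  · have hpos : (0 : ℝ) < B.card := by
      exact_mod_cast Finset.card_pos.2 ⟨_, h.fst_mem x hx⟩
    rwa [div_le_iff₀ hpos] at this

end LinkSys

theorem subdiv_adj_of_rel {n : ℕ} {H : SimpleGraph (Fin n)} {t : Edges H → ℕ} {x y}
    (h : subdivRel H t x y) (hne : x ≠ y) : (Subdiv H t).Adj x y := by
  rw [Subdiv, SimpleGraph.fromRel_adj]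
  exact ⟨hne, Or.inl h⟩

open Classical in
/-- The canonical path of an edge in a subdivision. -/
noncomputable def subdivSeq {n : ℕ} {H : SimpleGraph (Fin n)} (t : Edges H → ℕ) (f : Edges H)
    (s : ℕ) : Fin n ⊕ Σ e : Edges H, Fin (t e) :=
  if s = 0 then Sum.inl f.1.1 else if h : s - 1 < t f then Sum.inr ⟨f, ⟨s - 1, h⟩⟩
    else Sum.inl f.1.2

theorem subdivSeq_adj {n : ℕ} {H : SimpleGraph (Fin n)} (t : Edges H → ℕ) (f : Edges H)
    {s : ℕ} (hs : s ≤ t f) : (Subdiv H t).Adj (subdivSeq t f s) (subdivSeq t f (s + 1)) := by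
  rcases Nat.eq_zero_or_pos s with rfl | hpos
  · rcases Nat.eq_zero_or_pos (t f) with h0 | h0
    · simp only [subdivSeq, h0, if_true, Nat.add_sub_cancel, lt_irrefl, dite_false]
      rw [if_neg (by omega)]
      exact subdiv_adj_of_rel ⟨f.2, h0⟩ (by simpa using f.2.1.ne)
    · simp only [subdivSeq, if_true, Nat.add_sub_cancel, h0, dite_true]
      rw [if_neg (by omega)]
      exact subdiv_adj_of_rel (Or.inl ⟨rfl, rfl⟩) (by simp)
  · have h1 : s - 1 < t f := by omega
    rcases lt_or_eq_of_le hs with h2 | h2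
    · simp only [subdivSeq, h1, hpos.ne', if_false, dite_true, Nat.add_sub_cancel, h2]
      rw [if_neg (by omega)]
      exact subdiv_adj_of_rel ⟨rfl, by simp; omega⟩ (by simp; omega)
    · have h3 : ¬ s + 1 - 1 < t f := by omega
      simp only [subdivSeq, h1, h3, hpos.ne', if_false, dite_true, dite_false]
      rw [if_neg (by omega)]
      refine SimpleGraph.Adj.symm ?_
      exact subdiv_adj_of_rel (Or.inr ⟨rfl, by simp; omega⟩) (by simp)

noncomputable instance {n : ℕ} (H : SimpleGraph (Fin n)) : Fintype (Edges H) := by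
  classical
  unfold Edges
  infer_instance

theorem ncard_edgeSet_eq_card_edges {n : ℕ} (H : SimpleGraph (Fin n)) :
    H.edgeSet.ncard = Fintype.card (Edges H) := by
  let f : Edges H → Sym2 (Fin n) := fun e => s(e.1.1, e.1.2)
  have hinj : Function.Injective f := by
    rintro ⟨⟨u, v⟩, h1, h2⟩ ⟨⟨u', v'⟩, h1', h2'⟩ he
    simp only [f, Sym2.eq_iff] at he
    rcases he with ⟨rfl, rfl⟩ | ⟨rfl, rfl⟩
    · rfl
    · exact absurd h1 (not_lt.2 h1'.le)
  have hrange : H.edgeSet = f '' Set.univ := by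
    ext x
    induction x with | _ u v => ?_
    rw [SimpleGraph.mem_edgeSet]
    simp only [Set.image_univ, Set.mem_range]
    constructor
    · intro h
      rcases lt_or_gt_of_ne h.ne with hlt | hlt
      · exact ⟨⟨(u, v), hlt, h⟩, rfl⟩
      · exact ⟨⟨(v, u), hlt, h.symm⟩, Sym2.eq_swap⟩
    · rintro ⟨e, he⟩
      rw [← SimpleGraph.mem_edgeSet, ← he]
      exact e.2.2
  rw [hrange, Set.ncard_image_of_injective _ hinj, Set.ncard_univ, Nat.card_eq_fintype_card]

theorem MemTM.exists_linkSys {V : Type*} {G : SimpleGraph V} {r n : ℕ} {H : SimpleGraph (Fin n)}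
    (h : MemTM r G H) : ∃ (B : Finset V) (F : Finset (V × V × Finset V)), IsLinkSys G r B F ∧
      B.card = n ∧ F.card = H.edgeSet.ncard := by
  classical
  obtain ⟨t, ht, f, hf⟩ := h
  let β : Fin n → V := fun u => f (Sum.inl u)
  have hβ : Function.Injective β := fun u v huv => Sum.inl_injective (hf huv)
  let P : Edges H → Finset V := fun e => Finset.univ.image fun i : Fin (t e) => f (Sum.inr ⟨e, i⟩)
  let T : Edges H → V × V × Finset V := fun e => (β e.1.1, β e.1.2, P e)
  have hT : ∀ e e' : Edges H, s(β e.1.1, β e.1.2) = s(β e'.1.1, β e'.1.2) → e = e' := by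
    rintro ⟨⟨u, v⟩, h1, h2⟩ ⟨⟨u', v'⟩, h1', h2'⟩ he
    simp only [Sym2.eq_iff, hβ.eq_iff] at he
    rcases he with ⟨rfl, rfl⟩ | ⟨rfl, rfl⟩
    · rfl
    · exact absurd h1 (not_lt.2 h1'.le)
  have hTinj : Function.Injective T := fun e e' he => by
    simp only [T, Prod.mk.injEq] at he
    exact hT e e' (by rw [he.1, he.2.1])
  refine ⟨Finset.univ.image β, Finset.univ.image T, ?_, ?_, ?_⟩
  · constructor
    · simp [T]
    · simp [T]
    · simp only [Finset.mem_image, Finset.mem_univ, true_and, forall_exists_index,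
        forall_apply_eq_imp_iff]
      exact fun e => hβ.ne e.2.1.ne
    · simp only [Finset.mem_image, Finset.mem_univ, true_and, forall_exists_index,
        forall_apply_eq_imp_iff]
      exact fun e => Finset.card_image_le.trans (by simpa using ht e)
    · simp only [Finset.mem_image, Finset.mem_univ, true_and, forall_exists_index,
        forall_apply_eq_imp_iff]
      intro e
      rw [Finset.disjoint_left]
      intro x hx hx'
      simp only [T, P, β, Finset.mem_image, Finset.mem_univ, true_and] at hx hx'
      obtain ⟨i, rfl⟩ := hx
      obtain ⟨u, hu⟩ := hx'
      exact absurd (hf hu) (by simp)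
    · simp only [Finset.mem_image, Finset.mem_univ, true_and, forall_exists_index,
        forall_apply_eq_imp_iff]
      intro e
      refine ⟨t e + 1, fun s => f (subdivSeq t e s), by simp [subdivSeq, T, β],
        by simp [subdivSeq, T, β], fun s hs => f.map_adj (subdivSeq_adj t e (by omega)),
        fun s h1 h2 => ?_⟩
      have h3 : s - 1 < t e := by omega
      simp only [subdivSeq, h1.ne', h3, if_false, dite_true]
      simp [T, P]
    · simp only [Finset.mem_image, Finset.mem_univ, true_and, forall_exists_index,
        forall_apply_eq_imp_iff]
      intro e e' hne
      rw [Finset.disjoint_left]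
      intro x hx hx'
      simp only [T, P, Finset.mem_image, Finset.mem_univ, true_and] at hx hx'
      obtain ⟨i, rfl⟩ := hx
      obtain ⟨j, hj⟩ := hx'
      have := hf hj
      simp only [Sum.inr.injEq, Sigma.mk.injEq] at this
      exact hne (by rw [this.1])
    · simp only [Finset.mem_image, Finset.mem_univ, true_and, forall_exists_index,
        forall_apply_eq_imp_iff]
      intro e e' he
      rw [hT e e' he]
  · rw [Finset.card_image_of_injective _ hβ]; simp
  · rw [Finset.card_image_of_injective _ hTinj, ncard_edgeSet_eq_card_edges]; rfl

/-! ## Small separators in graphs with sparse shallow topological minors -/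

section Barrier

variable {V : Type*} [DecidableEq V] {G : SimpleGraph V}

theorem IsLinkSys.insert {r : ℕ} {B : Finset V} {F : Finset (V × V × Finset V)}
    (h : IsLinkSys G r B F) {a b : V} {P : Finset V} (ha : a ∈ B) (hb : b ∈ B) (hab : a ≠ b)
    (hP : P.card ≤ r) (hPB : Disjoint P B) (hPF : Disjoint P (F.biUnion fun t => t.2.2))
    (hlink : Link G P a b) (hnew : ∀ t ∈ F, s(a, b) ≠ s(t.1, t.2.1)) :
    IsLinkSys G r B (insert (a, b, P) F) := by
  rw [Finset.disjoint_biUnion_right] at hPF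
  constructor
  · simpa [ha] using fun a b c h' => h.fst_mem _ h'
  · simpa [hb] using fun a b c h' => h.snd_mem _ h'
  · simpa [hab] using fun a b c h' => h.ne _ h'
  · simpa [hP] using fun a b c h' => h.card_le _ h'
  · simpa [hPB] using fun a b c h' => h.disjoint_branch _ h'
  · rw [Finset.forall_mem_insert]
    exact ⟨hlink, h.link⟩
  · intro t ht t' ht' hne
    rw [Finset.mem_insert] at ht ht'
    rcases ht with rfl | ht <;> rcases ht' with rfl | ht'
    · exact absurd rfl hne
    · exact hPF _ ht'
    · exact (hPF _ ht).symm
    · exact h.disjoint _ ht _ ht' hne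
  · intro t ht t' ht' he
    rw [Finset.mem_insert] at ht ht'
    rcases ht with rfl | ht <;> rcases ht' with rfl | ht'
    · rfl
    · exact absurd he (hnew _ ht')
    · exact absurd he.symm (hnew _ ht)
    · exact h.simple _ ht _ ht' he

/-- Internally disjoint links, avoiding `N`, from `v` to distinct vertices of `Z`. -/
structure IsFan {V : Type*} (G : SimpleGraph V) (R : ℕ) (N Z : Finset V) (v : V)
    (Φ : Finset (V × Finset V)) : Prop where
  fst_mem : ∀ t ∈ Φ, t.1 ∈ Z
  inj : ∀ t ∈ Φ, ∀ t' ∈ Φ, t.1 = t'.1 → t = t'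
  card_le : ∀ t ∈ Φ, t.2.card ≤ R
  disjoint_branch : ∀ t ∈ Φ, Disjoint t.2 N
  disjoint : ∀ t ∈ Φ, ∀ t' ∈ Φ, t ≠ t' → Disjoint t.2 t'.2
  link : ∀ t ∈ Φ, Link G t.2 v t.1
  link_mem : ∀ t ∈ Φ, ∀ x ∈ t.2, Link G t.2 v x

theorem IsFan.insert {R : ℕ} {N Z : Finset V} {v z : V} {P : Finset V} {Φ : Finset (V × Finset V)}
    (h : IsFan G R N Z v Φ) (hz : z ∈ Z) (hP : P.card ≤ R) (hPN : Disjoint P N)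
    (hlink : Link G P v z) (hlink' : ∀ x ∈ P, Link G P v x) (hnew : ∀ t ∈ Φ, z ≠ t.1)
    (hPΦ : ∀ t ∈ Φ, Disjoint P t.2) : IsFan G R N Z v (insert (z, P) Φ) := by
  constructor
  · simpa [hz] using fun a b h' => h.fst_mem _ h'
  · intro t ht t' ht' he
    rw [Finset.mem_insert] at ht ht'
    rcases ht with rfl | ht <;> rcases ht' with rfl | ht'
    · rfl
    · exact absurd he (hnew _ ht')
    · exact absurd he.symm (hnew _ ht)
    · exact h.inj _ ht _ ht' he
  · simpa [hP] using fun a b h' => h.card_le _ h'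
  · simpa [hPN] using fun a b h' => h.disjoint_branch _ h'
  · intro t ht t' ht' hne
    rw [Finset.mem_insert] at ht ht'
    rcases ht with rfl | ht <;> rcases ht' with rfl | ht'
    · exact absurd rfl hne
    · exact hPΦ _ ht'
    · exact (hPΦ _ ht).symm
    · exact h.disjoint _ ht _ ht' hne
  · rw [Finset.forall_mem_insert]
    exact ⟨hlink, h.link⟩
  · rw [Finset.forall_mem_insert]
    exact ⟨hlink', h.link_mem⟩

/-- The pairs linked by a member of `F`. -/
def Linked {V : Type*} (F : Finset (V × V × Finset V)) (u v : V) : Prop :=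
  ∃ t ∈ F, s(u, v) = s(t.1, t.2.1)

theorem Linked.symm {V : Type*} {F : Finset (V × V × Finset V)} {u v : V} (h : Linked F u v) :
    Linked F v u := by
  obtain ⟨t, ht, he⟩ := h
  exact ⟨t, ht, by rw [← he, Sym2.eq_swap]⟩

open Classical in
theorem card_linked_le {r d : ℕ} (hd : ∀ B F, IsLinkSys G r B F → F.card ≤ d * B.card)
    {B : Finset V} {F : Finset (V × V × Finset V)} (h : IsLinkSys G r B F) {T : Finset V}
    (hT : T ⊆ B) : ((T ×ˢ T).filter fun p => Linked F p.1 p.2).card ≤ 2 * d * T.card := by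
  have hF' : IsLinkSys G r T (F.filter fun t => t.1 ∈ T ∧ t.2.1 ∈ T) :=
    { h.subset (Finset.filter_subset _ _) with
      fst_mem := fun t ht => (Finset.mem_filter.1 ht).2.1
      snd_mem := fun t ht => (Finset.mem_filter.1 ht).2.2
      disjoint_branch := fun t ht =>
        (h.disjoint_branch t (Finset.mem_filter.1 ht).1).mono_right hT }
  have hcard := hd _ _ hF'
  set F' := F.filter fun t => t.1 ∈ T ∧ t.2.1 ∈ T
  have hsub : ((T ×ˢ T).filter fun p => Linked F p.1 p.2) ⊆
      F'.image (fun t => (t.1, t.2.1)) ∪ F'.image (fun t => (t.2.1, t.1)) := by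
    rintro ⟨u, v⟩ hp
    simp only [Finset.mem_filter, Finset.mem_product] at hp
    obtain ⟨⟨hu, hv⟩, t, ht, he⟩ := hp
    rw [Finset.mem_union, Finset.mem_image, Finset.mem_image]
    rw [Sym2.eq_iff] at he
    rcases he with ⟨rfl, rfl⟩ | ⟨rfl, rfl⟩
    · exact Or.inl ⟨t, Finset.mem_filter.2 ⟨ht, hu, hv⟩, rfl⟩
    · exact Or.inr ⟨t, Finset.mem_filter.2 ⟨ht, hv, hu⟩, rfl⟩
  calc _ ≤ _ := Finset.card_le_card hsub
    _ ≤ F'.card + F'.card := (Finset.card_union_le _ _).trans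
        (add_le_add Finset.card_image_le Finset.card_image_le)
    _ ≤ 2 * d * T.card := by linarith

/-- A set meeting all short sequences that leave `v` and return to `S`, obtained from a maximal
link system on `S` and a maximal fan at `v`. -/
theorem exists_mem_barrier {R : ℕ} {S : Finset V} {F : Finset (V × V × Finset V)}
    (hF : IsLinkSys G (2 * R) S F)
    (hmax : ∀ F', IsLinkSys G (2 * R) S F' → F'.card ≤ F.card) {v : V} (hv : v ∈ S)
    {Φ : Finset (V × Finset V)}
    (hΦ : IsFan G R (S ∪ F.biUnion fun t => t.2.2) (F.biUnion fun t => t.2.2) v Φ)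
    (hΦmax : ∀ Φ', IsFan G R (S ∪ F.biUnion fun t => t.2.2) (F.biUnion fun t => t.2.2) v Φ' →
      Φ'.card ≤ Φ.card)
    {l : ℕ} {g : ℕ → V} (hl : l ≤ R) (h0 : g 0 = v) (hlS : g l ∈ S) (hlv : g l ≠ v)
    (hadj : ∀ s < l, G.Adj (g s) (g (s + 1))) (hinn : ∀ s, 0 < s → s < l → g s ∉ S) :
    ∃ s, 0 < s ∧ s ≤ l ∧ (Linked F v (g s) ∨ ∃ t ∈ Φ, g s = t.1 ∨ g s ∈ t.2) := by
  have hlpos : 0 < l := by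
    rcases Nat.eq_zero_or_pos l with rfl | h
    · exact absurd h0 hlv
    · exact h
  set Z := F.biUnion fun t => t.2.2 with hZ
  have hex : ∃ s, 0 < s ∧ g s ∈ S ∪ Z := ⟨l, hlpos, Finset.mem_union_left _ hlS⟩
  obtain ⟨hs0, hsN⟩ := Nat.find_spec hex
  have hsl : Nat.find hex ≤ l := Nat.find_min' hex ⟨hlpos, Finset.mem_union_left _ hlS⟩
  have hmin := fun m (hm : m < Nat.find hex) => Nat.find_min hex hm
  generalize Nat.find hex = s at *
  by_contra! hcon
  let P := (Finset.Ico 1 s).image g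
  have hPmem : ∀ i, 0 < i → i < s → g i ∈ (P : Set V) := fun i h1 h2 =>
    Finset.mem_coe.2 (Finset.mem_image_of_mem _ (Finset.mem_Ico.2 ⟨h1, h2⟩))
  have hPcard : P.card ≤ R := Finset.card_image_le.trans (by simp; omega)
  have hPN : Disjoint P (S ∪ Z) := by
    rw [Finset.disjoint_left]
    rintro x hx
    obtain ⟨i, hi, rfl⟩ := Finset.mem_image.1 hx
    have hi := Finset.mem_Ico.1 hi
    exact fun h => hmin i (by omega) ⟨by omega, h⟩
  have hlink : Link G P v (g s) := ⟨s, g, h0, rfl, fun i hi => hadj i (by omega), hPmem⟩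
  by_cases hsZ : g s ∈ Z
  · have hnew : ∀ t ∈ Φ, g s ≠ t.1 := fun t ht => ((hcon s hs0 hsl).2 t ht).1
    have hins : IsFan G R (S ∪ Z) Z v (insert (g s, P) Φ) := by
      refine hΦ.insert hsZ hPcard hPN hlink (fun x hx => ?_) hnew fun t ht => ?_
      · obtain ⟨i, hi, rfl⟩ := Finset.mem_image.1 hx
        have hi := Finset.mem_Ico.1 hi
        exact ⟨i, g, h0, rfl, fun j hj => hadj j (by omega),
          fun j hj1 hj2 => hPmem j hj1 (by omega)⟩
      · rw [Finset.disjoint_left]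
        intro x hx
        obtain ⟨i, hi, rfl⟩ := Finset.mem_image.1 hx
        have hi := Finset.mem_Ico.1 hi
        exact ((hcon i (by omega) (by omega)).2 t ht).2
    have hle := hΦmax _ hins
    rw [Finset.card_insert_of_notMem fun h => hnew _ h rfl] at hle
    omega
  · have hsS : g s ∈ S := (Finset.mem_union.1 hsN).resolve_right hsZ
    obtain rfl : s = l := by
      by_contra hne
      exact hinn s hs0 (by omega) hsS
    have hnew : ∀ t ∈ F, s(v, g s) ≠ s(t.1, t.2.1) := fun t ht he =>
      (hcon s hs0 hsl).1 ⟨t, ht, he⟩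
    rw [Finset.disjoint_union_right] at hPN
    have hle := hmax _ (hF.insert hv hlS hlv.symm (hPcard.trans (by omega)) hPN.1 hPN.2 hlink hnew)
    rw [Finset.card_insert_of_notMem fun h => hnew _ h rfl] at hle
    omega

theorem exists_barrier [Fintype V] {R d : ℕ}
    (hd : ∀ B F, IsLinkSys G (2 * R) B F → F.card ≤ d * B.card) {S : Finset V}
    (hS : S.Nonempty) :
    ∃ v ∈ S, ∃ Q : Finset V,
      Q.card ≤ (2 * d * (2 * d + 1) + d * (1 + 2 * R * (d * (2 * d + 1)))) * (R + 2) ∧ v ∉ Q ∧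
      ∀ (l : ℕ) (g : ℕ → V), l ≤ R → g 0 = v → g l ∈ S → g l ≠ v →
        (∀ s < l, G.Adj (g s) (g (s + 1))) → (∀ s, 0 < s → s < l → g s ∉ S) →
        ∃ s, 0 < s ∧ s ≤ l ∧ g s ∈ Q := by
  classical
  obtain ⟨F, hFm, hFmax⟩ := Finset.exists_max_image
    (Finset.univ.filter fun F : Finset (V × V × Finset V) => IsLinkSys G (2 * R) S F)
    Finset.card ⟨∅, by simpa using ⟨by simp, by simp, by simp, by simp, by simp, by simp, by simp,
      by simp⟩⟩
  have hF : IsLinkSys G (2 * R) S F := (Finset.mem_filter.1 hFm).2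
  have hmax : ∀ F', IsLinkSys G (2 * R) S F' → F'.card ≤ F.card := fun F' h =>
    hFmax F' (Finset.mem_filter.2 ⟨Finset.mem_univ _, h⟩)
  set Z := F.biUnion fun t => t.2.2 with hZdef
  have hfan : ∀ v, ∃ Φ, IsFan G R (S ∪ Z) Z v Φ ∧
      ∀ Φ', IsFan G R (S ∪ Z) Z v Φ' → Φ'.card ≤ Φ.card := by
    intro v
    obtain ⟨Φ, hm, hmx⟩ := Finset.exists_max_image
      (Finset.univ.filter fun Φ : Finset (V × Finset V) => IsFan G R (S ∪ Z) Z v Φ)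
      Finset.card ⟨∅, by simpa using ⟨by simp, by simp, by simp, by simp, by simp, by simp,
        by simp⟩⟩
    exact ⟨Φ, (Finset.mem_filter.1 hm).2, fun Φ' h =>
      hmx Φ' (Finset.mem_filter.2 ⟨Finset.mem_univ _, h⟩)⟩
  choose Φ hΦ hΦmax using hfan
  obtain ⟨I, hIS, hIcard, hI⟩ := exists_independent_of_degenerate (Linked F)
    (fun _ _ h => h.symm) (2 * d) S fun T hT hne =>
      exists_le_of_card_pairs_le _ hne (card_linked_le hd hF hT)
  have hIne : I.Nonempty := by
    rw [← Finset.card_pos]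
    by_contra h
    have : I.card = 0 := by omega
    rw [this] at hIcard
    have := hS.card_pos
    omega
  have hdisj : ∀ v ∈ I, ∀ w ∈ I, v ≠ w → ∀ t ∈ Φ v, ∀ t' ∈ Φ w, Disjoint t.2 t'.2 := by
    intro v hv w hw hvw t ht t' ht'
    rw [Finset.disjoint_left]
    intro x hx hx'
    have h1 : Link G ((t.2 ∪ t'.2 : Finset V) : Set V) v x :=
      ((hΦ v).link_mem t ht x hx).mono (by simp)
    have h2 : Link G ((t.2 ∪ t'.2 : Finset V) : Set V) w x :=
      ((hΦ w).link_mem t' ht' x hx').mono (by simp)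
    have h3 := h1.trans h2.symm (by simp [hx])
    have hdis : Disjoint (t.2 ∪ t'.2) (S ∪ Z) := Finset.disjoint_union_left.2
      ⟨(hΦ v).disjoint_branch t ht, (hΦ w).disjoint_branch t' ht'⟩
    rw [Finset.disjoint_union_right] at hdis
    have hnew : ∀ t ∈ F, s(v, w) ≠ s(t.1, t.2.1) := fun t ht he => hI v hv w hw hvw ⟨t, ht, he⟩
    have hle := hmax _ (hF.insert (hIS hv) (hIS hw) hvw ((Finset.card_union_le _ _).trans (by
      have := (hΦ v).card_le t ht
      have := (hΦ w).card_le t' ht'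
      omega)) hdis.1 hdis.2 h3 hnew)
    rw [Finset.card_insert_of_notMem fun h => hnew _ h rfl] at hle
    omega
  have hZS : Disjoint Z S := by
    rw [Finset.disjoint_biUnion_left]
    exact hF.disjoint_branch
  have hfans : IsLinkSys G (2 * R) (I ∪ Z)
      (I.biUnion fun v => (Φ v).image fun t => (v, t.1, t.2)) := by
    have hmem : ∀ x ∈ I.biUnion fun v => (Φ v).image fun t => (v, t.1, t.2),
        x.1 ∈ I ∧ x.2 ∈ Φ x.1 := by
      intro x hx
      simp only [Finset.mem_biUnion, Finset.mem_image] at hx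
      obtain ⟨v, hv, t, ht, rfl⟩ := hx
      exact ⟨hv, ht⟩
    have hne : ∀ v ∈ I, ∀ t ∈ Φ v, ∀ w ∈ I, w ≠ t.1 := by
      rintro v hv t ht w hw rfl
      exact Finset.disjoint_left.1 hZS ((hΦ v).fst_mem t ht) (hIS hw)
    constructor
    · exact fun x hx => Finset.mem_union_left _ (hmem x hx).1
    · exact fun x hx => Finset.mem_union_right _ ((hΦ _).fst_mem _ (hmem x hx).2)
    · exact fun x hx => hne _ (hmem x hx).1 _ (hmem x hx).2 _ (hmem x hx).1
    · exact fun x hx => ((hΦ _).card_le _ (hmem x hx).2).trans (by omega)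
    · exact fun x hx => ((hΦ _).disjoint_branch _ (hmem x hx).2).mono_right
        (Finset.union_subset_union_left hIS)
    · exact fun x hx => (hΦ _).link _ (hmem x hx).2
    · intro x hx y hy hxy
      by_cases hv : x.1 = y.1
      · refine (hΦ x.1).disjoint _ (hmem x hx).2 _ (hv ▸ (hmem y hy).2) fun h => hxy ?_
        exact Prod.ext hv h
      · exact hdisj _ (hmem x hx).1 _ (hmem y hy).1 hv _ (hmem x hx).2 _ (hmem y hy).2
    · intro x hx y hy he
      rw [Sym2.eq_iff] at he
      rcases he with ⟨h1, h2⟩ | ⟨h1, -⟩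
      · exact Prod.ext h1 ((hΦ x.1).inj _ (hmem x hx).2 _ (h1 ▸ (hmem y hy).2) h2)
      · exact absurd h1 (hne _ (hmem y hy).1 _ (hmem y hy).2 _ (hmem x hx).1)
  have hcardfans : ∑ v ∈ I, (Φ v).card ≤ d * (I ∪ Z).card := by
    refine le_trans (le_of_eq ?_) (hd _ _ hfans)
    rw [Finset.card_biUnion]
    · refine Finset.sum_congr rfl fun v _ => (Finset.card_image_of_injective _ ?_).symm
      intro t t' h
      simp only [Prod.mk.injEq, true_and] at h
      exact Prod.ext h.1 h.2
    · intro v _ w _ hvw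
      rw [Function.onFun, Finset.disjoint_left]
      simp only [Finset.mem_image, not_exists, not_and]
      rintro _ ⟨t, -, rfl⟩ t' - h
      exact hvw (congrArg Prod.fst h).symm
  have hZcard : Z.card ≤ 2 * R * (d * S.card) := by
    calc Z.card ≤ ∑ t ∈ F, t.2.2.card := Finset.card_biUnion_le
      _ ≤ F.card * (2 * R) := Finset.sum_le_card_nsmul _ _ _ hF.card_le
      _ ≤ (d * S.card) * (2 * R) := Nat.mul_le_mul_right _ (hd _ _ hF)
      _ = _ := by ring
  have hdeg : ∑ v ∈ I, (S.filter fun u => Linked F v u).card ≤ 2 * d * S.card := by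
    refine le_trans ?_ (card_linked_le hd hF subset_rfl)
    rw [Finset.card_filter, Finset.sum_product]
    refine (Finset.sum_le_sum_of_subset hIS).trans (le_of_eq ?_)
    exact Finset.sum_congr rfl fun v _ => Finset.card_filter _ _
  set M := 2 * d * (2 * d + 1) + d * (1 + 2 * R * (d * (2 * d + 1))) with hM
  obtain ⟨v, hvI, hvM⟩ : ∃ v ∈ I, (S.filter fun u => Linked F v u).card + (Φ v).card ≤ M := by
    refine Finset.exists_le_of_sum_le (g := fun _ => M) hIne ?_
    rw [Finset.sum_add_distrib, Finset.sum_const, smul_eq_mul]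
    have h1 : (I ∪ Z).card ≤ I.card + Z.card := Finset.card_union_le _ _
    have h2 : 2 * d * S.card ≤ 2 * d * ((2 * d + 1) * I.card) := Nat.mul_le_mul_left _ hIcard
    have h3 : 2 * R * (d * S.card) ≤ 2 * R * (d * ((2 * d + 1) * I.card)) :=
      Nat.mul_le_mul_left _ (Nat.mul_le_mul_left _ hIcard)
    have h4 : d * (I ∪ Z).card ≤ d * (I.card + 2 * R * (d * ((2 * d + 1) * I.card))) :=
      Nat.mul_le_mul_left _ (by omega)
    calc _ ≤ 2 * d * ((2 * d + 1) * I.card) +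
          d * (I.card + 2 * R * (d * ((2 * d + 1) * I.card))) := by omega
      _ = I.card * M := by rw [hM]; ring
  refine ⟨v, hIS hvI, (S.filter fun u => Linked F v u) ∪ (Φ v).biUnion fun t => insert t.1 t.2,
    ?_, ?_, ?_⟩
  · have h1 : ((Φ v).biUnion fun t => insert t.1 t.2).card ≤ (Φ v).card * (R + 1) := by
      refine Finset.card_biUnion_le.trans (Finset.sum_le_card_nsmul _ _ _ fun t ht => ?_)
      exact (Finset.card_insert_le _ _).trans (by have := (hΦ v).card_le t ht; omega)
    refine (Finset.card_union_le _ _).trans ?_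
    have h2 : (Φ v).card * (R + 1) ≤ M * (R + 1) := Nat.mul_le_mul_right _ (by omega)
    have : M * (R + 2) = M + M * (R + 1) := by ring
    omega
  · simp only [Finset.mem_union, Finset.mem_filter, Finset.mem_biUnion, Finset.mem_insert, not_or,
      not_and, not_exists]
    refine ⟨fun _ ⟨t, ht, he⟩ => ?_, fun t ht => ⟨?_, ?_⟩⟩
    · rw [Sym2.eq_iff] at he
      rcases he with ⟨h1, h2⟩ | ⟨h1, h2⟩ <;> exact hF.ne t ht (by rw [← h1, ← h2])
    · rintro rfl
      exact Finset.disjoint_left.1 hZS ((hΦ _).fst_mem t ht) (hIS hvI)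
    · exact fun h => Finset.disjoint_left.1 ((hΦ v).disjoint_branch t ht) h
        (Finset.mem_union_left _ (hIS hvI))
  · intro l g hl h0 hlS hlv hadj hinn
    obtain ⟨s, hs0, hsl, h | ⟨t, ht, h⟩⟩ :=
      exists_mem_barrier hF hmax (hIS hvI) (hΦ v) (hΦmax v) hl h0 hlS hlv hadj hinn
    · refine ⟨s, hs0, hsl, Finset.mem_union_left _ (Finset.mem_filter.2 ⟨?_, h⟩)⟩
      obtain ⟨t, ht, he⟩ := h
      rw [Sym2.eq_iff] at he
      rcases he with ⟨-, h2⟩ | ⟨-, h2⟩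
      · exact h2 ▸ hF.snd_mem t ht
      · exact h2 ▸ hF.fst_mem t ht
    · exact ⟨s, hs0, hsl, Finset.mem_union_right _ (Finset.mem_biUnion.2
        ⟨t, ht, Finset.mem_insert.2 h⟩)⟩

end Barrier

/-! ## Low tree-depth colorings -/

section LowTreeDepth

variable {V : Type*} {G : SimpleGraph V}

theorem exists_rank [Fintype V] {R q : ℕ}
    (h : ∀ S : Finset V, S.Nonempty → ∃ v ∈ S, ∃ Q : Finset V, Q.card ≤ q ∧
      ∀ (l : ℕ) (g : ℕ → V), l ≤ R → g 0 = v → g l ∈ S → g l ≠ v →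
        (∀ s < l, G.Adj (g s) (g (s + 1))) → (∀ s, 0 < s → s < l → g s ∉ S) →
        ∃ s, 0 < s ∧ s ≤ l ∧ g s ∈ Q) :
    ∃ (ρ : V → ℕ) (Q : V → Finset V), Function.Injective ρ ∧ (∀ v, (Q v).card ≤ q) ∧
      ∀ (v : V) (l : ℕ) (g : ℕ → V), l ≤ R → g 0 = v → ρ (g l) < ρ v →
        (∀ s < l, G.Adj (g s) (g (s + 1))) → (∀ s, 0 < s → s < l → ρ v < ρ (g s)) →
        ∃ s, 0 < s ∧ s ≤ l ∧ g s ∈ Q v := by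
  classical
  have key : ∀ (k : ℕ) (S : Finset V), S.card = k → ∃ (ρ : V → ℕ) (Q : V → Finset V),
      Set.InjOn ρ S ∧ (∀ v ∈ S, ρ v ≤ S.card) ∧ (∀ v, (Q v).card ≤ q) ∧
      ∀ v ∈ S, ∀ (l : ℕ) (g : ℕ → V), l ≤ R → g 0 = v → g l ∈ S → ρ (g l) < ρ v →
        (∀ s < l, G.Adj (g s) (g (s + 1))) →
        (∀ s, 0 < s → s < l → g s ∈ S → ρ v < ρ (g s)) → ∃ s, 0 < s ∧ s ≤ l ∧ g s ∈ Q v := by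
    intro k
    induction k with
    | zero =>
      intro S hS
      obtain rfl := Finset.card_eq_zero.1 hS
      exact ⟨fun _ => 0, fun _ => ∅, by simp, by simp, by simp, by simp⟩
    | succ k ih =>
      intro S hS
      obtain ⟨v, hv, Q', hQ'card, hQ'⟩ := h S (Finset.card_pos.1 (by omega))
      have hcard : (S.erase v).card = k := by rw [Finset.card_erase_of_mem hv]; omega
      obtain ⟨ρ, Q, hinj, hle, hQcard, hQ⟩ := ih (S.erase v) hcard
      have hlt : ∀ u ∈ S, u ≠ v → ρ u < k + 1 := fun u hu huv => by
        have := hle u (Finset.mem_erase.2 ⟨huv, hu⟩)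
        omega
      refine ⟨Function.update ρ v (k + 1), Function.update Q v Q', ?_, ?_, ?_, ?_⟩
      · intro u hu w hw he
        by_cases huv : u = v <;> by_cases hwv : w = v
        · rw [huv, hwv]
        · subst huv
          rw [Function.update_self, Function.update_of_ne hwv] at he
          exact absurd he (hlt w hw hwv).ne'
        · subst hwv
          rw [Function.update_self, Function.update_of_ne huv] at he
          exact absurd he (hlt u hu huv).ne
        · rw [Function.update_of_ne hwv, Function.update_of_ne huv] at he
          exact hinj (by simpa [huv] using hu) (by simpa [hwv] using hw) he
      · intro u hu
        by_cases huv : u = v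
        · rw [huv, Function.update_self, hS]
        · rw [Function.update_of_ne huv, hS]
          exact (hlt u hu huv).le
      · intro u
        by_cases huv : u = v
        · rw [huv, Function.update_self]; exact hQ'card
        · rw [Function.update_of_ne huv]; exact hQcard u
      · intro u hu l g hl h0 hgl hρ hadj hinn
        by_cases huv : u = v
        · subst huv
          rw [Function.update_self]
          refine hQ' l g hl h0 hgl (fun he => ?_) hadj fun s h1 h2 hs => ?_
          · rw [he] at hρ
            exact lt_irrefl _ hρ
          · have := hinn s h1 h2 hs
            rw [Function.update_self] at this
            by_cases hsu : g s = u
            · rw [hsu, Function.update_self] at this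
              exact lt_irrefl _ this
            · rw [Function.update_of_ne hsu] at this
              exact absurd this (hlt _ hs hsu).not_gt
        · rw [Function.update_of_ne huv] at hρ ⊢
          have hglv : g l ≠ v := by
            intro he
            rw [he, Function.update_self] at hρ
            exact absurd hρ (hlt u hu huv).not_gt
          rw [Function.update_of_ne hglv] at hρ
          refine hQ u (Finset.mem_erase.2 ⟨huv, hu⟩) l g hl h0 (Finset.mem_erase.2 ⟨hglv, hgl⟩) hρ
            hadj fun s h1 h2 hs => ?_
          have := hinn s h1 h2 (Finset.mem_of_mem_erase hs)
          rwa [Function.update_of_ne huv, Function.update_of_ne (Finset.ne_of_mem_erase hs)] at this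
  obtain ⟨ρ, Q, hinj, -, hQcard, hQ⟩ := key _ Finset.univ rfl
  exact ⟨ρ, Q, fun u v he => hinj (by simp) (by simp) he, hQcard,
    fun v l g hl h0 hlt hadj hinn => hQ v (by simp) l g hl h0 (by simp) hlt hadj
      fun s h1 h2 _ => hinn s h1 h2⟩

/-- `u` is weakly `l`-reachable from `v`: some walk of length at most `l` from `v` to `u` has all
its ranks at least that of `u`. -/
def WReach {V : Type*} (G : SimpleGraph V) (ρ : V → ℕ) (l : ℕ) (v u : V) : Prop :=
  ∃ m ≤ l, ∃ g : ℕ → V, g 0 = v ∧ g m = u ∧ (∀ s < m, G.Adj (g s) (g (s + 1))) ∧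
    ∀ s ≤ m, ρ u ≤ ρ (g s)

theorem WReach.exists_step {ρ : V → ℕ} {Q : V → Finset V} {R : ℕ} (hρ : Function.Injective ρ)
    (hQ : ∀ (v : V) (l : ℕ) (g : ℕ → V), l ≤ R → g 0 = v → ρ (g l) < ρ v →
        (∀ s < l, G.Adj (g s) (g (s + 1))) → (∀ s, 0 < s → s < l → ρ v < ρ (g s)) →
        ∃ s, 0 < s ∧ s ≤ l ∧ g s ∈ Q v) {l : ℕ} (hl : l + 1 ≤ R) {v u : V}
    (h : WReach G ρ (l + 1) v u) (huv : u ≠ v) : ∃ x ∈ Q v, WReach G ρ l x u := by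
  classical
  obtain ⟨m, hm, g, h0, hgm, hadj, hrank⟩ := h
  have hlt : ρ u < ρ v := lt_of_le_of_ne (h0 ▸ hrank 0 (by omega)) (hρ.ne huv)
  have hex : ∃ k j, j + k ≤ m ∧ g j = v ∧ ρ (g (j + k)) < ρ v :=
    ⟨m, 0, by omega, h0, by rwa [zero_add, hgm]⟩
  obtain ⟨j, hjk, hj, hjlt⟩ := Nat.find_spec hex
  have hmin := fun i (hi : i < Nat.find hex) => Nat.find_min hex hi
  generalize Nat.find hex = k at *
  obtain ⟨s, hs0, hsk, hsQ⟩ := hQ v k (fun s => g (j + s)) (by omega) hj hjlt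
    (fun s hs => hadj _ (by omega)) fun s hs0 hsk => by
      by_contra hle
      rcases lt_or_eq_of_le (not_lt.1 hle) with hlt' | heq
      · exact hmin s hsk ⟨j, by omega, hj, hlt'⟩
      · refine hmin (k - s) (by omega) ⟨j + s, by omega, hρ heq, ?_⟩
        rwa [show j + s + (k - s) = j + k by omega]
  refine ⟨_, hsQ, m - (j + s), by omega, fun i => g (j + s + i), rfl, ?_, fun i hi => ?_,
    fun i hi => hrank _ (by omega)⟩
  · dsimp only
    rw [show j + s + (m - (j + s)) = m by omega, hgm]
  · exact hadj _ (by omega)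

/-- A bound on the number of weakly reachable vertices. -/
def wreachBound (q : ℕ) : ℕ → ℕ
  | 0 => 1
  | l + 1 => 1 + q * wreachBound q l

theorem exists_wreach_bound {ρ : V → ℕ} {Q : V → Finset V} {R q : ℕ} (hρ : Function.Injective ρ)
    (hQcard : ∀ v, (Q v).card ≤ q)
    (hQ : ∀ (v : V) (l : ℕ) (g : ℕ → V), l ≤ R → g 0 = v → ρ (g l) < ρ v →
        (∀ s < l, G.Adj (g s) (g (s + 1))) → (∀ s, 0 < s → s < l → ρ v < ρ (g s)) →
        ∃ s, 0 < s ∧ s ≤ l ∧ g s ∈ Q v) {l : ℕ} (hl : l ≤ R) (v : V) :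
    ∃ T : Finset V, T.card ≤ wreachBound q l ∧ ∀ u, WReach G ρ l v u → u ∈ T := by
  classical
  induction l generalizing v with
  | zero =>
    refine ⟨{v}, by simp [wreachBound], ?_⟩
    rintro u ⟨m, hm, g, h0, hgm, -⟩
    obtain rfl : m = 0 := by omega
    simp [← h0, hgm]
  | succ l ih =>
    choose T hTcard hT using fun v => ih (by omega : l ≤ R) v
    refine ⟨insert v ((Q v).biUnion T), ?_, fun u hu => ?_⟩
    · have h1 : ((Q v).biUnion T).card ≤ (Q v).card * wreachBound q l :=
        Finset.card_biUnion_le.trans (Finset.sum_le_card_nsmul _ _ _ fun x _ => hTcard x)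
      have h2 := Nat.mul_le_mul_right (wreachBound q l) (hQcard v)
      have := Finset.card_insert_le v ((Q v).biUnion T)
      rw [wreachBound]
      omega
    · by_cases huv : u = v
      · simp [huv]
      · obtain ⟨x, hx, hxu⟩ := hu.exists_step hρ hQ hl huv
        exact Finset.mem_insert_of_mem (Finset.mem_biUnion.2 ⟨x, hx, hT x u hxu⟩)

theorem exists_wreach_coloring [Fintype V] {ρ : V → ℕ} (hρ : Function.Injective ρ) {R w : ℕ}
    (hw : ∀ v, ∃ T : Finset V, T.card ≤ w ∧ ∀ u, WReach G ρ R v u → u ∈ T) :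
    ∃ c : V → Fin (w + 1), ∀ u v, u ≠ v → WReach G ρ R v u → c u ≠ c v := by
  classical
  obtain ⟨conf, hconf⟩ : ∃ conf : V → V → Prop,
      ∀ u v, conf u v ↔ WReach G ρ R u v ∨ WReach G ρ R v u := ⟨_, fun _ _ => Iff.rfl⟩
  obtain ⟨c, hc⟩ := exists_coloring_of_degenerate conf
    (fun u v h => (hconf v u).2 ((hconf u v).1 h).symm) w Finset.univ
    fun S _ hS => by
      obtain ⟨v, hv, hmax⟩ := Finset.exists_max_image S ρ hS
      obtain ⟨T, hTcard, hT⟩ := hw v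
      refine ⟨v, hv, (Finset.card_le_card fun u hu => ?_).trans hTcard⟩
      obtain ⟨huS, h⟩ := Finset.mem_filter.1 hu
      rcases (hconf v u).1 h with h | h
      · exact hT u h
      · obtain ⟨m, hm, g, h0, hgm, hadj, hrank⟩ := h
        have h1 := hrank 0 (by omega)
        rw [h0] at h1
        obtain rfl := hρ (le_antisymm h1 (hmax u huS))
        exact hT v ⟨m, hm, g, h0, hgm, hadj, hrank⟩
  exact ⟨c, fun u v huv h => hc u (by simp) v (by simp) huv ((hconf u v).2 (Or.inr h))⟩

theorem lt_card_image_of_path [DecidableEq V] {α : Type*} [DecidableEq α] {ρ : V → ℕ} {R : ℕ}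
    {c : V → α} (hc : ∀ u v, u ≠ v → WReach G ρ R v u → c u ≠ c v) (k : ℕ) (hk : 2 ^ k ≤ R)
    (g : ℕ → V) (a : ℕ)
    (hadj : ∀ s, a ≤ s → s + 1 < a + 2 ^ k → G.Adj (g s) (g (s + 1)))
    (hinj : ∀ s t, a ≤ s → s < t → t < a + 2 ^ k → g s ≠ g t) :
    k < ((Finset.Ico a (a + 2 ^ k)).image fun s => c (g s)).card := by
  induction k generalizing a with
  | zero => simp
  | succ k ih =>
    have hpow : 2 ^ (k + 1) = 2 ^ k + 2 ^ k := by ring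
    have hkpos : 0 < 2 ^ k := by positivity
    obtain ⟨m, hm, hmin⟩ := Finset.exists_min_image (Finset.Ico a (a + 2 ^ (k + 1)))
      (fun s => ρ (g s)) ⟨a, by simp⟩
    have hm' := Finset.mem_Ico.1 hm
    have hne : ∀ s ∈ Finset.Ico a (a + 2 ^ (k + 1)), s ≠ m → c (g m) ≠ c (g s) := by
      intro s hs hsm
      have hs' := Finset.mem_Ico.1 hs
      rcases Nat.lt_or_gt_of_ne hsm with hlt | hlt
      · refine hc _ _ (hinj s m hs'.1 hlt hm'.2).symm
          ⟨m - s, by omega, fun i => g (s + i), rfl, ?_, fun i hi => hadj _ (by omega) (by omega),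
            fun i hi => hmin _ (Finset.mem_Ico.2 ⟨by omega, by omega⟩)⟩
        dsimp only
        rw [show s + (m - s) = m by omega]
      · refine hc _ _ (hinj m s hm'.1 hlt hs'.2)
          ⟨s - m, by omega, fun i => g (s - i), rfl, ?_, fun i hi => ?_,
            fun i hi => hmin _ (Finset.mem_Ico.2 ⟨by omega, by omega⟩)⟩
        · dsimp only
          rw [show s - (s - m) = m by omega]
        · have := hadj (s - (i + 1)) (by omega) (by omega)
          rw [show s - (i + 1) + 1 = s - i by omega] at this
          exact this.symm
    obtain ⟨b, hab, hb, hmb⟩ : ∃ b, a ≤ b ∧ b + 2 ^ k ≤ a + 2 ^ (k + 1) ∧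
        m ∉ Finset.Ico b (b + 2 ^ k) := by
      by_cases hma : m < a + 2 ^ k
      · exact ⟨a + 2 ^ k, by omega, by omega, by simp; omega⟩
      · exact ⟨a, by omega, by omega, by simp; omega⟩
    have h1 := ih (by omega) b (fun s hs1 hs2 => hadj s (by omega) (by omega))
      fun s t hs hst ht => hinj s t (by omega) hst (by omega)
    have hsub : Finset.Ico b (b + 2 ^ k) ⊆ Finset.Ico a (a + 2 ^ (k + 1)) :=
      Finset.Ico_subset_Ico hab hb
    have h2 : insert (c (g m)) ((Finset.Ico b (b + 2 ^ k)).image fun s => c (g s)) ⊆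
        (Finset.Ico a (a + 2 ^ (k + 1))).image fun s => c (g s) :=
      Finset.insert_subset (Finset.mem_image_of_mem (fun s => c (g s)) hm)
        (Finset.image_subset_image hsub)
    have h3 := Finset.card_le_card h2
    rw [Finset.card_insert_of_notMem] at h3
    · omega
    · intro hmem
      obtain ⟨s, hs, he⟩ := Finset.mem_image.1 hmem
      exact hne s (hsub hs) (fun h => hmb (h ▸ hs)) he.symm

theorem treeDepthLE_of_wreach_coloring {N p : ℕ} {ρ : V → ℕ} (hρ : Function.Injective ρ)
    {c : V → Fin N} (hc : ∀ u v, u ≠ v → WReach G ρ (2 ^ p) v u → c u ≠ c v)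
    (I : Finset (Fin N)) (hI : I.card ≤ p) :
    TreeDepthLE (G.induce {v | c v ∈ I}) I.card := by
  classical
  let P : V → Set V := fun u => {x | c x ∈ I ∧ ρ u ≤ ρ x}
  let r : {v | c v ∈ I} → {v | c v ∈ I} → Prop := fun u w =>
    ρ u.1 ≤ ρ w.1 ∧ Link G (P u.1) w.1 u.1
  have hchain : ∀ u v w, ρ u.1 ≤ ρ v.1 → r u w → r v w → r u v := by
    intro u v w hle hu hv
    refine ⟨hle, ?_⟩
    have h1 : Link G (P u.1) v.1 w.1 := hv.2.symm.mono fun x hx => ⟨hx.1, hle.trans hx.2⟩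
    exact h1.trans hu.2 ⟨w.2, hu.1⟩
  have hforest : IsForestOrder r := by
    refine ⟨fun v => ⟨le_rfl, 0, fun _ => v.1, rfl, rfl, by simp, by simp⟩,
      fun u v hu hv => Subtype.ext (hρ (le_antisymm hu.1 hv.1)),
      fun u v w hu hv => ⟨hu.1.trans hv.1, ?_⟩, fun u v w hu hv => ?_⟩
    · have h1 : Link G (P u.1) w.1 v.1 := hv.2.mono fun x hx => ⟨hx.1, hu.1.trans hx.2⟩
      exact h1.trans hu.2 ⟨v.2, hu.1⟩
    · rcases le_total (ρ u.1) (ρ v.1) with hle | hle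
      · exact Or.inl (hchain u v w hle hu hv)
      · exact Or.inr (hchain v u w hle hv hu)
  have hcolor : ∀ u v, r u v → c u.1 = c v.1 → u = v := by
    intro u v huv he
    by_contra hne
    have hne' : u.1 ≠ v.1 := fun h => hne (Subtype.ext h)
    obtain ⟨l, g, h0, hl, hP, hind⟩ := huv.2.exists_isInducedSeq
    have hmem : ∀ s ≤ l, g s ∈ P u.1 := by
      intro s hs
      rcases Nat.eq_zero_or_pos s with rfl | hpos
      · rw [h0]; exact ⟨v.2, huv.1⟩
      · rcases lt_or_eq_of_le hs with hlt | rfl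
        · exact hP s hpos hlt
        · rw [hl]; exact ⟨u.2, le_rfl⟩
    rcases le_or_gt l (2 ^ p) with hle | hgt
    · exact hc _ _ hne' ⟨l, hle, g, h0, hl, hind.1, fun s hs => (hmem s hs).2⟩ he
    · have h1 := lt_card_image_of_path hc p le_rfl g 0 (fun s _ hs => hind.1 s (by omega))
        fun s t _ hst ht => (hind.2 s t hst (by omega)).1
      have h2 : ((Finset.Ico 0 (0 + 2 ^ p)).image fun s => c (g s)) ⊆ I := by
        intro x hx
        obtain ⟨s, hs, rfl⟩ := Finset.mem_image.1 hx
        have hs := Finset.mem_Ico.1 hs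
        exact (hmem s (by omega)).1
      have := Finset.card_le_card h2
      omega
  refine ⟨r, hforest, fun u v huv => ?_, fun v => ?_⟩
  · have hadj : G.Adj u.1 v.1 := huv
    rcases le_total (ρ u.1) (ρ v.1) with hle | hle
    · exact Or.inl ⟨hle, Link.of_adj hadj.symm⟩
    · exact Or.inr ⟨hle, Link.of_adj hadj⟩
  · rw [← Set.ncard_coe_finset I]
    refine Set.ncard_le_ncard_of_injOn (fun u => c u.1) (fun u _ => u.2) (fun u hu w hw he => ?_)
      I.finite_toSet
    rcases hforest.2.2.2 u w v hu hw with h | h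
    · exact hcolor u w h he
    · exact (hcolor w u h he.symm).symm

theorem exists_chiP_le (p d : ℕ) : ∃ N, ∀ (n : ℕ) (G : SimpleGraph (Fin n)),
    (∀ B F, IsLinkSys G (2 * 2 ^ p) B F → F.card ≤ d * B.card) → chiP G p ≤ N := by
  refine ⟨wreachBound ((2 * d * (2 * d + 1) + d * (1 + 2 * 2 ^ p * (d * (2 * d + 1)))) *
    (2 ^ p + 2)) (2 ^ p) + 1, fun n G hd => ?_⟩
  obtain ⟨ρ, Q, hρ, hQcard, hQ⟩ := exists_rank (G := G) (R := 2 ^ p) fun S hS => by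
    obtain ⟨v, hv, Q, hQ, -, h⟩ := exists_barrier hd hS
    exact ⟨v, hv, Q, hQ, h⟩
  obtain ⟨c, hc⟩ := exists_wreach_coloring (G := G) hρ
    fun v => exists_wreach_bound hρ hQcard hQ le_rfl v
  exact Nat.sInf_le ⟨c, fun I hI => treeDepthLE_of_wreach_coloring hρ hc I hI⟩

theorem StronglyChiPBounded.of_omegaBoundedExpansion {C : GraphClass}
    (h : OmegaBoundedExpansion C) (p : ℕ) : StronglyChiPBounded C p := by
  obtain ⟨f, hf⟩ := h
  choose N hN using exists_chiP_le p
  refine ⟨fun w => N ⌈f w (2 * 2 ^ p)⌉₊, fun n G hG => hN _ n G fun B F hF => ?_⟩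
  have h1 := hF.card_le_of_avgDeg_le (fun m H hH => hf G hG (2 * 2 ^ p) H hH)
  have h2 := Nat.le_ceil (f (omegaNum G) (2 * 2 ^ p))
  have h3 : (F.card : ℝ) ≤ ((⌈f (omegaNum G) (2 * 2 ^ p)⌉₊ * B.card : ℕ) : ℝ) := by
    push_cast
    have h4 := mul_le_mul_of_nonneg_right h2 (Nat.cast_nonneg (α := ℝ) B.card)
    have h5 : (0 : ℝ) ≤ F.card := Nat.cast_nonneg _
    linarith
  exact_mod_cast h3

end LowTreeDepth

/-! ## Induced subdivisions in bipartite graphs without large bicliques -/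

section Biclique

variable {V : Type*} {G : SimpleGraph V}

open Classical in
/-- The neighbors of `v` in `X`. -/
noncomputable def nbrs {V : Type*} (G : SimpleGraph V) (X : Finset V) (v : V) : Finset V :=
  X.filter fun x => G.Adj v x

theorem mem_nbrs {X : Finset V} {v x : V} : x ∈ nbrs G X v ↔ x ∈ X ∧ G.Adj v x := by
  simp [nbrs]

theorem nbrs_subset {X : Finset V} {v : V} : nbrs G X v ⊆ X := fun _ h => (mem_nbrs.1 h).1

theorem nbrs_mono {X Y : Finset V} (h : X ⊆ Y) {v : V} : nbrs G X v ⊆ nbrs G Y v :=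
  fun _ hx => mem_nbrs.2 ⟨h (mem_nbrs.1 hx).1, (mem_nbrs.1 hx).2⟩

/-- The number of pairs of adjacent vertices in `X × Y`. -/
noncomputable def crossEdges {V : Type*} (G : SimpleGraph V) (X Y : Finset V) : ℕ :=
  ∑ y ∈ Y, (nbrs G X y).card

theorem crossEdges_comm (X Y : Finset V) : crossEdges G X Y = crossEdges G Y X := by
  classical
  simp only [crossEdges, nbrs, Finset.card_filter]
  rw [Finset.sum_comm]
  exact Finset.sum_congr rfl fun x _ => Finset.sum_congr rfl fun y _ =>
    if_congr (G.adj_comm _ _) rfl rfl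

/-- `X` and `Y` contain no sets of sizes `a` and `b` that are completely joined. -/
def BicliqueFree {V : Type*} (G : SimpleGraph V) (X Y : Finset V) (a b : ℕ) : Prop :=
  ∀ A ⊆ X, ∀ B ⊆ Y, A.card = a → B.card = b → ∃ x ∈ A, ∃ y ∈ B, ¬ G.Adj x y

theorem BicliqueFree.symm {X Y : Finset V} {a b : ℕ} (h : BicliqueFree G X Y a b) :
    BicliqueFree G Y X b a := by
  intro A hA B hB hAa hBb
  obtain ⟨x, hx, y, hy, hxy⟩ := h B hB A hA hBb hAa
  exact ⟨y, hy, x, hx, fun h => hxy h.symm⟩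

theorem BicliqueFree.mono {X Y X' Y' : Finset V} {a b : ℕ} (h : BicliqueFree G X Y a b)
    (hX : X' ⊆ X) (hY : Y' ⊆ Y) : BicliqueFree G X' Y' a b :=
  fun A hA B hB => h A (hA.trans hX) B (hB.trans hY)

/-- `G` contains an induced `1`-subdivision with more than `D` edges per branch vertex: the set
`T` of subdivision vertices is matched with distinct pairs of elements of `B`. -/
def HasDenseSubdivision {V : Type*} (G : SimpleGraph V) (D : ℕ) : Prop :=
  ∃ B T : Finset V, (∀ u ∈ B, ∀ v ∈ B, ¬ G.Adj u v) ∧ (∀ u ∈ T, ∀ v ∈ T, ¬ G.Adj u v) ∧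
    Disjoint T B ∧ (∀ y ∈ T, ∃ u ∈ B, ∃ v ∈ B, u ≠ v ∧ ∀ x ∈ B, G.Adj y x ↔ x = u ∨ x = v) ∧
    (∀ y ∈ T, ∀ z ∈ T, nbrs G B y = nbrs G B z → y = z) ∧ D * B.card < T.card

theorem hasDenseSubdivision_of_light [Fintype V] {X Y : Finset V} {D W m : ℕ}
    (hX : ∀ u ∈ X, ∀ v ∈ X, ¬ G.Adj u v) (hY : ∀ u ∈ Y, ∀ v ∈ Y, ¬ G.Adj u v)
    (hXY : Disjoint X Y) (hm : 1 ≤ m) (hdeg : ∀ y ∈ Y, (nbrs G X y).card ≤ m)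
    {E : Finset (V × V × V)}
    (hE : ∀ t ∈ E, t.1 ≠ t.2.1 ∧ t.2.2 ∈ Y ∧ t.1 ∈ nbrs G X t.2.2 ∧ t.2.1 ∈ nbrs G X t.2.2)
    (hlight : ∀ t ∈ E, ∃ C : Finset V, C.card ≤ W ∧
      ∀ y ∈ Y, t.1 ∈ nbrs G X y → t.2.1 ∈ nbrs G X y → y ∈ C)
    (hcard : 4 * m * (2 * W * D) * X.card < E.card) : HasDenseSubdivision G D := by
  classical
  obtain ⟨B, hBX, hB⟩ := exists_restriction X E (fun t => t.1) (fun t => t.2.1)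
    (fun t => nbrs G X t.2.2 \ {t.1, t.2.1}) (2 * m) (2 * W * D) (by omega)
    (fun t ht => nbrs_subset (hE t ht).2.2.1) (fun t ht => nbrs_subset (hE t ht).2.2.2)
    (fun t ht => (hE t ht).1) (by simp) (by simp)
    (fun t ht => Nat.mul_le_mul_left _
      ((Finset.card_le_card Finset.sdiff_subset).trans (hdeg _ (hE t ht).2.1)))
    (by linarith)
  set E' := E.filter fun t => t.1 ∈ B ∧ t.2.1 ∈ B ∧ Disjoint (nbrs G X t.2.2 \ {t.1, t.2.1}) B
    with hE'
  have hE'mem : ∀ t ∈ E', t.1 ∈ B ∧ t.2.1 ∈ B ∧ nbrs G B t.2.2 = {t.1, t.2.1} := by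
    intro t ht
    obtain ⟨htE, h1, h2, h3⟩ := Finset.mem_filter.1 ht
    obtain ⟨-, -, h4, h5⟩ := hE t htE
    refine ⟨h1, h2, Finset.ext fun x => ?_⟩
    rw [mem_nbrs]
    constructor
    · rintro ⟨hxB, hx⟩
      by_contra hne
      exact Finset.disjoint_left.1 h3 (Finset.mem_sdiff.2 ⟨mem_nbrs.2 ⟨hBX hxB, hx⟩, hne⟩) hxB
    · intro hx
      rcases Finset.mem_insert.1 hx with rfl | hx
      · exact ⟨h1, (mem_nbrs.1 h4).2⟩
      · rw [Finset.mem_singleton] at hx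
        subst hx
        exact ⟨h2, (mem_nbrs.1 h5).2⟩
  have himg : E'.card ≤ 2 * W * (E'.image fun t => nbrs G B t.2.2).card := by
    refine Finset.card_le_mul_card_image _ _ fun S hS => ?_
    obtain ⟨t, ht, rfl⟩ := Finset.mem_image.1 hS
    obtain ⟨C, hC, hCmem⟩ := hlight t (Finset.mem_filter.1 ht).1
    have hsub : (E'.filter fun s => nbrs G B s.2.2 = nbrs G B t.2.2) ⊆
        (C.image fun y => (t.1, t.2.1, y)) ∪ (C.image fun y => (t.2.1, t.1, y)) := by
      intro s hs
      obtain ⟨hsE, hst⟩ := Finset.mem_filter.1 hs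
      have h1 := (hE'mem s hsE).2.2
      have h2 := (hE'mem t ht).2.2
      have hyY := (hE s (Finset.mem_filter.1 hsE).1).2.1
      have hBn : nbrs G B s.2.2 ⊆ nbrs G X s.2.2 := nbrs_mono hBX
      have hsC : s.2.2 ∈ C := hCmem _ hyY (hBn (by rw [hst, h2]; simp))
        (hBn (by rw [hst, h2]; simp))
      rw [hst, h2] at h1
      have h3 : s(t.1, t.2.1) = s(s.1, s.2.1) := by
        have : ({t.1, t.2.1} : Set V) = {s.1, s.2.1} := by
          have := congrArg (fun S : Finset V => (S : Set V)) h1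
          simpa using this
        rw [Sym2.eq_iff]
        exact Set.pair_eq_pair_iff.1 this
      rw [Finset.mem_union, Finset.mem_image, Finset.mem_image]
      rw [Sym2.eq_iff] at h3
      rcases h3 with ⟨h4, h5⟩ | ⟨h4, h5⟩
      · exact Or.inl ⟨_, hsC, by rw [h4, h5]⟩
      · exact Or.inr ⟨_, hsC, by rw [h4, h5]⟩
    refine (Finset.card_le_card hsub).trans ((Finset.card_union_le _ _).trans ?_)
    have h1 := Finset.card_image_le (s := C) (f := fun y => (t.1, t.2.1, y))
    have h2 := Finset.card_image_le (s := C) (f := fun y => (t.2.1, t.1, y))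
    omega
  rw [show (E'.image fun t => nbrs G B t.2.2) = (E'.image fun t => t.2.2).image (nbrs G B) by
    rw [Finset.image_image]; rfl] at himg
  obtain ⟨T, hTsub, hTinj, hTimg⟩ :=
    Finset.exists_subset_injOn_image_eq_of_surjOn (f := nbrs G B)
      (E'.image fun t => t.2.2 : Finset V) ((E'.image fun t => t.2.2).image (nbrs G B))
      (by rw [Finset.coe_image (f := nbrs G B)]; exact Set.surjOn_image _ _)
  have hTmem : ∀ y ∈ T, ∃ t ∈ E', t.2.2 = y := fun y hy => Finset.mem_image.1 (hTsub hy)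
  have hTY : T ⊆ Y := fun y hy => by
    obtain ⟨t, ht, rfl⟩ := hTmem y hy
    exact (hE t (Finset.mem_filter.1 ht).1).2.1
  refine ⟨B, T, fun u hu v hv => hX u (hBX hu) v (hBX hv), fun u hu v hv => hY u (hTY hu) v (hTY hv),
    (hXY.mono hBX hTY).symm, fun y hy => ?_, fun y hy z hz h => hTinj hy hz h, ?_⟩
  · obtain ⟨t, ht, rfl⟩ := hTmem y hy
    obtain ⟨h1, h2, h3⟩ := hE'mem t ht
    refine ⟨t.1, h1, t.2.1, h2, (hE t (Finset.mem_filter.1 ht).1).1, fun x hx => ?_⟩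
    have := Finset.ext_iff.1 h3 x
    rw [mem_nbrs, Finset.mem_insert, Finset.mem_singleton] at this
    exact ⟨fun h => this.1 ⟨hx, h⟩, fun h => (this.2 h).2⟩
  · rw [← hTimg, Finset.card_image_of_injOn hTinj] at himg
    have h1 : 2 * W * (D * B.card) < 2 * W * T.card := by
      calc _ = 2 * W * D * B.card := by ring
        _ < _ := lt_of_lt_of_le hB himg
    exact Nat.lt_of_mul_lt_mul_left h1

theorem hasDenseSubdivision_step [Fintype V] {X Y : Finset V} {D d m a b : ℕ}
    (hX : ∀ u ∈ X, ∀ v ∈ X, ¬ G.Adj u v) (hY : ∀ u ∈ Y, ∀ v ∈ Y, ¬ G.Adj u v)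
    (hXY : Disjoint X Y) (hle : X.card ≤ Y.card) (hYne : Y.Nonempty)
    (hm : 128 * (4 * d * D) + 64 * d + 2 ≤ m) (hdeg : ∀ y ∈ Y, m ≤ (nbrs G X y).card)
    (he : crossEdges G X Y ≤ m * (X.card + Y.card)) (hfree : BicliqueFree G X Y (a + 1) b)
    (ih : ∀ X' ⊆ X, ∀ Y' ⊆ Y, BicliqueFree G X' Y' a b →
      d * (X'.card + Y'.card) < crossEdges G X' Y' → HasDenseSubdivision G D) :
    HasDenseSubdivision G D := by
  classical
  set Y0 := Y.filter fun y => (nbrs G X y).card ≤ 4 * m with hY0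
  have hY0Y : Y0 ⊆ Y := Finset.filter_subset _ _
  have hY0card : Y.card ≤ 2 * Y0.card := by
    have h1 : (Y \ Y0).card * (4 * m) ≤ crossEdges G X Y := by
      rw [← smul_eq_mul]
      refine (Finset.card_nsmul_le_sum _ _ _ fun y hy => ?_).trans
        (Finset.sum_le_sum_of_subset (Finset.sdiff_subset : Y \ Y0 ⊆ Y))
      rw [Finset.mem_sdiff, hY0, Finset.mem_filter, not_and, not_le] at hy
      exact (hy.2 hy.1).le
    have h2 : (Y \ Y0).card + Y0.card = Y.card := Finset.card_sdiff_add_card_eq_card hY0Y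
    have h3 : m * (4 * (Y \ Y0).card) ≤ m * (2 * Y.card) := by
      calc _ = (Y \ Y0).card * (4 * m) := by ring
        _ ≤ m * (X.card + Y.card) := h1.trans he
        _ ≤ _ := Nat.mul_le_mul_left _ (by omega)
    have := Nat.le_of_mul_le_mul_left h3 (by omega)
    omega
  have hY0pos : 0 < Y0.card := by have := hYne.card_pos; omega
  have hdeg0 : ∀ y ∈ Y0, (nbrs G X y).card ≤ 4 * m := fun y hy => (Finset.mem_filter.1 hy).2
  set W := 2 * d with hW
  set E := (X ×ˢ X ×ˢ Y0).filter fun t =>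
    t.1 ≠ t.2.1 ∧ t.1 ∈ nbrs G X t.2.2 ∧ t.2.1 ∈ nbrs G X t.2.2 with hE
  have hEmem : ∀ t ∈ E, t.2.2 ∈ Y0 ∧ t.1 ≠ t.2.1 ∧ t.1 ∈ nbrs G X t.2.2 ∧
      t.2.1 ∈ nbrs G X t.2.2 := fun t ht => by
    obtain ⟨h1, h2⟩ := Finset.mem_filter.1 ht
    simp only [Finset.mem_product] at h1
    exact ⟨h1.2.2, h2⟩
  have hEcard : Y0.card * m ^ 2 ≤ 2 * E.card := by
    rw [Finset.card_eq_sum_card_fiberwise (f := fun t => t.2.2) (t := Y0)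
      (fun t ht => (hEmem t ht).1), Finset.mul_sum, ← smul_eq_mul]
    refine Finset.card_nsmul_le_sum _ _ _ fun y hy => ?_
    have h1 : ((nbrs G X y).offDiag.image fun p => (p.1, p.2, y)) ⊆
        E.filter fun t => t.2.2 = y := by
      intro t ht
      obtain ⟨p, hp, rfl⟩ := Finset.mem_image.1 ht
      rw [Finset.mem_offDiag] at hp
      refine Finset.mem_filter.2 ⟨Finset.mem_filter.2 ⟨?_, hp.2.2, hp.1, hp.2.1⟩, rfl⟩
      simp only [Finset.mem_product]
      exact ⟨nbrs_subset hp.1, nbrs_subset hp.2.1, hy⟩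
    have h2 := Finset.card_le_card h1
    rw [Finset.card_image_of_injective _ (fun p p' h => by
      simp only [Prod.mk.injEq, and_true] at h
      exact Prod.ext h.1 h.2), Finset.offDiag_card] at h2
    have h3 := hdeg y (hY0Y hy)
    set k := (nbrs G X y).card
    have h4 : m ^ 2 ≤ k ^ 2 := Nat.pow_le_pow_left h3 2
    have h5 : 2 * k ≤ k * k := Nat.mul_le_mul_right k (by omega)
    have h6 : k ^ 2 = k * k := by ring
    omega
  by_cases hlight : Y0.card * m ^ 2 ≤
      4 * (E.filter fun t => (nbrs G Y0 t.1 ∩ nbrs G Y0 t.2.1).card ≤ W).card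
  · refine hasDenseSubdivision_of_light (X := X) (Y := Y0) (W := W) (m := 4 * m) hX
      (fun u hu v hv => hY u (hY0Y hu) v (hY0Y hv)) (hXY.mono_right hY0Y) (by omega) hdeg0
      (E := E.filter fun t => (nbrs G Y0 t.1 ∩ nbrs G Y0 t.2.1).card ≤ W)
      (fun t ht => ?_) (fun t ht => ?_) ?_
    · obtain ⟨h1, h2, h3, h4⟩ := hEmem t (Finset.mem_filter.1 ht).1
      exact ⟨h2, h1, h3, h4⟩
    · refine ⟨_, (Finset.mem_filter.1 ht).2, fun y hy h1 h2 => ?_⟩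
      rw [Finset.mem_inter, mem_nbrs, mem_nbrs]
      exact ⟨⟨hy, (mem_nbrs.1 h1).2.symm⟩, hy, (mem_nbrs.1 h2).2.symm⟩
    · refine Nat.lt_of_mul_lt_mul_left (a := 4) (lt_of_lt_of_le ?_ hlight)
      have h1 : X.card ≤ 2 * Y0.card := hle.trans hY0card
      calc 4 * (4 * (4 * m) * (2 * W * D) * X.card)
          ≤ 4 * (4 * (4 * m) * (2 * W * D) * (2 * Y0.card)) := by gcongr
        _ = Y0.card * m * (128 * (4 * d * D)) := by rw [hW]; ring
        _ < Y0.card * m * m := Nat.mul_lt_mul_of_pos_left (by omega)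
            (Nat.mul_pos hY0pos (by omega))
        _ = Y0.card * m ^ 2 := by ring
  · push Not at hlight
    set Eh := E.filter fun t => ¬ (nbrs G Y0 t.1 ∩ nbrs G Y0 t.2.1).card ≤ W with hEh
    have hEhcard : Y0.card * m ^ 2 < 4 * Eh.card := by
      have : (E.filter fun t => (nbrs G Y0 t.1 ∩ nbrs G Y0 t.2.1).card ≤ W).card + Eh.card =
        E.card := Finset.card_filter_add_card_filter_not _
      omega
    have hEhX : ∀ t ∈ Eh, t.1 ∈ X := fun t ht =>
      nbrs_subset (hEmem t (Finset.mem_filter.1 ht).1).2.2.1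
    obtain ⟨x0, hx0X, hx0⟩ : ∃ x ∈ X,
        m * (nbrs G Y0 x).card < 32 * (Eh.filter fun t => t.1 = x).card := by
      by_contra! hcon
      have h1 := Finset.sum_le_sum hcon
      rw [← Finset.mul_sum, ← Finset.mul_sum,
        ← Finset.card_eq_sum_card_fiberwise (f := fun t => t.1) (t := X)
        (fun t ht => hEhX t ht)] at h1
      have h2 : ∑ x ∈ X, (nbrs G Y0 x).card ≤ Y0.card * (4 * m) := by
        change crossEdges G Y0 X ≤ _
        rw [crossEdges_comm]
        exact Finset.sum_le_card_nsmul _ _ _ hdeg0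
      have h3 := Nat.mul_le_mul_left m h2
      have h4 : m * (Y0.card * (4 * m)) = 4 * (Y0.card * m ^ 2) := by ring
      omega
    set Y1 := nbrs G Y0 x0 with hY1
    set X1 := X.filter fun x => x ≠ x0 ∧ W < (nbrs G Y0 x0 ∩ nbrs G Y0 x).card with hX1
    have hnb : ∀ x, nbrs G Y1 x = nbrs G Y0 x0 ∩ nbrs G Y0 x := by
      intro x
      ext y
      simp only [hY1, mem_nbrs, Finset.mem_inter]
      tauto
    have hcount : (Eh.filter fun t => t.1 = x0).card ≤ crossEdges G X1 Y1 := by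
      rw [crossEdges_comm, crossEdges, Finset.card_eq_sum_card_fiberwise (f := fun t => t.2.1)
        (t := X1)]
      · refine Finset.sum_le_sum fun x hx => ?_
        refine Finset.card_le_card_of_injOn (fun t => t.2.2) (fun t ht => ?_)
          fun t ht t' ht' h => ?_
        · simp only [Finset.coe_filter, Finset.mem_filter, Set.mem_ofPred_eq] at ht
          obtain ⟨⟨ht1, rfl⟩, rfl⟩ := ht
          obtain ⟨h1, h2, h3, h4⟩ := hEmem t (Finset.mem_filter.1 ht1).1
          simp only [Finset.mem_coe, hnb, Finset.mem_inter, mem_nbrs]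
          exact ⟨⟨h1, (mem_nbrs.1 h3).2.symm⟩, h1, (mem_nbrs.1 h4).2.symm⟩
        · simp only [Finset.coe_filter, Finset.mem_filter, Set.mem_ofPred_eq] at ht ht'
          exact Prod.ext (ht.1.2.trans ht'.1.2.symm) (Prod.ext (ht.2.trans ht'.2.symm) h)
      · intro t ht
        simp only [Finset.coe_filter, Set.mem_ofPred_eq] at ht
        obtain ⟨ht1, rfl⟩ := ht
        obtain ⟨h1, h2⟩ := Finset.mem_filter.1 ht1
        obtain ⟨h3, h4, h5, h6⟩ := hEmem t h1
        exact Finset.mem_coe.2 (Finset.mem_filter.2 ⟨nbrs_subset h6, h4.symm, not_le.1 h2⟩)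
    have hW1 : X1.card * W ≤ crossEdges G X1 Y1 := by
      rw [crossEdges_comm, crossEdges, ← smul_eq_mul]
      refine Finset.card_nsmul_le_sum _ _ _ fun x hx => ?_
      rw [hnb]
      exact (Finset.mem_filter.1 hx).2.2.le
    refine ih X1 (Finset.filter_subset _ _) Y1 (nbrs_subset.trans hY0Y) ?_ ?_
    · intro A hA B hB hAa hBb
      have hx0A : x0 ∉ A := fun h => (Finset.mem_filter.1 (hA h)).2.1 rfl
      obtain ⟨x, hx, y, hy, hxy⟩ := hfree (insert x0 A)
        (Finset.insert_subset hx0X (hA.trans (Finset.filter_subset _ _))) B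
        (hB.trans (nbrs_subset.trans hY0Y)) (by rw [Finset.card_insert_of_notMem hx0A, hAa]) hBb
      rcases Finset.mem_insert.1 hx with rfl | hx
      · exact absurd (mem_nbrs.1 (hB hy)).2 hxy
      · exact ⟨x, hx, y, hy, hxy⟩
    · have h1 : 64 * d * Y1.card ≤ m * Y1.card := Nat.mul_le_mul_right _ (by omega)
      have h2 : X1.card * W = 2 * (d * X1.card) := by rw [hW]; ring
      have h3 : 64 * d * Y1.card = 64 * (d * Y1.card) := by ring
      rw [mul_add]
      omega

theorem exists_hasDenseSubdivision (D k : ℕ) : ∀ a b, a + b = k → ∃ d : ℕ, ∀ (n : ℕ)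
    (G : SimpleGraph (Fin n)) (X Y : Finset (Fin n)), (∀ u ∈ X, ∀ v ∈ X, ¬ G.Adj u v) →
    (∀ u ∈ Y, ∀ v ∈ Y, ¬ G.Adj u v) → Disjoint X Y → BicliqueFree G X Y a b →
    d * (X.card + Y.card) < crossEdges G X Y → HasDenseSubdivision G D := by
  induction k with
  | zero =>
    intro a b hab
    refine ⟨0, fun n G X Y _ _ _ hfree _ => ?_⟩
    obtain ⟨x, hx, -⟩ := hfree ∅ (by simp) ∅ (by simp) (by simp; omega) (by simp; omega)
    simp at hx
  | succ k ih =>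
    intro a b hab
    rcases a with _ | a
    · refine ⟨b, fun n G X Y _ _ _ hfree he => ?_⟩
      exfalso
      have hYb : Y.card < b := by
        by_contra hle
        obtain ⟨B, hB, hBb⟩ := Finset.exists_subset_card_eq (not_lt.1 hle)
        obtain ⟨x, hx, -⟩ := hfree ∅ (by simp) B hB (by simp) hBb
        simp at hx
      have h1 : crossEdges G X Y ≤ Y.card * X.card :=
        Finset.sum_le_card_nsmul _ _ _ fun y _ => Finset.card_le_card nbrs_subset
      have h2 : Y.card * X.card ≤ b * X.card := Nat.mul_le_mul_right _ hYb.le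
      rw [mul_add] at he
      omega
    rcases b with _ | b
    · refine ⟨a + 1, fun n G X Y _ _ _ hfree he => ?_⟩
      exfalso
      have hXa : X.card < a + 1 := by
        by_contra hle
        obtain ⟨A, hA, hAa⟩ := Finset.exists_subset_card_eq (not_lt.1 hle)
        obtain ⟨x, hx, y, hy, -⟩ := hfree A hA ∅ (by simp) hAa (by simp)
        simp at hy
      have h1 : crossEdges G X Y ≤ Y.card * X.card :=
        Finset.sum_le_card_nsmul _ _ _ fun y _ => Finset.card_le_card nbrs_subset
      have h2 : Y.card * X.card ≤ Y.card * (a + 1) := Nat.mul_le_mul_left _ hXa.le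
      rw [mul_add, mul_comm (a + 1) Y.card] at he
      omega
    obtain ⟨d₁, hd₁⟩ := ih a (b + 1) (by omega)
    obtain ⟨d₂, hd₂⟩ := ih b (a + 1) (by omega)
    set d := max d₁ d₂ with hd
    refine ⟨128 * (4 * d * D) + 64 * d + 1, fun n G X₀ Y₀ hX₀ hY₀ hXY₀ hfree₀ he₀ => ?_⟩
    set e := 128 * (4 * d * D) + 64 * d + 1 with hedef
    classical
    obtain ⟨⟨X, Y⟩, hmem, hmin⟩ := Finset.exists_min_image
      ((X₀.powerset ×ˢ Y₀.powerset).filter fun p =>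
        e * (p.1.card + p.2.card) < crossEdges G p.1 p.2) (fun p => p.1.card + p.2.card)
      ⟨(X₀, Y₀), by simpa using he₀⟩
    obtain ⟨hsub, hlt⟩ := Finset.mem_filter.1 hmem
    simp only [Finset.mem_product, Finset.mem_powerset] at hsub hlt
    obtain ⟨hXX₀, hYY₀⟩ := hsub
    have hmin' : ∀ X' ⊆ X, ∀ Y' ⊆ Y, X'.card + Y'.card < X.card + Y.card →
        crossEdges G X' Y' ≤ e * (X'.card + Y'.card) := by
      intro X' hX' Y' hY' hcard
      by_contra hcon
      have := hmin (X', Y') (Finset.mem_filter.2 ⟨Finset.mem_product.2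
        ⟨Finset.mem_powerset.2 (hX'.trans hXX₀), Finset.mem_powerset.2 (hY'.trans hYY₀)⟩,
        not_le.1 hcon⟩)
      simp only at this
      omega
    have hdelY : ∀ y ∈ Y, crossEdges G X Y = crossEdges G X (Y.erase y) + (nbrs G X y).card :=
      fun y hy => (Finset.sum_erase_add _ _ hy).symm
    have hdegY : ∀ y ∈ Y, e + 1 ≤ (nbrs G X y).card := by
      intro y hy
      have h1 := hmin' X subset_rfl (Y.erase y) (Finset.erase_subset _ _)
        (by have := Finset.card_erase_lt_of_mem hy; omega)
      rw [hdelY y hy] at hlt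
      have h2 : e * (X.card + Y.card) = e * (X.card + (Y.erase y).card) + e := by
        rw [← Finset.card_erase_add_one hy]; ring
      omega
    have hdelX : ∀ x ∈ X, crossEdges G X Y = crossEdges G (X.erase x) Y + (nbrs G Y x).card := by
      intro x hx
      rw [crossEdges_comm, crossEdges_comm (X.erase x)]
      exact (Finset.sum_erase_add _ _ hx).symm
    have hdegX : ∀ x ∈ X, e + 1 ≤ (nbrs G Y x).card := by
      intro x hx
      have h1 := hmin' (X.erase x) (Finset.erase_subset _ _) Y subset_rfl
        (by have := Finset.card_erase_lt_of_mem hx; omega)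
      rw [hdelX x hx] at hlt
      have h2 : e * (X.card + Y.card) = e * ((X.erase x).card + Y.card) + e := by
        rw [← Finset.card_erase_add_one hx]; ring
      omega
    obtain ⟨y, hy⟩ : Y.Nonempty := by
      rw [Finset.nonempty_iff_ne_empty]
      rintro rfl
      simp [crossEdges] at hlt
    obtain ⟨x, hx⟩ : X.Nonempty := by
      have := hdegY y hy
      obtain ⟨x, hx⟩ := Finset.card_pos.1 (by omega : 0 < (nbrs G X y).card)
      exact ⟨x, nbrs_subset hx⟩
    have he : crossEdges G X Y ≤ (e + 1) * (X.card + Y.card) := by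
      have h1 := hmin' X subset_rfl (Y.erase y) (Finset.erase_subset _ _)
        (by have := Finset.card_erase_lt_of_mem hy; omega)
      rw [hdelY y hy]
      have h2 : (nbrs G X y).card ≤ X.card := Finset.card_le_card nbrs_subset
      have h3 : e * (X.card + (Y.erase y).card) ≤ e * (X.card + Y.card) :=
        Nat.mul_le_mul_left _ (by have := Finset.card_erase_le (s := Y) (a := y); omega)
      rw [add_mul]
      omega
    have hX : ∀ u ∈ X, ∀ v ∈ X, ¬ G.Adj u v := fun u hu v hv => hX₀ u (hXX₀ hu) v (hXX₀ hv)
    have hY : ∀ u ∈ Y, ∀ v ∈ Y, ¬ G.Adj u v := fun u hu v hv => hY₀ u (hYY₀ hu) v (hYY₀ hv)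
    have hXY : Disjoint X Y := hXY₀.mono hXX₀ hYY₀
    have hfree : BicliqueFree G X Y (a + 1) (b + 1) := hfree₀.mono hXX₀ hYY₀
    rcases le_total X.card Y.card with hle | hle
    · refine hasDenseSubdivision_step (d := d) (m := e + 1) hX hY hXY hle ⟨y, hy⟩ (by omega) hdegY
        he hfree fun X' hX' Y' hY' hf hlt' => hd₁ n G X' Y'
          (fun u hu v hv => hX u (hX' hu) v (hX' hv)) (fun u hu v hv => hY u (hY' hu) v (hY' hv))
          (hXY.mono hX' hY') hf (lt_of_le_of_lt (Nat.mul_le_mul_right _ (le_max_left _ _)) hlt')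
    · refine hasDenseSubdivision_step (d := d) (m := e + 1) hY hX hXY.symm hle ⟨x, hx⟩ (by omega)
        hdegX (by rw [crossEdges_comm, add_comm Y.card]; exact he) hfree.symm
        fun X' hX' Y' hY' hf hlt' => hd₂ n G X' Y'
          (fun u hu v hv => hY u (hX' hu) v (hX' hv)) (fun u hu v hv => hX u (hY' hu) v (hY' hv))
          (hXY.symm.mono hX' hY') hf
          (lt_of_le_of_lt (Nat.mul_le_mul_right _ (le_max_right _ _)) hlt')

end Biclique

/-! ## Bounded expansion from induced subdivisions -/

section InducedSubdivisions

variable {V : Type*} {G : SimpleGraph V}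

theorem HasDenseSubdivision.exists_memITM {D : ℕ} (h : HasDenseSubdivision G D) :
    ∃ (n : ℕ) (H : SimpleGraph (Fin n)), MemITM 1 G H ∧ D * n < H.edgeSet.ncard := by
  classical
  obtain ⟨B, T, hB, hT, hTB, hnb, hinj, hcard⟩ := h
  choose u hu v hv huv hadj using fun y : T => hnb y.1 y.2
  have hmem : ∀ y : T, (y : V) ∉ B := fun y => Finset.disjoint_left.1 hTB y.2
  have hu' : ∀ y : T, G.Adj y (u y) := fun y => (hadj y _ (hu y)).2 (Or.inl rfl)
  have hv' : ∀ y : T, G.Adj y (v y) := fun y => (hadj y _ (hv y)).2 (Or.inr rfl)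
  have hsys : IsInducedPathSys G B
      (fun (y : T) s => if s = 0 then u y else if s = 1 then (y : V) else v y) (fun _ => 1) := by
    refine ⟨⟨fun y => by simpa using hu y, fun y => by simpa using hv y,
      fun y => by simpa using huv y, fun y s hs => ?_, fun y s s' h1 h2 h3 h4 _ => by omega,
      fun y s h1 h2 => ?_, fun y z s s' hyz h1 h2 h3 h4 => ?_, fun y z h => ?_⟩, hB,
      fun y s h1 h2 w hw hyw => ?_, fun y z s s' h1 h2 h3 h4 hyz => ?_⟩
    · interval_cases s
      · simpa using (hu' y).symm
      · simpa using hv' y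
    · obtain rfl : s = 1 := by omega
      simpa using hmem y
    · obtain rfl : s = 1 := by omega
      obtain rfl : s' = 1 := by omega
      simpa using hyz
    · refine Subtype.ext (hinj _ y.2 _ z.2 (Finset.ext fun x => ?_))
      simp only [if_true, Nat.reduceAdd, OfNat.ofNat_ne_zero, if_false,
        OfNat.ofNat_ne_one] at h
      rw [mem_nbrs, mem_nbrs]
      refine and_congr_right fun hx => ?_
      rw [hadj y x hx, hadj z x hx, ← Sym2.mem_iff, ← Sym2.mem_iff, h]
    · obtain rfl : s = 1 := by omega
      simpa using (hadj y w hw).1 (by simpa using hyw)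
    · obtain rfl : s = 1 := by omega
      obtain rfl : s' = 1 := by omega
      exact absurd (by simpa using hyz) (hT _ y.2 _ z.2)
  obtain ⟨H, hH, hHcard⟩ := hsys.exists_memITM fun _ => rfl
  exact ⟨_, H, hH, by rw [hHcard, Fintype.card_coe]; exact hcard⟩

open Classical in
/-- The ordered pairs of adjacent elements of `S`. -/
noncomputable def adjPairs {V : Type*} (G : SimpleGraph V) (S : Finset V) : Finset (V × V) :=
  (S ×ˢ S).filter fun p => G.Adj p.1 p.2

theorem mem_adjPairs {S : Finset V} {p : V × V} :
    p ∈ adjPairs G S ↔ (p.1 ∈ S ∧ p.2 ∈ S) ∧ G.Adj p.1 p.2 := by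
  simp [adjPairs]

theorem card_adjPairs_le {c d : ℕ} (κ : V → Fin c) (hκ : ∀ u v, G.Adj u v → κ u ≠ κ v)
    (S : Finset V)
    (h : ∀ X ⊆ S, ∀ Y ⊆ S, (∀ u ∈ X, ∀ v ∈ X, ¬ G.Adj u v) → (∀ u ∈ Y, ∀ v ∈ Y, ¬ G.Adj u v) →
      Disjoint X Y → crossEdges G X Y ≤ d * (X.card + Y.card)) :
    (adjPairs G S).card ≤ c * c * (2 * d) * S.card := by
  classical
  rw [Finset.card_eq_sum_card_fiberwise (f := fun p => (κ p.1, κ p.2)) (t := Finset.univ)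
    (by simp)]
  have h1 : ∀ i ∈ (Finset.univ : Finset (Fin c × Fin c)),
      ((adjPairs G S).filter fun p => (κ p.1, κ p.2) = i).card ≤ 2 * d * S.card := by
    rintro ⟨i, j⟩ -
    by_cases hij : i = j
    · subst hij
      rw [Finset.card_eq_zero.2]
      · exact Nat.zero_le _
      · refine Finset.filter_eq_empty_iff.2 fun p hp he => ?_
        rw [Prod.mk.injEq] at he
        exact hκ _ _ (mem_adjPairs.1 hp).2 (he.1.trans he.2.symm)
    set X := S.filter fun x => κ x = i with hX
    set Y := S.filter fun x => κ x = j with hY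
    have hind : ∀ i, ∀ u ∈ S.filter (fun x => κ x = i), ∀ v ∈ S.filter (fun x => κ x = i),
        ¬ G.Adj u v := fun i u hu v hv huv =>
      hκ u v huv ((Finset.mem_filter.1 hu).2.trans (Finset.mem_filter.1 hv).2.symm)
    have h2 := h X (Finset.filter_subset _ _) Y (Finset.filter_subset _ _) (hind i) (hind j)
      (Finset.disjoint_left.2 fun x hx hy => hij
        ((Finset.mem_filter.1 hx).2.symm.trans (Finset.mem_filter.1 hy).2))
    have h3 : ((adjPairs G S).filter fun p => (κ p.1, κ p.2) = (i, j)).card ≤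
        crossEdges G X Y := by
      rw [crossEdges, ← Finset.card_sigma]
      refine Finset.card_le_card_of_injOn (fun p => ⟨p.2, p.1⟩) (fun p hp => ?_) ?_
      · obtain ⟨hp1, hp2⟩ := Finset.mem_filter.1 (Finset.mem_coe.1 hp)
        obtain ⟨⟨hp3, hp4⟩, hp5⟩ := mem_adjPairs.1 hp1
        rw [Prod.mk.injEq] at hp2
        exact Finset.mem_coe.2 (Finset.mem_sigma.2 ⟨Finset.mem_filter.2 ⟨hp4, hp2.2⟩,
          mem_nbrs.2 ⟨Finset.mem_filter.2 ⟨hp3, hp2.1⟩, hp5.symm⟩⟩)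
      · rintro ⟨a, b⟩ - ⟨a', b'⟩ - h
        simpa [and_comm] using h
    calc _ ≤ d * (X.card + Y.card) := h3.trans h2
      _ ≤ d * (S.card + S.card) := by
        gcongr <;> exact Finset.filter_subset _ _
      _ = _ := by ring
  calc _ ≤ (Finset.univ : Finset (Fin c × Fin c)).card • (2 * d * S.card) :=
        Finset.sum_le_card_nsmul _ _ _ h1
    _ = _ := by simp [mul_assoc]

section LinkSys

variable {r d : ℕ} {B : Finset V} {F : Finset (V × V × Finset V)}

theorem IsLinkSys.exists_nonadj (h : IsLinkSys G r B F)
    (hd : ∀ S : Finset V, (adjPairs G S).card ≤ d * S.card) :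
    ∃ F' ⊆ F, F.card ≤ d * B.card + F'.card ∧ ∀ t ∈ F', ¬ G.Adj t.1 t.2.1 := by
  classical
  refine ⟨F.filter fun t => ¬ G.Adj t.1 t.2.1, Finset.filter_subset _ _, ?_,
    fun t ht => (Finset.mem_filter.1 ht).2⟩
  rw [← Finset.card_filter_add_card_filter_not (s := F) fun t => G.Adj t.1 t.2.1]
  refine Nat.add_le_add_right (le_trans ?_ (hd B)) _
  refine Finset.card_le_card_of_injOn (fun t => (t.1, t.2.1)) (fun t ht => ?_) ?_
  · obtain ⟨h1, h2⟩ := Finset.mem_filter.1 (Finset.mem_coe.1 ht)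
    exact Finset.mem_coe.2 (mem_adjPairs.2 ⟨⟨h.fst_mem t h1, h.snd_mem t h1⟩, h2⟩)
  · intro t ht t' ht' he
    rw [Prod.mk.injEq] at he
    exact h.simple t (Finset.mem_filter.1 (Finset.mem_coe.1 ht)).1 t'
      (Finset.mem_filter.1 (Finset.mem_coe.1 ht')).1 (by rw [he.1, he.2])

theorem IsLinkSys.eq_of_mem (h : IsLinkSys G r B F) {t t' : V × V × Finset V} (ht : t ∈ F)
    (ht' : t' ∈ F) {x : V} (hx : x ∈ t.2.2) (hx' : x ∈ t'.2.2) : t = t' := by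
  by_contra hne
  exact Finset.disjoint_left.1 (h.disjoint t ht t' ht' hne) hx hx'

theorem IsLinkSys.exists_independent (h : IsLinkSys G r B F)
    (hd : ∀ S : Finset V, (adjPairs G S).card ≤ d * S.card) :
    ∃ I ⊆ F, F.card ≤ (d * r + 1) * I.card ∧ ∀ t ∈ I, ∀ t' ∈ I, t ≠ t' →
      ∀ x ∈ t.2.2, ∀ y ∈ t'.2.2, ¬ G.Adj x y := by
  classical
  obtain ⟨conf, hconf⟩ : ∃ conf : V × V × Finset V → V × V × Finset V → Prop,
    ∀ t t', conf t t' ↔ ∃ x ∈ t.2.2, ∃ y ∈ t'.2.2, G.Adj x y := ⟨_, fun _ _ => Iff.rfl⟩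
  obtain ⟨I, hI, hcard, hind⟩ := exists_independent_of_degenerate conf (fun t t' htt => by
      obtain ⟨x, hx, y, hy, hxy⟩ := (hconf _ _).1 htt
      exact (hconf _ _).2 ⟨y, hy, x, hx, hxy.symm⟩) (d * r) F fun T hT hTne => by
    refine exists_le_of_card_pairs_le conf hTne ?_
    have hcard : (T.biUnion fun t => t.2.2).card ≤ T.card * r :=
      Finset.card_biUnion_le_card_mul _ _ _ fun t ht => h.card_le t (hT ht)
    have hpick : ∀ p : (V × V × Finset V) × (V × V × Finset V), ∃ e : V × V,
        conf p.1 p.2 → e.1 ∈ p.1.2.2 ∧ e.2 ∈ p.2.2.2 ∧ G.Adj e.1 e.2 := by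
      intro p
      by_cases hp : conf p.1 p.2
      · obtain ⟨x, hx, y, hy, hxy⟩ := (hconf _ _).1 hp
        exact ⟨(x, y), fun _ => ⟨hx, hy, hxy⟩⟩
      · exact ⟨(p.1.1, p.1.1), fun h => absurd h hp⟩
    choose e he using hpick
    calc _ ≤ (adjPairs G (T.biUnion fun t => t.2.2)).card := by
          refine Finset.card_le_card_of_injOn e (fun p hp => ?_) fun p hp p' hp' hpp => ?_
          · obtain ⟨hp1, hp2⟩ := Finset.mem_filter.1 (Finset.mem_coe.1 hp)
            rw [Finset.mem_product] at hp1
            obtain ⟨h1, h2, h3⟩ := he p hp2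
            exact Finset.mem_coe.2 (mem_adjPairs.2 ⟨⟨Finset.mem_biUnion.2 ⟨_, hp1.1, h1⟩,
              Finset.mem_biUnion.2 ⟨_, hp1.2, h2⟩⟩, h3⟩)
          · obtain ⟨hp1, hp2⟩ := Finset.mem_filter.1 (Finset.mem_coe.1 hp)
            obtain ⟨hp1', hp2'⟩ := Finset.mem_filter.1 (Finset.mem_coe.1 hp')
            rw [Finset.mem_product] at hp1 hp1'
            obtain ⟨h1, h2, -⟩ := he p hp2
            obtain ⟨h1', h2', -⟩ := he p' hp2'
            rw [← hpp] at h1' h2'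
            exact Prod.ext (h.eq_of_mem (hT hp1.1) (hT hp1'.1) h1 h1')
              (h.eq_of_mem (hT hp1.2) (hT hp1'.2) h2 h2')
      _ ≤ d * (T.card * r) := (hd _).trans (Nat.mul_le_mul_left _ hcard)
      _ = _ := by ring
  exact ⟨I, hI, hcard, fun t ht t' ht' hne x hx y hy hxy =>
    hind t ht t' ht' hne ((hconf _ _).2 ⟨x, hx, y, hy, hxy⟩)⟩

/-- The branch vertices other than the ends of a link that see the interior of the link. -/
def IsSpoiler {V : Type*} (G : SimpleGraph V) (t : V × V × Finset V) (z : V) : Prop :=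
  z ≠ t.1 ∧ z ≠ t.2.1 ∧ ∃ x ∈ t.2.2, G.Adj x z

open Classical in
theorem IsLinkSys.exists_few_spoilers (h : IsLinkSys G r B F)
    (hd : ∀ S : Finset V, (adjPairs G S).card ≤ d * S.card) (hBF : B.card ≤ F.card) :
    ∃ F' ⊆ F, F.card ≤ 2 * F'.card ∧
      ∀ t ∈ F', (B.filter (IsSpoiler G t)).card ≤ 2 * (d * (r + 1)) := by
  set w := d * (r + 1) with hw
  refine ⟨F.filter fun t => (B.filter (IsSpoiler G t)).card ≤ 2 * w, Finset.filter_subset _ _, ?_,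
    fun t ht => (Finset.mem_filter.1 ht).2⟩
  have hsum : ∑ t ∈ F, (B.filter (IsSpoiler G t)).card ≤ w * F.card := by
    have hcard : (F.biUnion fun t => t.2.2).card ≤ F.card * r :=
      Finset.card_biUnion_le_card_mul _ _ _ fun t ht => h.card_le t ht
    have hpick : ∀ p : (_ : V × V × Finset V) × V, ∃ x : V,
        IsSpoiler G p.1 p.2 → x ∈ p.1.2.2 ∧ G.Adj x p.2 := by
      intro p
      by_cases hp : IsSpoiler G p.1 p.2
      · obtain ⟨-, -, x, hx, hxz⟩ := hp
        exact ⟨x, fun _ => ⟨hx, hxz⟩⟩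
      · exact ⟨p.2, fun h => absurd h hp⟩
    choose e he using hpick
    rw [← Finset.card_sigma]
    calc _ ≤ (adjPairs G ((F.biUnion fun t => t.2.2) ∪ B)).card := by
          refine Finset.card_le_card_of_injOn (fun p => (e p, p.2)) (fun p hp => ?_)
            fun p hp p' hp' hpp => ?_
          · obtain ⟨h1, h2⟩ := Finset.mem_sigma.1 (Finset.mem_coe.1 hp)
            obtain ⟨h2, h3⟩ := Finset.mem_filter.1 h2
            obtain ⟨h4, h5⟩ := he p h3
            exact Finset.mem_coe.2 (mem_adjPairs.2 ⟨⟨Finset.mem_union_left _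
              (Finset.mem_biUnion.2 ⟨_, h1, h4⟩), Finset.mem_union_right _ h2⟩, h5⟩)
          · obtain ⟨h1, h2⟩ := Finset.mem_sigma.1 (Finset.mem_coe.1 hp)
            obtain ⟨h1', h2'⟩ := Finset.mem_sigma.1 (Finset.mem_coe.1 hp')
            rw [Prod.mk.injEq] at hpp
            have h3 := (he p (Finset.mem_filter.1 h2).2).1
            have h3' := (he p' (Finset.mem_filter.1 h2').2).1
            rw [← hpp.1] at h3'
            exact Sigma.ext (h.eq_of_mem h1 h1' h3 h3') (heq_of_eq hpp.2)
      _ ≤ d * (F.card * r + F.card) :=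
          (hd _).trans (Nat.mul_le_mul_left _ ((Finset.card_union_le _ _).trans (by omega)))
      _ = _ := by rw [hw]; ring
  have hbad : (F.filter fun t => ¬ (B.filter (IsSpoiler G t)).card ≤ 2 * w).card * (2 * w + 1) ≤
      w * F.card := by
    refine le_trans ?_ hsum
    rw [← smul_eq_mul]
    refine (Finset.card_nsmul_le_sum _ _ _ fun t ht => ?_).trans
      (Finset.sum_le_sum_of_subset (Finset.filter_subset _ _))
    have := (Finset.mem_filter.1 ht).2
    omega
  have hsplit : (F.filter fun t => (B.filter (IsSpoiler G t)).card ≤ 2 * w).card +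
      (F.filter fun t => ¬ (B.filter (IsSpoiler G t)).card ≤ 2 * w).card = F.card :=
    Finset.card_filter_add_card_filter_not _
  by_contra! hlt
  nlinarith

theorem IsLinkSys.exists_memITM_of_clean (h : IsLinkSys G r B F) {D : ℕ}
    (hcard : r * D * B.card < F.card) (hB : ∀ u ∈ B, ∀ v ∈ B, ¬ G.Adj u v)
    (hF : ∀ t ∈ F, ∀ t' ∈ F, t ≠ t' → ∀ x ∈ t.2.2, ∀ y ∈ t'.2.2, ¬ G.Adj x y)
    (hs : ∀ t ∈ F, ∀ z ∈ B, ¬ IsSpoiler G t z) :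
    ∃ k, 1 ≤ k ∧ k ≤ r ∧ ∃ (n : ℕ) (H : SimpleGraph (Fin n)),
      MemITM k G H ∧ D * n < H.edgeSet.ncard := by
  classical
  obtain ⟨q, t, hq, htr, hends, hinn, hind⟩ := h.exists_pathSys
  have ht1 : ∀ i, 1 ≤ t i := by
    intro i
    by_contra hlt
    have h0 : t i = 0 := by omega
    have := hq.adj i 0 (by omega)
    refine hB _ (hq.fst_mem i) _ (hq.lst_mem i) ?_
    rwa [h0]
  obtain ⟨k, hk, hlt⟩ : ∃ k ∈ Finset.Icc 1 r,
      D * B.card < (Finset.univ.filter fun i => t i = k).card := by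
    by_contra! hcon
    have h1 := Finset.sum_le_card_nsmul _ _ _ hcon
    rw [← Finset.card_eq_sum_card_fiberwise (f := t)
      (fun i _ => Finset.mem_coe.2 (Finset.mem_Icc.2 ⟨ht1 i, htr i⟩))] at h1
    simp only [Finset.card_univ, Fintype.card_coe, Nat.card_Icc, Nat.add_sub_cancel,
      smul_eq_mul] at h1
    rw [mul_assoc] at hcard
    omega
  obtain ⟨hk1, hkr⟩ := Finset.mem_Icc.1 hk
  have hsys : IsInducedPathSys G B (fun i : {i // t i = k} => q i.1) (fun i => t i.1) := by
    refine ⟨⟨fun i => hq.fst_mem _, fun i => hq.lst_mem _, fun i => hq.ends_ne _,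
      fun i => hq.adj _, fun i => hq.inj _, fun i => hq.notMem _,
      fun i j s s' hij => hq.disj _ _ s s' fun h => hij (Subtype.ext h),
      fun i j h => Subtype.ext (hq.simple _ _ h)⟩, hB, fun i s h1 h2 v hv hadj => ?_,
      fun i j s s' h1 h2 h3 h4 hadj => ?_⟩
    · have hsp := hs _ i.1.2 v hv
      have hP := hinn i.1 s h1 h2
      obtain ⟨he0, he1⟩ := hends i.1
      by_cases hv0 : v = i.1.1.1
      · left
        refine ⟨hv0.trans he0.symm, ?_⟩
        by_contra hne
        refine ((hind i.1).2 0 s h1 (by omega)).2 (by omega) ?_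
        rw [he0, ← hv0]
        exact hadj.symm
      by_cases hv1 : v = i.1.1.2.1
      · right
        refine ⟨hv1.trans he1.symm, ?_⟩
        by_contra hne
        refine ((hind i.1).2 s (t i.1 + 1) (by omega) le_rfl).2 (by omega) ?_
        rw [he1, ← hv1]
        exact hadj
      exact absurd ⟨hv0, hv1, _, hP, hadj⟩ hsp
    · by_cases hij : i = j
      · subst hij
        refine ⟨rfl, ?_⟩
        rcases lt_trichotomy s s' with hlt' | rfl | hlt'
        · by_contra hne
          exact ((hind i.1).2 s s' hlt' (by omega)).2 (by omega) hadj
        · exact absurd hadj (G.loopless.irrefl _)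
        · by_contra hne
          exact ((hind i.1).2 s' s hlt' (by omega)).2 (by omega) hadj.symm
      · exact absurd hadj (hF _ i.1.2 _ j.1.2
          (fun h => hij (Subtype.ext (Subtype.ext h))) _ (hinn i.1 s h1 h2) _ (hinn j.1 s' h3 h4))
  obtain ⟨H, hH, hHcard⟩ := hsys.exists_memITM (r := k) fun i => i.2
  refine ⟨k, hk1, hkr, _, H, hH, ?_⟩
  rw [hHcard, Fintype.card_subtype]
  exact hlt

theorem IsLinkSys.exists_memITM [Fintype V] (h : IsLinkSys G r B F)
    (hd : ∀ S : Finset V, (adjPairs G S).card ≤ d * S.card) {D q : ℕ}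
    (hq : q = 2 * (2 * (d * (r + 1)) + 2 * d) + 2)
    (hcard : (d + (d * r + 1) * (4 * q * (r * D) + 1)) * B.card < F.card) :
    ∃ k, 1 ≤ k ∧ k ≤ r ∧ ∃ (n : ℕ) (H : SimpleGraph (Fin n)),
      MemITM k G H ∧ D * n < H.edgeSet.ncard := by
  classical
  obtain ⟨F₁, hF₁, hcard₁, hnadj⟩ := h.exists_nonadj hd
  obtain ⟨F₂, hF₂, hcard₂, hind⟩ := (h.subset hF₁).exists_independent hd
  have h₂ : (4 * q * (r * D) + 1) * B.card < F₂.card := by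
    refine Nat.lt_of_mul_lt_mul_left (a := d * r + 1) (lt_of_lt_of_le ?_ hcard₂)
    rw [add_mul, mul_assoc] at hcard
    omega
  obtain ⟨F₃, hF₃, hcard₃, hspoil⟩ :=
    ((h.subset hF₁).subset hF₂).exists_few_spoilers hd
      ((Nat.le_mul_of_pos_left _ (Nat.succ_pos _)).trans h₂.le)
  have hF₃F : F₃ ⊆ F := hF₃.trans (hF₂.trans hF₁)
  obtain ⟨O, hO, hOadj⟩ := exists_outNeighbor_of_degenerate G.Adj (fun _ _ => G.symm.symm _ _) d B
    fun T _ hT => exists_le_of_card_pairs_le G.Adj hT (hd T)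
  obtain ⟨X, hXB, hX⟩ := exists_restriction B F₃ (fun t => t.1) (fun t => t.2.1)
    (fun t => B.filter (IsSpoiler G t) ∪ ((O t.1 ∪ O t.2.1) \ {t.1, t.2.1})) q (r * D) (by omega)
    (fun t ht => h.fst_mem t (hF₃F ht)) (fun t ht => h.snd_mem t (hF₃F ht))
    (fun t ht => h.ne t (hF₃F ht)) (fun t _ => by simp [IsSpoiler]) (fun t _ => by simp [IsSpoiler])
    (fun t ht => by
      have h1 := hspoil t ht
      have h2 : ((O t.1 ∪ O t.2.1) \ {t.1, t.2.1}).card ≤ d + d :=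
        (Finset.card_le_card Finset.sdiff_subset).trans
          ((Finset.card_union_le _ _).trans (Nat.add_le_add (hO _) (hO _)))
      have h3 := Finset.card_union_le (B.filter (IsSpoiler G t))
        ((O t.1 ∪ O t.2.1) \ {t.1, t.2.1})
      omega)
    (by
      have : (4 * q * (r * D) + 1) * B.card = 2 * (2 * q * (r * D) * B.card) + B.card := by ring
      omega)
  set F₄ := F₃.filter fun t => t.1 ∈ X ∧ t.2.1 ∈ X ∧
    Disjoint (B.filter (IsSpoiler G t) ∪ ((O t.1 ∪ O t.2.1) \ {t.1, t.2.1})) X with hF₄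
  have hF₄F : F₄ ⊆ F := (Finset.filter_subset _ _).trans hF₃F
  set X' := F₄.image (fun t => t.1) ∪ F₄.image (fun t => t.2.1) with hX'
  have hX'X : X' ⊆ X := by
    refine Finset.union_subset ?_ ?_ <;> refine Finset.image_subset_iff.2 fun t ht => ?_
    · exact (Finset.mem_filter.1 ht).2.1
    · exact (Finset.mem_filter.1 ht).2.2.1
  have hsys : IsLinkSys G r X' F₄ := by
    have h4 := h.subset hF₄F
    exact ⟨fun t ht => Finset.mem_union_left _ (Finset.mem_image_of_mem _ ht),
      fun t ht => Finset.mem_union_right _ (Finset.mem_image_of_mem (fun t => t.2.1) ht), h4.ne,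
      h4.card_le, fun t ht => (h4.disjoint_branch t ht).mono_right (hX'X.trans hXB), h4.link,
      h4.disjoint, h4.simple⟩
  have hO' : ∀ u ∈ X', ∀ v ∈ X', u ∈ O v → ¬ G.Adj u v := by
    intro u hu v hv huv hadj
    obtain ⟨t, ht, hvt⟩ : ∃ t ∈ F₄, v = t.1 ∨ v = t.2.1 := by
      rcases Finset.mem_union.1 hv with hv | hv <;> obtain ⟨t, ht, rfl⟩ := Finset.mem_image.1 hv
      · exact ⟨t, ht, Or.inl rfl⟩
      · exact ⟨t, ht, Or.inr rfl⟩
    have hdis := (Finset.mem_filter.1 ht).2.2.2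
    have hut : u = t.1 ∨ u = t.2.1 := by
      by_contra hne
      refine Finset.disjoint_right.1 hdis (hX'X hu) (Finset.mem_union_right _
        (Finset.mem_sdiff.2 ⟨Finset.mem_union.2 ?_, by simpa using hne⟩))
      rcases hvt with rfl | rfl
      · exact Or.inl huv
      · exact Or.inr huv
    have hn := hnadj t (hF₂ (hF₃ (Finset.mem_filter.1 ht).1))
    rcases hut with rfl | rfl <;> rcases hvt with rfl | rfl
    · exact G.loopless.irrefl _ hadj
    · exact hn hadj
    · exact hn hadj.symm
    · exact G.loopless.irrefl _ hadj
  refine hsys.exists_memITM_of_clean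
    (lt_of_le_of_lt (Nat.mul_le_mul_left _ (Finset.card_le_card hX'X)) hX)
    (fun u hu v hv huv => ?_) (fun t ht t' ht' => ?_) fun t ht z hz hsp => ?_
  · rcases hOadj u (hXB (hX'X hu)) v (hXB (hX'X hv)) huv.ne huv with h1 | h1
    · exact hO' u hu v hv h1 huv
    · exact hO' v hv u hu h1 huv.symm
  · exact hind t (hF₃ (Finset.mem_filter.1 ht).1) t' (hF₃ (Finset.mem_filter.1 ht').1)
  · exact Finset.disjoint_right.1 (Finset.mem_filter.1 ht).2.2.2 (hX'X hz)
      (Finset.mem_union_left _ (Finset.mem_filter.2 ⟨hXB (hX'X hz), hsp⟩))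

end LinkSys

end InducedSubdivisions

/-! ## Classes of graphs -/

section Classes

theorem le_omegaNum {n m : ℕ} {G : SimpleGraph (Fin n)}
    (h : IsSubgraphOf (⊤ : SimpleGraph (Fin m)) G) : m ≤ omegaNum G := by
  refine le_csSup ⟨n, fun k ⟨f, hf⟩ => ?_⟩ h
  simpa using Fintype.card_le_of_injective f hf

theorem colorable_chi {n : ℕ} (G : SimpleGraph (Fin n)) : G.Colorable (chi G) :=
  Nat.sInf_mem (s := {N | G.Colorable N})
    ⟨n, (by simpa using G.colorable_of_fintype : G.Colorable n)⟩

theorem Hereditary.exists_mem_iso {C : GraphClass} (hC : Hereditary C) {n : ℕ}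
    {G : SimpleGraph (Fin n)} (hG : G ∈ C n) {W : Type*} [Fintype W] {K : SimpleGraph W}
    (hK : Nonempty (K ↪g G)) :
    ∃ (m : ℕ) (H : SimpleGraph (Fin m)), H ∈ C m ∧ Nonempty (H ≃g K) := by
  obtain ⟨f⟩ := hK
  let e := SimpleGraph.Iso.comap (Fintype.equivFin W).symm K
  exact ⟨_, _, hC G _ hG ⟨f.comp e.toEmbedding⟩, ⟨e⟩⟩

theorem ncard_edgeSet_le_of_avgDeg_le {n : ℕ} {H : SimpleGraph (Fin n)} {d : ℝ}
    (h : avgDeg H ≤ d) : H.edgeSet.ncard ≤ ⌈d⌉₊ * n := by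
  rcases Nat.eq_zero_or_pos n with rfl | hn
  · have : H.edgeSet = ∅ := Set.eq_empty_of_forall_notMem fun e => by
      induction e with | _ u v => exact u.elim0
    simp [this]
  · have hn' : (0 : ℝ) < n := by exact_mod_cast hn
    rw [avgDeg, div_le_iff₀ hn'] at h
    have h1 : d * n ≤ ⌈d⌉₊ * n := by
      gcongr
      exact Nat.le_ceil d
    have h2 : (0 : ℝ) ≤ H.edgeSet.ncard := Nat.cast_nonneg _
    exact_mod_cast (by linarith : (H.edgeSet.ncard : ℝ) ≤ ⌈d⌉₊ * n)

theorem avgDeg_le_of_ncard_edgeSet_le {n k : ℕ} {H : SimpleGraph (Fin n)}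
    (h : H.edgeSet.ncard ≤ k * n) : avgDeg H ≤ 2 * k := by
  rw [avgDeg]
  refine div_le_of_le_mul₀ (Nat.cast_nonneg _) (by positivity) ?_
  have : (H.edgeSet.ncard : ℝ) ≤ k * n := by exact_mod_cast h
  linarith

theorem bicliqueFree_of_not_embeds {n s : ℕ} {G : SimpleGraph (Fin n)}
    (h : ¬ Nonempty (completeBipartiteGraph (Fin s) (Fin s) ↪g G)) {X Y : Finset (Fin n)}
    (hX : ∀ u ∈ X, ∀ v ∈ X, ¬ G.Adj u v) (hY : ∀ u ∈ Y, ∀ v ∈ Y, ¬ G.Adj u v)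
    (hXY : Disjoint X Y) : BicliqueFree G X Y s s := by
  intro A hA B hB hAs hBs
  by_contra! hcon
  refine h ⟨⟨⟨Sum.elim (fun i => ((A.equivFinOfCardEq hAs).symm i : Fin n))
    (fun i => ((B.equivFinOfCardEq hBs).symm i : Fin n)), ?_⟩, ?_⟩⟩
  · refine Function.Injective.sumElim
      (Subtype.val_injective.comp (A.equivFinOfCardEq hAs).symm.injective)
      (Subtype.val_injective.comp (B.equivFinOfCardEq hBs).symm.injective) fun i j he => ?_
    refine Finset.disjoint_left.1 hXY (hA ((A.equivFinOfCardEq hAs).symm i).2) ?_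
    rw [he]
    exact hB ((B.equivFinOfCardEq hBs).symm j).2
  · rintro (i | i) (j | j)
    · simpa using hX _ (hA ((A.equivFinOfCardEq hAs).symm i).2) _
        (hA ((A.equivFinOfCardEq hAs).symm j).2)
    · simpa using hcon _ ((A.equivFinOfCardEq hAs).symm i).2 _
        ((B.equivFinOfCardEq hBs).symm j).2
    · simpa using (hcon _ ((A.equivFinOfCardEq hAs).symm j).2 _
        ((B.equivFinOfCardEq hBs).symm i).2).symm
    · simpa using hY _ (hB ((B.equivFinOfCardEq hBs).symm i).2) _
        (hB ((B.equivFinOfCardEq hBs).symm j).2)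

theorem exists_card_adjPairs_le {C : GraphClass} (hC : Hereditary C) (hχ : ChiBounded C)
    (hs : ∃ s : ℕ, ¬ ∃ (n : ℕ) (G : SimpleGraph (Fin n)), G ∈ C n ∧
      Nonempty (G ≃g completeBipartiteGraph (Fin s) (Fin s)))
    (hI : ∃ d : ℝ, ∀ ⦃m : ℕ⦄ (H : SimpleGraph (Fin m)), MemITMClass 1 C H → avgDeg H ≤ d) (t : ℕ) :
    ∃ d : ℕ, ∀ (n : ℕ) (G : SimpleGraph (Fin n)), G ∈ C n → omegaNum G ≤ t →
      ∀ S : Finset (Fin n), (adjPairs G S).card ≤ d * S.card := by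
  obtain ⟨f, hf⟩ := hχ
  obtain ⟨s, hs⟩ := hs
  obtain ⟨D, hD⟩ := hI
  obtain ⟨d, hd⟩ := exists_hasDenseSubdivision ⌈D⌉₊ (s + s) s s rfl
  set c := (Finset.range (t + 1)).sup f with hc
  refine ⟨c * c * (2 * d), fun n G hG hω S => ?_⟩
  obtain ⟨κ⟩ : G.Colorable c := (colorable_chi G).mono
    ((hf G hG G ⟨SimpleGraph.Embedding.refl⟩).trans
      (Finset.le_sup (f := f) (Finset.mem_range.2 (by omega))))
  refine card_adjPairs_le κ (fun u v huv => κ.valid huv) S fun X _ Y _ hX hY hXY => ?_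
  by_contra hlt
  obtain ⟨m, H, hH, hcard⟩ := (hd n G X Y hX hY hXY (bicliqueFree_of_not_embeds (fun hK => by
    obtain ⟨m, K, hK, hiso⟩ := hC.exists_mem_iso hG hK
    exact hs ⟨m, K, hK, hiso⟩) hX hY hXY) (not_le.1 hlt)).exists_memITM
  exact absurd (ncard_edgeSet_le_of_avgDeg_le (hD H ⟨n, G, hG, hH⟩)) (not_le.2 hcard)

theorem boundedExpansion_of_memITM {C : GraphClass} (hC : Hereditary C) (hχ : ChiBounded C)
    (hs : ∃ s : ℕ, ¬ ∃ (n : ℕ) (G : SimpleGraph (Fin n)), G ∈ C n ∧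
      Nonempty (G ≃g completeBipartiteGraph (Fin s) (Fin s)))
    (hI : ∀ r : ℕ, 1 ≤ r → ∃ d : ℝ, ∀ ⦃m : ℕ⦄ (H : SimpleGraph (Fin m)),
      MemITMClass r C H → avgDeg H ≤ d) (t : ℕ) :
    BoundedExpansion (fun n => {G : SimpleGraph (Fin n) | G ∈ C n ∧ omegaNum G ≤ t}) := by
  intro r
  obtain ⟨d, hd⟩ := exists_card_adjPairs_le hC hχ hs (hI 1 le_rfl) t
  choose! D hD using hI
  set D' := (Finset.range (r + 1)).sup fun k => ⌈D k⌉₊ with hD'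
  obtain ⟨q, hq⟩ : ∃ q, q = 2 * (2 * (d * (r + 1)) + 2 * d) + 2 := ⟨_, rfl⟩
  refine ⟨_, fun m H ⟨n, G, ⟨hG, hω⟩, hH⟩ => avgDeg_le_of_ncard_edgeSet_le
    (k := d + (d * r + 1) * (4 * q * (r * D') + 1)) ?_⟩
  obtain ⟨B, F, hF, rfl, hFcard⟩ := hH.exists_linkSys
  rw [← hFcard]
  by_contra hlt
  obtain ⟨k, hk1, hkr, m, H', hH', hcard⟩ := hF.exists_memITM (hd n G hG hω) hq (not_le.1 hlt)
  have h1 := ncard_edgeSet_le_of_avgDeg_le (hD k hk1 H' ⟨n, G, hG, hH'⟩)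
  have h2 : ⌈D k⌉₊ ≤ D' :=
    Finset.le_sup (f := fun k => ⌈D k⌉₊) (Finset.mem_range.2 (by omega : k < r + 1))
  exact absurd (h1.trans (Nat.mul_le_mul_right _ h2)) (not_le.2 hcard)

theorem OmegaBoundedExpansion.of_boundedExpansion {C : GraphClass}
    (h : ∀ t : ℕ, 1 ≤ t →
      BoundedExpansion (fun n => {G : SimpleGraph (Fin n) | G ∈ C n ∧ omegaNum G ≤ t})) :
    OmegaBoundedExpansion C := by
  choose f hf using fun t => h (t + 1) (by omega)
  exact ⟨f, fun n G hG r m H hH => hf _ r H ⟨n, G, ⟨hG, Nat.le_succ _⟩, hH⟩⟩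

end Classes

/-! ## Consequences of restricted dualities -/

section Duality

theorem isAcyclicDigraph_of_rank {n : ℕ} {F : Fin n → Fin n → Prop} (ρ : Fin n → ℕ)
    (h : ∀ u v, F u v → ρ u < ρ v) : IsAcyclicDigraph F := by
  intro v hv
  have : ∀ w, Relation.TransGen F v w → ρ v < ρ w := by
    intro w hw
    induction hw with
    | single h1 => exact h _ _ h1
    | tail _ h1 ih => exact ih.trans (h _ _ h1)
  exact lt_irrefl _ (this v hv)

theorem connected_of_exists_lt_adj {n : ℕ} (G : SimpleGraph (Fin (n + 1)))
    (h : ∀ v, v ≠ 0 → ∃ u < v, G.Adj u v) : G.Connected := by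
  have hreach : ∀ v, G.Reachable 0 v := by
    intro v
    induction v using WellFoundedLT.induction with
    | _ v ih =>
      by_cases hv : v = 0
      · rw [hv]
      · obtain ⟨u, huv, hadj⟩ := h v hv
        exact (ih u huv).trans hadj.reachable
  exact (SimpleGraph.connected_iff _).2
    ⟨fun u v => (hreach u).symm.trans (hreach v), ⟨0⟩⟩

theorem not_loop_of_not_digraphHomEx {nF m : ℕ} {F : Fin nF → Fin nF → Prop}
    {D : Fin m → Fin m → Prop} (h : ¬ DigraphHomEx F D) (x : Fin m) : ¬ D x x :=
  fun hx => h ⟨fun _ => x, fun _ _ _ => hx⟩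

theorem ChiBounded.of_restrictedDual {C : GraphClass} (hC : Hereditary C)
    (h : ∀ (nF : ℕ) (F : Fin nF → Fin nF → Prop), IsAcyclicDigraph F →
      (SimpleGraph.fromRel F).Connected → HasRestrictedDualForOrientations C F) :
    ChiBounded C := by
  choose m D hFD hD using fun t : ℕ => h (t + 1) (fun u v => u < v)
    (isAcyclicDigraph_of_rank (fun u => u) fun _ _ h => h)
    (connected_of_exists_lt_adj _ fun v hv =>
      ⟨0, Fin.pos_iff_ne_zero.2 hv,
        (SimpleGraph.fromRel_adj _ _ _).2 ⟨Ne.symm hv, Or.inl (Fin.pos_iff_ne_zero.2 hv)⟩⟩)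
  refine ⟨m, fun n G hG k H hHG => ?_⟩
  have hH : H ∈ C k := hC G H hG hHG
  set t := omegaNum H with ht
  have hor : IsOrientationOf (fun u v => H.Adj u v ∧ u < v) H := by
    refine ⟨fun u v h => lt_asymm h.1.2 h.2.2, fun u v => ⟨fun huv => ?_, ?_⟩⟩
    · rcases lt_or_gt_of_ne huv.ne with h1 | h1
      · exact Or.inl ⟨huv, h1⟩
      · exact Or.inr ⟨huv.symm, h1⟩
    · rintro (h1 | h1)
      · exact h1.1
      · exact h1.1.symm
  have hno : ¬ DigraphHomEx (fun u v : Fin (t + 1) => u < v) (fun u v => H.Adj u v ∧ u < v) := by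
    rintro ⟨f, hf⟩
    have hinj : Function.Injective f := by
      intro u v huv
      by_contra hne
      rcases lt_or_gt_of_ne hne with h1 | h1
      · exact (hf u v h1).1.ne huv
      · exact (hf v u h1).1.ne huv.symm
    have := le_omegaNum (G := H) (m := t + 1) ⟨⟨f, fun {u v} huv => by
      rcases lt_or_gt_of_ne huv.ne with h1 | h1
      · exact (hf u v h1).1
      · exact (hf v u h1).1.symm⟩, hinj⟩
    omega
  obtain ⟨f, hf⟩ := (hD t _ H hH hor).1 hno
  refine Nat.sInf_le ⟨SimpleGraph.Coloring.mk f fun {u v} huv he => ?_⟩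
  rcases lt_or_gt_of_ne huv.ne with h1 | h1
  · have := hf u v ⟨huv, h1⟩
    rw [he] at this
    exact not_loop_of_not_digraphHomEx (hFD t) _ this
  · have := hf v u ⟨huv.symm, h1⟩
    rw [he] at this
    exact not_loop_of_not_digraphHomEx (hFD t) _ this

/-- Two disjoint orientations `0 → 1 → 2 → 3`, `0 → 3` of a `4`-cycle with an arc joining their
sources. -/
def twinCycles : Fin 8 → Fin 8 → Prop := fun u v =>
  (u, v) ∈ ([(0, 1), (1, 2), (2, 3), (0, 3), (4, 5), (5, 6), (6, 7), (4, 7), (0, 4)] :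
    List (Fin 8 × Fin 8))

instance : DecidableRel twinCycles := fun u v => by
  unfold twinCycles
  infer_instance

/-- The orientation of `K_{s,s}` in which a perfect matching is oriented backwards. -/
def matchedArc {s : ℕ} : Fin s ⊕ Fin s → Fin s ⊕ Fin s → Prop
  | Sum.inl i, Sum.inr j => i ≠ j
  | Sum.inr j, Sum.inl i => i = j
  | _, _ => False

theorem matchedArc_asymm {s : ℕ} (x y : Fin s ⊕ Fin s) : ¬ (matchedArc x y ∧ matchedArc y x) := by
  rintro ⟨h1, h2⟩
  rcases x with i | i <;> rcases y with j | j <;> simp only [matchedArc] at h1 h2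
  · exact h1 h2
  · exact h2 h1

theorem completeBipartiteGraph_adj_iff_matchedArc {s : ℕ} (x y : Fin s ⊕ Fin s) :
    (completeBipartiteGraph (Fin s) (Fin s)).Adj x y ↔ matchedArc x y ∨ matchedArc y x := by
  rcases x with i | i <;> rcases y with j | j <;> simp [matchedArc]
  · exact (em (i = j)).symm
  · exact em (j = i)

theorem exists_eq_inl_of_matchedArc {s : ℕ} {x₀ x₁ x₂ x₃ : Fin s ⊕ Fin s}
    (h1 : matchedArc x₀ x₁) (h2 : matchedArc x₁ x₂) (h3 : matchedArc x₂ x₃)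
    (h4 : matchedArc x₀ x₃) : ∃ i, x₀ = Sum.inl i := by
  rcases x₀ with i | i
  · exact ⟨i, rfl⟩
  · rcases x₁ with j | j <;> rcases x₂ with k | k <;> rcases x₃ with l | l <;>
      simp only [matchedArc] at h1 h2 h3 h4
    exact (h2 ((h1.trans h4.symm).trans h3)).elim

theorem exists_not_completeBipartite_of_restrictedDual {C : GraphClass}
    (h : ∀ (nF : ℕ) (F : Fin nF → Fin nF → Prop), IsAcyclicDigraph F →
      (SimpleGraph.fromRel F).Connected → HasRestrictedDualForOrientations C F) :
    ∃ s : ℕ, ¬ ∃ (n : ℕ) (G : SimpleGraph (Fin n)), G ∈ C n ∧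
      Nonempty (G ≃g completeBipartiteGraph (Fin s) (Fin s)) := by
  obtain ⟨m, D, hFD, hD⟩ := h 8 twinCycles
    (isAcyclicDigraph_of_rank (fun u => u) (by decide))
    (connected_of_exists_lt_adj _ (by simp only [SimpleGraph.fromRel_adj]; decide))
  have hdigon : ∀ x y, D x y → ¬ D y x := by
    intro x y hxy hyx
    have key : ∀ u v, twinCycles u v →
        decide (u ∈ ([0, 2, 5, 7] : List (Fin 8))) = !decide (v ∈ ([0, 2, 5, 7] : List (Fin 8))) := by
      decide
    refine hFD ⟨fun u => bif decide (u ∈ ([0, 2, 5, 7] : List (Fin 8))) then x else y,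
      fun u v huv => ?_⟩
    dsimp only
    rw [key u v huv]
    cases decide (v ∈ ([0, 2, 5, 7] : List (Fin 8)))
    · exact hxy
    · exact hyx
  refine ⟨m + 1, ?_⟩
  rintro ⟨n, G, hG, ⟨e⟩⟩
  have hor : IsOrientationOf (fun u v => matchedArc (e u) (e v)) G := by
    refine ⟨fun u v => matchedArc_asymm _ _, fun u v => ?_⟩
    rw [← e.map_adj_iff]
    exact completeBipartiteGraph_adj_iff_matchedArc _ _
  have hno : ¬ DigraphHomEx twinCycles (fun u v => matchedArc (e u) (e v)) := by
    rintro ⟨g, hg⟩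
    obtain ⟨i, hi⟩ := exists_eq_inl_of_matchedArc (hg 0 1 (by decide)) (hg 1 2 (by decide))
      (hg 2 3 (by decide)) (hg 0 3 (by decide))
    obtain ⟨j, hj⟩ := exists_eq_inl_of_matchedArc (hg 4 5 (by decide)) (hg 5 6 (by decide))
      (hg 6 7 (by decide)) (hg 4 7 (by decide))
    have h04 : matchedArc (e (g 0)) (e (g 4)) := hg 0 4 (by decide)
    rw [hi, hj] at h04
    exact h04
  obtain ⟨f, hf⟩ := (hD _ G hG hor).1 hno
  have hinj : Function.Injective fun i => f (e.symm (Sum.inl i)) := by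
    intro i j hij
    by_contra hne
    have h1 := hf (e.symm (Sum.inl i)) (e.symm (Sum.inr j)) (by simpa [matchedArc] using hne)
    have h2 := hf (e.symm (Sum.inr j)) (e.symm (Sum.inl j)) (by simp [matchedArc])
    simp only at hij
    rw [← hij] at h2
    exact hdigon _ _ h1 h2
  simpa using Fintype.card_le_of_injective _ hinj

/-- Two internally disjoint directed paths of lengths `r + 2` and `r` from `0` to `r + 2`. -/
def twoPaths (r : ℕ) : Fin (2 * r + 1 + 1) → Fin (2 * r + 1 + 1) → Prop := fun u v =>
  ((u : ℕ) + 1 = v ∧ (u : ℕ) ≤ r + 1) ∨ ((v : ℕ) + 1 = u ∧ r + 2 ≤ (v : ℕ)) ∨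
    ((u : ℕ) = 0 ∧ (v : ℕ) = 2 * r + 1)

theorem digraphHomEx_twoPaths {r m : ℕ} (hr : 1 ≤ r) {D : Fin m → Fin m → Prop} :
    DigraphHomEx (twoPaths r) D ↔ ∃ p q : ℕ → Fin m, (∀ k < r + 2, D (p k) (p (k + 1))) ∧
      (∀ k < r, D (q k) (q (k + 1))) ∧ p 0 = q 0 ∧ p (r + 2) = q r := by
  constructor
  · rintro ⟨f, hf⟩
    refine ⟨fun k => f (Fin.ofNat _ k), fun k => if k = 0 then f 0 else
      f (Fin.ofNat _ (2 * r + 2 - k)), fun k hk => hf _ _ ?_, fun k hk => ?_, by simp, ?_⟩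
    · left
      simp only [Fin.ofNat_eq_cast, Fin.val_natCast]
      rw [Nat.mod_eq_of_lt (by omega), Nat.mod_eq_of_lt (by omega)]
      omega
    · rcases Nat.eq_zero_or_pos k with rfl | hk0
      · simp only [if_true]
        rw [if_neg (by omega)]
        refine hf _ _ (Or.inr (Or.inr ?_))
        simp
      · simp only
        rw [if_neg (by omega), if_neg (by omega)]
        refine hf _ _ (Or.inr (Or.inl ?_))
        simp only [Fin.ofNat_eq_cast, Fin.val_natCast]
        rw [Nat.mod_eq_of_lt (by omega), Nat.mod_eq_of_lt (by omega)]
        omega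
    · simp only
      rw [if_neg (by omega), show 2 * r + 2 - r = r + 2 by omega]
  · rintro ⟨p, q, hp, hq, h0, h1⟩
    refine ⟨fun u => if (u : ℕ) ≤ r + 2 then p u else q (2 * r + 2 - u), fun u v huv => ?_⟩
    dsimp only
    have hu := u.2
    have hv := v.2
    rcases huv with ⟨h2, h3⟩ | ⟨h2, h3⟩ | ⟨h2, h3⟩
    · rw [if_pos (by omega), if_pos (by omega), ← h2]
      exact hp _ (by omega)
    · rw [if_neg (by omega)]
      have := hq (2 * r + 2 - u) (by omega)
      rw [show 2 * r + 2 - (u : ℕ) + 1 = 2 * r + 2 - v by omega] at this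
      split_ifs with h4
      · have h5 : (v : ℕ) = r + 2 := by omega
        rw [show 2 * r + 2 - (v : ℕ) = r by omega] at this
        rwa [h5, h1]
      · exact this
    · rw [if_pos (by omega), h2, h0]
      have := hq 0 (by omega)
      split_ifs with h4
      · have h5 : (v : ℕ) = r + 2 := by omega
        have h6 : r = 1 := by omega
        rw [h5, h1]
        subst h6
        exact this
      · rwa [show 2 * r + 2 - (v : ℕ) = 0 + 1 by omega]

section SubdivArc

variable {n r : ℕ} {H : SimpleGraph (Fin n)} {S : Set (Edges H)}

/-- The orientation of the `r`-subdivision of `H` in which every path is directed from the smaller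
to the larger end, except for the last edge in the paths replacing the edges in `S`. -/
def subdivArc (r : ℕ) {n : ℕ} {H : SimpleGraph (Fin n)} (S : Set (Edges H)) :
    (Fin n ⊕ Σ _ : Edges H, Fin r) → (Fin n ⊕ Σ _ : Edges H, Fin r) → Prop
  | Sum.inl u, Sum.inr ⟨e, i⟩ =>
      (u = e.1.1 ∧ (i : ℕ) = 0) ∨ (u = e.1.2 ∧ (i : ℕ) + 1 = r ∧ e ∈ S)
  | Sum.inr ⟨e, i⟩, Sum.inl v => v = e.1.2 ∧ (i : ℕ) + 1 = r ∧ e ∉ S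
  | Sum.inr ⟨e, i⟩, Sum.inr ⟨e', j⟩ => e = e' ∧ (i : ℕ) + 1 = (j : ℕ)
  | _, _ => False

theorem subdivArc_asymm (x y : Fin n ⊕ Σ _ : Edges H, Fin r) :
    ¬ (subdivArc r S x y ∧ subdivArc r S y x) := by
  rintro ⟨h1, h2⟩
  rcases x with u | ⟨e, i⟩ <;> rcases y with v | ⟨e', j⟩ <;> simp only [subdivArc] at h1 h2
  · rcases h1 with ⟨rfl, -⟩ | h1
    · exact e'.2.1.ne h2.1
    · exact h2.2.2 h1.2.2
  · rcases h2 with ⟨rfl, -⟩ | h2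
    · exact e.2.1.ne h1.1
    · exact h1.2.2 h2.2.2
  · omega

theorem subdiv_adj_iff_subdivArc (hr : 1 ≤ r) (x y : Fin n ⊕ Σ _ : Edges H, Fin r) :
    (Subdiv H fun _ => r).Adj x y ↔ subdivArc r S x y ∨ subdivArc r S y x := by
  rw [Subdiv, SimpleGraph.fromRel_adj]
  rcases x with u | ⟨e, i⟩ <;> rcases y with v | ⟨e', j⟩
  · simp only [subdivRel, subdivArc]
    constructor
    · rintro ⟨-, ⟨-, h⟩ | ⟨-, h⟩⟩ <;> omega
    · rintro (h | h) <;> exact h.elim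
  · simp only [subdivRel, subdivArc]
    by_cases hS : e' ∈ S <;> simp [hS]
  · simp only [subdivRel, subdivArc]
    by_cases hS : e ∈ S <;> simp [hS, or_comm]
  · simp only [subdivRel, subdivArc]
    constructor
    · exact fun h => h.2
    · refine fun h => ⟨?_, h⟩
      rintro ⟨⟩
      omega

/-- `x` is the `i`-th subdivision vertex of the edge `e`. -/
def IsInner {n r : ℕ} {H : SimpleGraph (Fin n)} (x : Fin n ⊕ Σ _ : Edges H, Fin r) (e : Edges H)
    (i : ℕ) : Prop :=
  ∃ h : i < r, x = Sum.inr ⟨e, ⟨i, h⟩⟩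

theorem IsInner.eq {x : Fin n ⊕ Σ _ : Edges H, Fin r} {e e' : Edges H} {i i' : ℕ}
    (h : IsInner x e i) (h' : IsInner x e' i') : e = e' ∧ i = i' := by
  obtain ⟨_, rfl⟩ := h
  obtain ⟨_, h'⟩ := h'
  cases h'
  exact ⟨rfl, rfl⟩

theorem not_isInner_inl {u : Fin n} {e : Edges H} {i : ℕ} :
    ¬ IsInner (r := r) (Sum.inl u) e i := by
  rintro ⟨_, h⟩
  cases h

theorem IsInner.step {x y : Fin n ⊕ Σ _ : Edges H, Fin r} {e : Edges H} {i : ℕ}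
    (h : IsInner x e i) (hxy : subdivArc r S x y) :
    IsInner y e (i + 1) ∨ (y = Sum.inl e.1.2 ∧ i + 1 = r ∧ e ∉ S) := by
  obtain ⟨hi, rfl⟩ := h
  rcases y with v | ⟨e', j, hj⟩
  · obtain ⟨rfl, h1, h2⟩ := hxy
    exact Or.inr ⟨rfl, h1, h2⟩
  · obtain ⟨rfl, h1⟩ := hxy
    simp only at h1
    subst h1
    exact Or.inl ⟨hj, rfl⟩

theorem exists_isInner_of_subdivArc_inl {u : Fin n} {y : Fin n ⊕ Σ _ : Edges H, Fin r}
    (h : subdivArc r S (Sum.inl u) y) :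
    ∃ e : Edges H, (IsInner y e 0 ∧ e.1.1 = u) ∨ (IsInner y e (r - 1) ∧ e.1.2 = u ∧ e ∈ S) := by
  rcases y with v | ⟨e, i, hi⟩
  · exact h.elim
  · rcases h with ⟨rfl, h1⟩ | ⟨rfl, h1, h2⟩ <;> simp only at h1
    · subst h1
      exact ⟨e, Or.inl ⟨⟨hi, rfl⟩, rfl⟩⟩
    · obtain rfl : i = r - 1 := by omega
      exact ⟨e, Or.inr ⟨⟨hi, rfl⟩, rfl, h2⟩⟩

theorem IsInner.not_step {x y : Fin n ⊕ Σ _ : Edges H, Fin r} {e : Edges H}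
    (h : IsInner x e (r - 1)) (he : e ∈ S) : ¬ subdivArc r S x y := by
  intro hxy
  rcases h.step hxy with h1 | h1
  · obtain ⟨h1, -⟩ := h1
    omega
  · exact h1.2.2 he

variable {p : ℕ → Fin n ⊕ Σ _ : Edges H, Fin r} {a L i : ℕ} {e : Edges H}

theorem IsInner.walk (h : IsInner (p a) e i)
    (hp : ∀ k, a ≤ k → k < a + L → subdivArc r S (p k) (p (k + 1))) :
    ∀ k ≤ L, i + k < r → IsInner (p (a + k)) e (i + k) := by
  intro k
  induction k with
  | zero => exact fun _ _ => h
  | succ k ih =>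
    intro hk hik
    rcases (ih (by omega) (by omega)).step (hp (a + k) (by omega) (by omega)) with h1 | h1
    · exact h1
    · omega

theorem IsInner.walk_end (h : IsInner (p a) e i)
    (hp : ∀ k, a ≤ k → k < a + L → subdivArc r S (p k) (p (k + 1))) (hL : r ≤ i + L) :
    p (a + (r - i)) = Sum.inl e.1.2 ∧ e ∉ S := by
  have hi : i < r := h.1
  have h1 := h.walk hp (r - 1 - i) (by omega) (by omega)
  have h2 := hp (a + (r - 1 - i)) (by omega) (by omega)
  rw [show a + (r - 1 - i) + 1 = a + (r - i) by omega] at h2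
  rcases h1.step h2 with ⟨h3, -⟩ | h3
  · omega
  · exact ⟨h3.1, h3.2.2⟩

theorem exists_isInner_of_walk {u : Fin n} (h : p a = Sum.inl u)
    (h1 : subdivArc r S (p a) (p (a + 1))) (h2 : subdivArc r S (p (a + 1)) (p (a + 2))) :
    ∃ e : Edges H, IsInner (p (a + 1)) e 0 ∧ e.1.1 = u := by
  rw [h] at h1
  obtain ⟨e, h3 | h3⟩ := exists_isInner_of_subdivArc_inl h1
  · exact ⟨e, h3⟩
  · exact absurd h2 (h3.1.not_step h3.2.2)

theorem not_walks_subdivArc (hr : 1 ≤ r) (p q : ℕ → Fin n ⊕ Σ _ : Edges H, Fin r)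
    (hp : ∀ k < r + 2, subdivArc r S (p k) (p (k + 1)))
    (hq : ∀ k < r, subdivArc r S (q k) (q (k + 1))) (h0 : p 0 = q 0) : p (r + 2) ≠ q r := by
  intro hend
  rcases hx : p 0 with u | ⟨e, i, hi⟩
  · obtain ⟨e, he, heu⟩ := exists_isInner_of_walk hx (hp 0 (by omega)) (hp 1 (by omega))
    obtain ⟨h1, heS⟩ := he.walk_end (S := S) (L := r) (fun k _ hk => hp k (by omega)) (by omega)
    rw [show 0 + 1 + (r - 0) = r + 1 by omega] at h1
    have h2 := hp (r + 1) (by omega)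
    rw [h1] at h2
    obtain ⟨e', he'⟩ := exists_isInner_of_subdivArc_inl h2
    have h3 := hq 0 (by omega)
    rw [← h0, hx] at h3
    obtain ⟨f, hf⟩ := exists_isInner_of_subdivArc_inl h3
    have hqr : IsInner (q r) f (r - 1) := by
      rcases hf with ⟨hf, -⟩ | ⟨hf, -, hfS⟩
      · have := hf.walk (S := S) (L := r - 1) (fun k _ hk => hq k (by omega)) (r - 1) le_rfl
          (by omega)
        rwa [show 0 + 1 + (r - 1) = r by omega, Nat.zero_add] at this
      · rcases Nat.lt_or_ge 1 r with h4 | h4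
        · exact absurd (hq 1 h4) (hf.not_step hfS)
        · obtain rfl : r = 1 := by omega
          exact hf
    have hlt := e.2.1
    have hlt' := f.2.1
    rw [← hend] at hqr
    rcases he' with ⟨he', h4⟩ | ⟨he', h4, h5⟩ <;> obtain ⟨rfl, -⟩ := he'.eq hqr <;>
      rcases hf with ⟨-, h6⟩ | ⟨-, h6, -⟩
    · rw [heu, ← h6, h4] at hlt
      exact lt_irrefl _ hlt
    · rw [h4, h6, ← heu] at hlt'
      exact lt_asymm hlt hlt'
    · have : e = e' := Subtype.ext (Prod.ext (heu.trans h6.symm) h4.symm)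
      exact heS (this ▸ h5)
    · rw [heu, ← h6, h4] at hlt
      exact lt_irrefl _ hlt
  · have he : IsInner (p 0) e i := ⟨hi, hx⟩
    obtain ⟨h1, heS⟩ := he.walk_end (S := S) (L := r + 2) (fun k _ hk => hp k (by omega))
      (by omega)
    obtain ⟨h2, -⟩ := (h0 ▸ he).walk_end (S := S) (L := r) (fun k _ hk => hq k (by omega))
      (by omega)
    rw [Nat.zero_add] at h1 h2
    obtain ⟨e', he', hev⟩ := exists_isInner_of_walk h1 (hp _ (by omega)) (hp _ (by omega))
    have hlt' := e'.2.1
    have hpend : (IsInner (p (r + 2)) e' (i + 1)) ∨ p (r + 2) = Sum.inl e'.1.2 := by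
      rcases Nat.lt_or_ge (i + 1) r with h3 | h3
      · have := he'.walk (S := S) (L := i + 1) (fun k _ hk => hp k (by omega)) (i + 1) le_rfl
          (by omega)
        rw [show r - i + 1 + (i + 1) = r + 2 by omega, Nat.zero_add] at this
        exact Or.inl this
      · have := (he'.walk_end (S := S) (L := i + 1) (fun k _ hk => hp k (by omega)) (by omega)).1
        rw [show r - i + 1 + (r - 0) = r + 2 by omega] at this
        exact Or.inr this
    rw [hend] at hpend
    rcases Nat.eq_zero_or_pos i with rfl | hi0
    · rw [Nat.sub_zero] at h2
      rw [h2] at hpend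
      rcases hpend with h3 | h3
      · exact not_isInner_inl h3
      · rw [Sum.inl.injEq] at h3
        rw [hev, h3] at hlt'
        exact lt_irrefl _ hlt'
    · have h3 := hq (r - i) (by omega)
      rw [h2] at h3
      obtain ⟨f, hf⟩ := exists_isInner_of_subdivArc_inl h3
      have hqend : IsInner (q r) f (i - 1) ∨ (IsInner (q r) f (r - 1) ∧ f.1.2 = e.1.2) := by
        rcases hf with ⟨hf, -⟩ | ⟨hf, h4, hfS⟩
        · have := hf.walk (S := S) (L := i - 1) (fun k _ hk => hq k (by omega)) (i - 1) le_rfl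
            (by omega)
          rw [show r - i + 1 + (i - 1) = r by omega, Nat.zero_add] at this
          exact Or.inl this
        · rcases Nat.lt_or_ge 1 i with h5 | h5
          · exact absurd (hq (r - i + 1) (by omega)) (hf.not_step hfS)
          · rw [show r - i + 1 = r by omega] at hf
            exact Or.inr ⟨hf, h4⟩
      rcases hpend with h4 | h4
      · rcases hqend with h5 | ⟨h5, h6⟩
        · have := (h4.eq h5).2
          omega
        · obtain ⟨rfl, -⟩ := h4.eq h5
          rw [hev, h6] at hlt'
          exact lt_irrefl _ hlt'
      · rw [h4] at hqend
        rcases hqend with h5 | ⟨h5, -⟩ <;> exact not_isInner_inl h5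

theorem subdivArc_subdivSeq (hr : 1 ≤ r) {s : ℕ} (hs : s < r ∨ (s = r ∧ e ∉ S)) :
    subdivArc r S (subdivSeq (fun _ => r) e s) (subdivSeq (fun _ => r) e (s + 1)) := by
  rcases s with _ | s
  · have h0 : 0 < r := hr
    simp only [subdivSeq, if_true, Nat.zero_add, Nat.sub_self, h0, dite_true, one_ne_zero, if_false]
    exact Or.inl ⟨rfl, rfl⟩
  · have h1 : s < r := by omega
    simp only [subdivSeq, Nat.add_sub_cancel, h1, dite_true, Nat.succ_ne_zero, if_false]
    rcases hs with hs | ⟨hs, he⟩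
    · simp only [hs, dite_true]
      exact ⟨rfl, rfl⟩
    · rw [dif_neg (by omega)]
      exact ⟨rfl, hs, he⟩

theorem subdivArc_subdivSeq_last (hr : 1 ≤ r) (he : e ∈ S) :
    subdivArc r S (Sum.inl e.1.2) (subdivSeq (fun _ => r) e r) := by
  obtain ⟨r, rfl⟩ : ∃ k, r = k + 1 := ⟨r - 1, by omega⟩
  simp only [subdivSeq, Nat.add_sub_cancel, Nat.lt_succ_self, dite_true, Nat.succ_ne_zero, if_false]
  exact Or.inr ⟨rfl, rfl, he⟩

end SubdivArc

theorem isAcyclicDigraph_twoPaths (r : ℕ) : IsAcyclicDigraph (twoPaths r) := by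
  refine isAcyclicDigraph_of_rank
    (fun j => if (j : ℕ) ≤ r + 1 then (2 * j : ℕ) else 2 * (2 * r + 2 - j) + 3) fun u v h => ?_
  have hu := u.2
  have hv := v.2
  rcases h with h | h | h <;> split_ifs <;> omega

theorem connected_twoPaths (r : ℕ) : (SimpleGraph.fromRel (twoPaths r)).Connected := by
  refine connected_of_exists_lt_adj _ fun v hv => ⟨⟨v - 1, by omega⟩, ?_, ?_⟩
  · have := Fin.pos_iff_ne_zero.2 hv
    rw [Fin.lt_def] at this ⊢
    simp at this ⊢
    omega
  · have := Fin.pos_iff_ne_zero.2 hv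
    rw [Fin.lt_def] at this
    simp only [Fin.val_zero] at this
    rw [SimpleGraph.fromRel_adj]
    refine ⟨fun h => ?_, ?_⟩
    · have := congrArg Fin.val h
      simp only at this
      omega
    · simp only [twoPaths]
      omega

theorem ncard_edgeSet_le_of_restrictedDual {C : GraphClass} (hC : Hereditary C) {r m : ℕ}
    (hr : 1 ≤ r) {D : Fin m → Fin m → Prop} (hFD : ¬ DigraphHomEx (twoPaths r) D)
    (hD : ∀ ⦃n : ℕ⦄ (A : Fin n → Fin n → Prop) (G : SimpleGraph (Fin n)), G ∈ C n →
      IsOrientationOf A G → (¬ DigraphHomEx (twoPaths r) A ↔ DigraphHomEx A D))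
    {n : ℕ} {H : SimpleGraph (Fin n)} (hH : MemITMClass r C H) :
    H.edgeSet.ncard ≤ m * n := by
  obtain ⟨k, G, hG, hHG⟩ := hH
  obtain ⟨N, G', hG', ⟨e⟩⟩ := hC.exists_mem_iso hG hHG
  have hf : ∀ S : Set (Edges H), ∃ f : (Fin n ⊕ Σ _ : Edges H, Fin r) → Fin m,
      ∀ x y, subdivArc r S x y → D (f x) (f y) := by
    intro S
    have hor : IsOrientationOf (fun u v => subdivArc r S (e u) (e v)) G' :=
      ⟨fun u v => subdivArc_asymm _ _, fun u v => by
        rw [← e.map_adj_iff]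
        exact subdiv_adj_iff_subdivArc hr _ _⟩
    have hno : ¬ DigraphHomEx (twoPaths r) (fun u v => subdivArc r S (e u) (e v)) := by
      rw [digraphHomEx_twoPaths hr]
      rintro ⟨p, q, hp, hq, h0, h1⟩
      exact not_walks_subdivArc hr (fun k => e (p k)) (fun k => e (q k)) hp hq
        (congrArg e h0) (congrArg e h1)
    obtain ⟨f, hf⟩ := (hD _ G' hG' hor).1 hno
    exact ⟨fun x => f (e.symm x), fun x y hxy => hf _ _ (by simpa using hxy)⟩
  choose f hf using hf
  have key : ∀ S S' : Set (Edges H), (∀ i, f S (Sum.inl i) = f S' (Sum.inl i)) → S' ⊆ S := by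
    intro S S' hSS' a ha'
    by_contra ha
    refine hFD ((digraphHomEx_twoPaths hr).2
      ⟨fun k => if k ≤ r + 1 then f S (subdivSeq (fun _ => r) a k)
        else f S' (subdivSeq (fun _ => r) a r),
      fun k => f S' (subdivSeq (fun _ => r) a k), fun k hk => ?_, fun k hk => ?_, ?_, ?_⟩)
    · dsimp only
      rcases Nat.lt_or_ge k (r + 1) with h1 | h1
      · rw [if_pos (by omega), if_pos (by omega)]
        exact hf _ _ _ (subdivArc_subdivSeq hr (by
          rcases Nat.lt_or_ge k r with h2 | h2
          · exact Or.inl h2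
          · exact Or.inr ⟨by omega, ha⟩))
      · obtain rfl : k = r + 1 := by omega
        rw [if_pos le_rfl, if_neg (by omega)]
        have : subdivSeq (fun _ => r) a (r + 1) = Sum.inl a.1.2 := by simp [subdivSeq]
        rw [this, hSS']
        exact hf _ _ _ (subdivArc_subdivSeq_last hr ha')
    · exact hf _ _ _ (subdivArc_subdivSeq hr (Or.inl hk))
    · simpa [subdivSeq] using hSS' _
    · simp
  have hinj : Function.Injective fun (S : Set (Edges H)) (i : Fin n) => f S (Sum.inl i) :=
    fun S S' h => Set.Subset.antisymm (key S' S fun i => (congrFun h i).symm)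
      (key S S' fun i => congrFun h i)
  have hcard := Fintype.card_le_of_injective _ hinj
  rw [Fintype.card_set, Fintype.card_fun, Fintype.card_fin, Fintype.card_fin] at hcard
  rw [ncard_edgeSet_eq_card_edges]
  have h1 : m ^ n ≤ (2 ^ m) ^ n := Nat.pow_le_pow_left Nat.lt_two_pow_self.le n
  rw [← pow_mul] at h1
  exact (Nat.pow_le_pow_iff_right (by norm_num)).1 (hcard.trans h1)

theorem avgDeg_le_of_restrictedDual {C : GraphClass} (hC : Hereditary C)
    (h : ∀ (nF : ℕ) (F : Fin nF → Fin nF → Prop), IsAcyclicDigraph F →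
      (SimpleGraph.fromRel F).Connected → HasRestrictedDualForOrientations C F)
    {r : ℕ} (hr : 1 ≤ r) :
    ∃ d : ℝ, ∀ ⦃m : ℕ⦄ (H : SimpleGraph (Fin m)), MemITMClass r C H → avgDeg H ≤ d := by
  obtain ⟨m, D, hFD, hD⟩ := h _ (twoPaths r) (isAcyclicDigraph_twoPaths r) (connected_twoPaths r)
  exact ⟨2 * m, fun n H hH => avgDeg_le_of_ncard_edgeSet_le
    (ncard_edgeSet_le_of_restrictedDual hC hr hFD hD hH)⟩

end Duality

/-! ## Restricted dualities from low tree-depth colorings -/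

section Dual

/-- Digraphs with labels with label-preserving homomorphisms to each other. -/
def LabelHomEquiv {V W L : Type} (A : V → V → Prop) (l : V → L) (B : W → W → Prop)
    (l' : W → L) : Prop :=
  (∃ f : A →r B, ∀ v, l' (f v) = l v) ∧ ∃ g : B →r A, ∀ w, l (g w) = l' w

/-- The disjoint union of a family of digraphs. -/
def sigmaArc {ι : Type} {T : ι → Type} (arc : ∀ i, T i → T i → Prop) (x y : Σ i, T i) : Prop :=
  ∃ i a b, x = ⟨i, a⟩ ∧ y = ⟨i, b⟩ ∧ arc i a b

theorem sigmaArc_mk_iff {ι : Type} {T : ι → Type} {arc : ∀ i, T i → T i → Prop} {i : ι}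
    {a b : T i} : sigmaArc arc ⟨i, a⟩ ⟨i, b⟩ ↔ arc i a b := by
  constructor
  · rintro ⟨j, a', b', h1, h2, h⟩
    cases h1
    cases h2
    exact h
  · exact fun h => ⟨i, a, b, rfl, rfl, h⟩

/-- The digraph obtained by adding a root to a digraph in which the labels record the arcs from and
to the root. -/
def optionArc {T L : Type} (arc : T → T → Prop) (lab : T → L × Prop × Prop) :
    Option T → Option T → Prop
  | none, none => False
  | none, some y => (lab y).2.1
  | some x, none => (lab x).2.2
  | some x, some y => arc x y

theorem IsForestOrder.exists_root {V : Type} [Finite V] {r : V → V → Prop} (hr : IsForestOrder r)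
    (v : V) : ∃ w, r w v ∧ ∀ u, r u w → u = w := by
  obtain ⟨hrefl, hanti, htrans, -⟩ := hr
  obtain ⟨w, hw, hmin⟩ := Set.exists_min_image {u | r u v} (fun u => {x | r x u}.ncard)
    (Set.toFinite _) ⟨v, hrefl v⟩
  refine ⟨w, hw, fun u hu => hanti _ _ hu ?_⟩
  have h1 : {x | r x u} ⊆ {x | r x w} := fun x hx => htrans _ _ _ hx hu
  have h2 := Set.eq_of_subset_of_ncard_le h1 (hmin u (htrans _ _ _ hu hw)) (Set.toFinite _)
  exact h2.symm.subset (hrefl w)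

theorem exists_finite_labelHomEquiv (h : ℕ) : ∀ (L : Type) [Finite L],
    ∃ (ι : Type) (_ : Finite ι) (T : ι → Type) (_ : ∀ i, Finite (T i))
      (arc : ∀ i, T i → T i → Prop) (lab : ∀ i, T i → L),
      ∀ (V : Type) [Finite V] (A : V → V → Prop) (l : V → L) (r : V → V → Prop),
        (∀ v, ¬ A v v) → IsForestOrder r → (∀ u v, A u v → r u v ∨ r v u) →
        (∀ v, {u | r u v}.ncard ≤ h) → ∃ i, LabelHomEquiv A l (arc i) (lab i) := by
  induction h with
  | zero =>
    intro L _
    refine ⟨Unit, inferInstance, fun _ => Empty, inferInstance, fun _ _ _ => False,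
      fun _ => Empty.elim, ?_⟩
    intro V _ A l r _ hr _ hcard
    have : IsEmpty V := ⟨fun v => by
      have h1 := (Set.ncard_eq_zero (Set.toFinite _)).1 (Nat.le_zero.1 (hcard v))
      exact Set.notMem_empty v (h1 ▸ hr.1 v)⟩
    exact ⟨(), ⟨⟨isEmptyElim, fun {a} => isEmptyElim a⟩, isEmptyElim⟩,
      ⟨⟨Empty.elim, fun {a} => a.elim⟩, fun a => a.elim⟩⟩
  | succ h ih =>
    intro L _
    obtain ⟨ι, _, T, _, arc, lab, hT⟩ := ih (L × Prop × Prop)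
    refine ⟨Set (ι × L), inferInstance, fun S => Σ κ : S, Option (T κ.1.1), inferInstance,
      fun S => sigmaArc fun κ => optionArc (arc κ.1.1) (lab κ.1.1),
      fun S x => x.2.elim x.1.1.2 fun y => (lab x.1.1.1 y).1, ?_⟩
    intro V _ A l r hirr hr hcomp hcard
    have hr' := hr
    obtain ⟨hrefl, hanti, htrans, hchain⟩ := hr'
    have hsub : ∀ w : V, (∀ u, r u w → u = w) → ∃ i, LabelHomEquiv
        (fun u v : {v // r w v ∧ v ≠ w} => A u v) (fun v => (l v, A w v, A v w))
        (arc i) (lab i) := by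
      intro w hw
      refine hT _ _ _ (fun u v => r u v) (fun v => hirr v) ⟨fun v => hrefl v,
        fun u v h1 h2 => Subtype.ext (hanti _ _ h1 h2), fun u v x => htrans _ _ _,
        fun u v x => hchain _ _ _⟩ (fun u v => hcomp _ _) fun v => ?_
      rw [← Set.ncard_image_of_injective _ Subtype.val_injective]
      have h1 : Subtype.val '' {u : {v // r w v ∧ v ≠ w} | r u v} ⊆ {u | r u v} \ {w} := by
        rintro _ ⟨u, hu, rfl⟩
        exact ⟨hu, u.2.2⟩
      have h2 := Set.ncard_le_ncard h1 (Set.toFinite _)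
      rw [Set.ncard_sdiff_singleton_of_mem (show w ∈ {u | r u v.1} from v.2.1)] at h2
      have h3 := hcard v
      omega
    choose root hroot hrootmin using hr.exists_root
    choose i hi using hsub
    choose f hf using fun w hw => (hi w hw).1
    choose g hg using fun w hw => (hi w hw).2
    have hroot_eq : ∀ u v, r u v → root u = root v := fun u v huv => by
      rcases hchain _ _ _ (htrans _ _ _ (hroot u) huv) (hroot v) with h1 | h1
      · exact hrootmin v _ h1
      · exact (hrootmin u _ h1).symm
    have hroot_adj : ∀ u v, A u v → root u = root v := fun u v huv =>
      (hcomp u v huv).elim (hroot_eq u v) fun h1 => (hroot_eq v u h1).symm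
    let S : Set (ι × L) := {κ | ∃ w, ∃ hw : ∀ u, r u w → u = w, κ = (i w hw, l w)}
    refine ⟨S, ?_, ?_⟩
    · classical
      let φ : ∀ w (hw : ∀ u, r u w → u = w), {v // r w v} → Option (T (i w hw)) := fun w hw v =>
        if hv : v.1 = w then none else some (f w hw ⟨v, v.2, hv⟩)
      have hφ : ∀ w hw (u v : {v // r w v}), A u v →
          optionArc (arc (i w hw)) (lab (i w hw)) (φ w hw u) (φ w hw v) := by
        rintro w hw ⟨u, hu⟩ ⟨v, hv⟩ huv
        change A u v at huv
        simp only [φ]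
        split_ifs with h1 h2 h2
        · exact hirr w (by rwa [h1, h2] at huv)
        · simp only [optionArc]
          rw [hf]
          rwa [h1] at huv
        · simp only [optionArc]
          rw [hf]
          rwa [h2] at huv
        · exact (f w hw).map_rel huv
      have hφl : ∀ w hw (v : {v // r w v}),
          (φ w hw v).elim (l w) (fun y => (lab (i w hw) y).1) = l v := by
        rintro w hw ⟨v, hv⟩
        simp only [φ]
        split_ifs with h1
        · rw [h1]; rfl
        · simp only [Option.elim_some]
          rw [hf]
      refine ⟨⟨fun v => ⟨⟨(i (root v) (hrootmin v), l (root v)), root v, hrootmin v, rfl⟩,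
        φ (root v) (hrootmin v) ⟨v, hroot v⟩⟩, fun {u v} huv => ?_⟩, fun v => hφl _ _ _⟩
      have key : ∀ w hw w' hw' (hwu : r w u) (hwv : r w' v), w = w' →
          sigmaArc (fun κ : S => optionArc (arc κ.1.1) (lab κ.1.1))
            ⟨⟨(i w hw, l w), w, hw, rfl⟩, φ w hw ⟨u, hwu⟩⟩
            ⟨⟨(i w' hw', l w'), w', hw', rfl⟩, φ w' hw' ⟨v, hwv⟩⟩ := by
        rintro w hw _ hw' hwu hwv rfl
        exact sigmaArc_mk_iff.2 (hφ w hw _ _ huv)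
      exact key _ _ _ _ _ _ (hroot_adj u v huv)
    · have hg' : ∀ κ : S, ∃ ψ : Option (T κ.1.1) → V,
          (∀ x y, optionArc (arc κ.1.1) (lab κ.1.1) x y → A (ψ x) (ψ y)) ∧
          ∀ x, l (ψ x) = x.elim κ.1.2 fun y => (lab κ.1.1 y).1 := by
        rintro ⟨_, w, hw, rfl⟩
        refine ⟨fun x => x.elim w fun y => g w hw y, ?_, ?_⟩
        · rintro (_ | x) (_ | y) hxy
          · exact hxy.elim
          · have := hg w hw y
            simp only [optionArc, ← this] at hxy
            exact hxy
          · have := hg w hw x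
            simp only [optionArc, ← this] at hxy
            exact hxy
          · exact (g w hw).map_rel hxy
        · rintro (_ | x)
          · rfl
          · exact congrArg Prod.fst (hg w hw x)
      choose ψ hψ hψl using hg'
      refine ⟨⟨fun x => ψ x.1 x.2, ?_⟩, fun x => hψl _ _⟩
      rintro _ _ ⟨κ, a, b, rfl, rfl, hab⟩
      exact hψ κ a b hab

theorem exists_transitive {V : Type*} [DecidableEq V] (A : V → V → Prop) (k : ℕ) :
    ∀ S : Finset V, 2 ^ k ≤ S.card → (∀ u ∈ S, ∀ v ∈ S, u ≠ v → A u v ∨ A v u) →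
      ∃ g : Fin k → V, (∀ i, g i ∈ S) ∧ ∀ i j, i < j → A (g i) (g j) := by
  classical
  induction k with
  | zero => exact fun S _ _ => ⟨Fin.elim0, fun i => i.elim0, fun i => i.elim0⟩
  | succ k ih =>
    intro S hS hA
    obtain ⟨v, hv⟩ : S.Nonempty := Finset.card_pos.1 (lt_of_lt_of_le (by positivity) hS)
    have hcard := Finset.card_filter_add_card_filter_not (s := S.erase v) (A v)
    rw [Finset.card_erase_of_mem hv] at hcard
    rw [pow_succ] at hS
    rcases Nat.lt_or_ge ((S.erase v).filter (A v)).card (2 ^ k) with h1 | h1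
    · obtain ⟨g, hg, hgA⟩ := ih ((S.erase v).filter fun u => ¬ A v u) (by omega) fun u hu w hw =>
        hA u (by simp_all) w (by simp_all)
      have hg' : ∀ i, g i ∈ S ∧ A (g i) v := fun i => by
        have := hg i
        simp only [Finset.mem_filter, Finset.mem_erase] at this
        exact ⟨this.1.2, (hA _ this.1.2 _ hv this.1.1).resolve_right this.2⟩
      refine ⟨Fin.snoc (α := fun _ => V) g v, fun i => ?_, fun i j => ?_⟩
      · refine Fin.lastCases ?_ (fun i => ?_) i
        · simpa using hv
        · simpa using (hg' i).1
      · refine Fin.lastCases (fun h => absurd h (Fin.le_last _).not_gt) (fun i => ?_) i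
        refine Fin.lastCases (fun _ => ?_) (fun j hij => ?_) j
        · simpa using (hg' i).2
        · simpa using hgA i j (by simpa using hij)
    · obtain ⟨g, hg, hgA⟩ := ih ((S.erase v).filter (A v)) h1 fun u hu w hw =>
        hA u (by simp_all) w (by simp_all)
      have hg' : ∀ i, g i ∈ S ∧ A v (g i) := fun i => by
        have := hg i
        simp only [Finset.mem_filter, Finset.mem_erase] at this
        exact ⟨this.1.2, this.2⟩
      refine ⟨Fin.cons (α := fun _ => V) v g, fun i => ?_, fun i j => ?_⟩
      · refine Fin.cases ?_ (fun i => ?_) i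
        · simpa using hv
        · simpa using (hg' i).1
      · refine Fin.cases (fun h => absurd h (Fin.zero_le _).not_gt) (fun j => ?_) j
        refine Fin.cases (fun _ => ?_) (fun i hij => ?_) i
        · simpa using (hg' j).2
        · simpa using hgA i j (by simpa using hij)

theorem omegaNum_lt_of_not_digraphHomEx {k n : ℕ} {F : Fin k → Fin k → Prop}
    (hF : IsAcyclicDigraph F) {A : Fin n → Fin n → Prop} {G : SimpleGraph (Fin n)}
    (hA : IsOrientationOf A G) (h : ¬ DigraphHomEx F A) : omegaNum G < 2 ^ k := by
  by_contra! hk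
  have hmem : omegaNum G ∈ {m | IsSubgraphOf (⊤ : SimpleGraph (Fin m)) G} := by
    refine Nat.sSup_mem ⟨0, ⟨⟨Fin.elim0, fun {a} => a.elim0⟩, fun a => a.elim0⟩⟩ ⟨n, ?_⟩
    rintro m ⟨f, hf⟩
    simpa using Fintype.card_le_of_injective f hf
  obtain ⟨f, hf⟩ := hmem
  obtain ⟨g, -, hg⟩ := exists_transitive A k (Finset.univ.map ⟨f, hf⟩) (by simpa using hk) (by
    simp only [Finset.mem_map, Finset.mem_univ, true_and, Function.Embedding.coeFn_mk]
    rintro _ ⟨x, rfl⟩ _ ⟨y, rfl⟩ hxy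
    exact (hA.2 _ _).1 (f.map_adj fun h => hxy (congrArg f h)))
  have hlt : ∀ u, {w | Relation.TransGen F w u}.ncard < k := fun u => by
    have h1 : {w | Relation.TransGen F w u} ⊂ Set.univ :=
      Set.ssubset_univ_iff.2 fun h => hF u (h.symm ▸ Set.mem_univ u :
        u ∈ {w | Relation.TransGen F w u})
    simpa using Set.ncard_lt_ncard h1 (Set.toFinite _)
  refine h ⟨fun u => g ⟨_, hlt u⟩, fun u v huv => hg _ _ ?_⟩
  refine Set.ncard_lt_ncard ⟨fun w hw => Relation.TransGen.tail hw huv, fun h => ?_⟩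
    (Set.toFinite _)
  exact hF u (h (Relation.TransGen.single huv))

theorem exists_coloring_of_chiP_le {n p N : ℕ} {G : SimpleGraph (Fin n)} (h : chiP G p ≤ N) :
    ∃ c : Fin n → Fin N, ∀ I : Finset (Fin N), I.card ≤ p →
      TreeDepthLE (G.induce {v | c v ∈ I}) p := by
  have hne : {N | ∃ c : Fin n → Fin N, ∀ I : Finset (Fin N), I.card ≤ p →
      TreeDepthLE (G.induce {v | c v ∈ I}) I.card}.Nonempty := by
    refine ⟨n, id, fun I _ => ⟨fun u v => u ≤ v, ⟨fun v => le_rfl, fun u v => le_antisymm,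
      fun u v w => le_trans, fun u v _ _ _ => le_total u v⟩, fun u v _ => le_total u v,
      fun v => ?_⟩⟩
    rw [← Set.ncard_coe_finset I, ← Set.ncard_image_of_injective _ Subtype.val_injective]
    refine Set.ncard_le_ncard ?_ (Set.toFinite _)
    rintro _ ⟨u, -, rfl⟩
    exact u.2
  obtain ⟨c, hc⟩ : ∃ c : Fin n → Fin (chiP G p), ∀ I : Finset (Fin (chiP G p)), I.card ≤ p →
      TreeDepthLE (G.induce {v | c v ∈ I}) I.card := Nat.sInf_mem hne
  refine ⟨fun v => Fin.castLE h (c v), fun I hI => ?_⟩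
  set J := Finset.univ.filter fun x => Fin.castLE h x ∈ I with hJ
  have hset : {v | Fin.castLE h (c v) ∈ I} = {v | c v ∈ J} := by
    ext v
    simp [hJ]
  have hcard : J.card ≤ p := (Finset.card_le_card_of_injOn (Fin.castLE h)
    (fun x hx => (Finset.mem_filter.1 hx).2) (Fin.castLE_injective h).injOn).trans hI
  rw [hset]
  obtain ⟨r, h1, h2, h3⟩ := hc J hcard
  exact ⟨r, h1, h2, fun v => (h3 v).trans hcard⟩

theorem exists_target_of_treeDepth (p : ℕ) {k : ℕ} {F : Fin k → Fin k → Prop}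
    (hconn : (SimpleGraph.fromRel F).Connected) :
    ∃ (U : Type) (_ : Finite U) (B : U → U → Prop), IsEmpty (F →r B) ∧
      ∀ (V : Type) [Finite V] (A : V → V → Prop) (G : SimpleGraph V),
        (∀ u v, A u v → G.Adj u v) → TreeDepthLE G p → IsEmpty (F →r A) → Nonempty (A →r B) := by
  obtain ⟨ι, _, T, _, arc, lab, hT⟩ := exists_finite_labelHomEquiv p Unit
  refine ⟨Σ i : {i // IsEmpty (F →r arc i)}, T i, inferInstance, sigmaArc fun i => arc i,
    ⟨fun f => ?_⟩, fun V _ A G hAG hG hFA => ?_⟩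
  · have hadj : ∀ u v, F u v → (f u).1 = (f v).1 := by
      intro u v huv
      obtain ⟨i, a, b, h1, h2, -⟩ := f.map_rel huv
      rw [h1, h2]
    have hreach : ∀ u v, (SimpleGraph.fromRel F).Reachable u v → (f u).1 = (f v).1 := by
      rintro u v ⟨w⟩
      induction w with
      | nil => rfl
      | cons h _ ih =>
        rw [← ih]
        rcases ((SimpleGraph.fromRel_adj _ _ _).1 h).2 with h1 | h1
        · exact hadj _ _ h1
        · exact (hadj _ _ h1).symm
    obtain ⟨u₀⟩ := hconn.nonempty
    have hex : ∀ u, ∃ a : T (f u₀).1, f u = ⟨(f u₀).1, a⟩ := by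
      intro u
      rw [hreach u₀ u (hconn.preconnected _ _)]
      exact ⟨_, rfl⟩
    choose a ha using hex
    refine (f u₀).1.2.elim ⟨a, fun {u v} huv => ?_⟩
    have := f.map_rel huv
    rw [ha u, ha v] at this
    exact (sigmaArc_mk_iff (T := fun i : {i // IsEmpty (F →r arc i)} => T i)).1 this
  · obtain ⟨r, hr, hcomp, hcard⟩ := hG
    obtain ⟨i, ⟨f, -⟩, ⟨g, -⟩⟩ := hT V A (fun _ => ()) r (fun v h => (hAG v v h).ne rfl) hr
      (fun u v h => hcomp u v (hAG u v h)) hcard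
    exact ⟨⟨fun v => ⟨⟨i, ⟨fun f' => hFA.elim (g.comp f')⟩⟩, f v⟩,
      fun huv => sigmaArc_mk_iff.2 (f.map_rel huv)⟩⟩

theorem hasRestrictedDual_of_stronglyChiPBounded {C : GraphClass} {k : ℕ}
    (h : StronglyChiPBounded C k) {F : Fin k → Fin k → Prop} (hF : IsAcyclicDigraph F)
    (hconn : (SimpleGraph.fromRel F).Connected) : HasRestrictedDualForOrientations C F := by
  classical
  obtain ⟨f, hf⟩ := h
  set N := (Finset.range (2 ^ k)).sup f with hN
  obtain ⟨U, _, B, hFB, hB⟩ := exists_target_of_treeDepth k hconn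
  let X := Σ i : Fin N, ({I : Finset (Fin N) // I.card ≤ k ∧ i ∈ I} → U)
  let E : X → X → Prop := fun x y => ∀ (I : Finset (Fin N)) (hI : I.card ≤ k) (hx : x.1 ∈ I)
    (hy : y.1 ∈ I), B (x.2 ⟨I, hI, hx⟩) (y.2 ⟨I, hI, hy⟩)
  have hFE : IsEmpty (F →r E) := by
    refine ⟨fun φ => ?_⟩
    have hI : (Finset.univ.image fun v => (φ v).1).card ≤ k :=
      Finset.card_image_le.trans (by simp)
    have hmem : ∀ u, (φ u).1 ∈ Finset.univ.image fun v => (φ v).1 := fun u =>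
      Finset.mem_image_of_mem _ (Finset.mem_univ u)
    exact hFB.elim ⟨fun u => (φ u).2 ⟨_, hI, hmem u⟩,
      fun {u v} huv => φ.map_rel huv _ hI (hmem u) (hmem v)⟩
  obtain ⟨m, ⟨e⟩⟩ := Finite.exists_equiv_fin X
  refine ⟨m, fun x y => E (e.symm x) (e.symm y), ?_, fun n A G hG hA => ⟨fun hFA => ?_, ?_⟩⟩
  · rintro ⟨φ, hφ⟩
    exact hFE.elim ⟨fun u => e.symm (φ u), fun {u v} huv => hφ u v huv⟩
  · have hχ : chiP G k ≤ N := (hf G hG).trans (Finset.le_sup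
      (Finset.mem_range.2 (omegaNum_lt_of_not_digraphHomEx hF hA hFA)))
    obtain ⟨c, hc⟩ := exists_coloring_of_chiP_le hχ
    have hhom : ∀ I : Finset (Fin N), I.card ≤ k →
        Nonempty ((fun u v : {v | c v ∈ I} => A u v) →r B) := fun I hI =>
      hB _ _ (G.induce {v | c v ∈ I}) (fun u v huv => (hA.2 u v).2 (Or.inl huv)) (hc I hI)
        ⟨fun φ => hFA ⟨fun u => (φ u).1, fun u v huv => φ.map_rel huv⟩⟩
    let φ := fun I hI => Classical.choice (hhom I hI)
    refine ⟨fun v => e ⟨c v, fun J => φ J.1 J.2.1 ⟨v, J.2.2⟩⟩, fun u v huv => ?_⟩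
    simp only [Equiv.symm_apply_apply]
    exact fun I hI hx hy => (φ I hI).map_rel huv
  · rintro ⟨φ, hφ⟩ ⟨ψ, hψ⟩
    exact hFE.elim ⟨fun u => e.symm (φ (ψ u)), fun {u v} huv => hφ _ _ (hψ u v huv)⟩

end Dual

/-- characterization of strongly `χ_p`-bounded hereditary classes. -/
theorem strongly_chiP_bounded_tfae (C : GraphClass) (hC : Hereditary C) :
    List.TFAE [
      -- (i) strongly χ_p-bounded for every positive p
      ∀ p : ℕ, 1 ≤ p → StronglyChiPBounded C p,
      -- (ii) each 𝒞_t has bounded expansion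
      ∀ t : ℕ, 1 ≤ t →
        BoundedExpansion (fun n => {G : SimpleGraph (Fin n) | G ∈ C n ∧ omegaNum G ≤ t}),
      -- (iii) ω-bounded expansion
      OmegaBoundedExpansion C,
      -- (iv) χ-bounded, some K_{s,s} missing, and bounded average degree of ITM_r^e(𝒞)
      ChiBounded C ∧
        (∃ s : ℕ, ¬ ∃ (n : ℕ) (G : SimpleGraph (Fin n)), G ∈ C n ∧
            Nonempty (G ≃g completeBipartiteGraph (Fin s) (Fin s))) ∧
        (∀ r : ℕ, 1 ≤ r → ∃ d : ℝ, ∀ ⦃m : ℕ⦄ (H : SimpleGraph (Fin m)),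
            MemITMClass r C H → avgDeg H ≤ d),
      -- (v) every connected acyclically oriented graph has a restricted dual
      ∀ (nF : ℕ) (F : Fin nF → Fin nF → Prop),
        IsAcyclicDigraph F → (SimpleGraph.fromRel F).Connected →
        HasRestrictedDualForOrientations C F
    ] := by
  tfae_have 1 → 5 := fun h nF F hF hconn => by
    obtain ⟨u⟩ := hconn.nonempty
    exact hasRestrictedDual_of_stronglyChiPBounded (h nF u.pos) hF hconn
  tfae_have 5 → 4 := fun h => ⟨ChiBounded.of_restrictedDual hC h,
    exists_not_completeBipartite_of_restrictedDual h, fun _ hr => avgDeg_le_of_restrictedDual hC h hr⟩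
  tfae_have 4 → 2 := fun h t _ => boundedExpansion_of_memITM hC h.1 h.2.1 h.2.2 t
  tfae_have 2 → 3 := OmegaBoundedExpansion.of_boundedExpansion
  tfae_have 3 → 1 := fun h p _ => StronglyChiPBounded.of_omegaBoundedExpansion h p
  tfae_finish
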